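/- arXiv:1412.8713 — 5 statements merged into one kernel-verified Lean document; each statement's English description precedes it below -/
import Mathlib

section
/- Let (x^1(t),…,x^N(t)) solve ẋ^i = (1/4)((x^{i+1}−x^i)^2 − (x^i−x^{i−1})^2) with x^0 := −x^1, x^{N+1} := 2−x^N. Assume there are positive constants c_0, C_0 with c_0/N ≤ x^i(0)−x^{i−1}(0) ≤ C_0/N for all i. Let X(t,θ) solve ∂_t X = (1/2)∂_θX ∂²_{θθ}X with X(t,0)=0, X(t,1)=1, from X_0 ∈ C^{4,α}([0,1]) with c_0 ≤ ∂_θX_0 ≤ C_0. Set μ_t^N := (1/N)Σ_{i=1}^N δ_{x^i(t)}. Then there exist constants c̄, C̄ > 0, depending only on c_0, C_0 and ‖X_0‖_{C^{4,α}([0,1])}, such that MK_1(μ_t^N, dθ) ≤ e^{−c̄ t/N^3} + C̄/N^2 + 1/(4N) for all t ≥ 0; in particular MK_1(μ_t^N, dθ) ≤ 1/(4N) + (C̄+1)/N^2 for all t ≥ 2N^3 log N / c̄. -/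
open MeasureTheory

/-- The reference grid points `(i - 1/2)/N`. -/
noncomputable def grid (N i : ℕ) : ℝ := ((i : ℝ) - 1 / 2) / N

/-- Extension of a finite family `v 1, …, v N` by the boundary conventions
`v 0 := -v 1` and `v (N+1) := 2 - v N`. -/
noncomputable def pad (N : ℕ) (v : ℕ → ℝ) : ℕ → ℝ :=
  fun i => if i = 0 then -v 1 else if i = N + 1 then 2 - v N else v i

/-- `f` is of class `C^{4,α}` on `[0,1]` with all relevant norms bounded by `K`. -/
def C4HolderBound (α K : ℝ) (f : ℝ → ℝ) : Prop :=
  ContDiff ℝ 4 f ∧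
    (∀ k : ℕ, k ≤ 4 → ∀ θ ∈ Set.Icc (0 : ℝ) 1, |iteratedDeriv k f θ| ≤ K) ∧
    ∀ θ ∈ Set.Icc (0 : ℝ) 1, ∀ θ' ∈ Set.Icc (0 : ℝ) 1,
      |iteratedDeriv 4 f θ - iteratedDeriv 4 f θ'| ≤ K * |θ - θ'| ^ α

theorem pad_zero (N : ℕ) (v : ℕ → ℝ) : pad N v 0 = -v 1 := by simp [pad]

theorem pad_succ_last (N : ℕ) (v : ℕ → ℝ) : pad N v (N + 1) = 2 - v N := by simp [pad]

theorem pad_of_mem {N i : ℕ} (v : ℕ → ℝ) (h1 : 1 ≤ i) (hN : i ≤ N) : pad N v i = v i := by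
  have h0 : i ≠ 0 := by omega
  have h2 : i ≠ N + 1 := by omega
  simp [pad, h0, h2]

theorem sum_Icc_one_eq_sum_range (N : ℕ) (f : ℕ → ℝ) :
    ∑ i ∈ Finset.Icc 1 N, f i = ∑ i ∈ Finset.range N, f (i + 1) := by
  induction N with
  | zero => simp
  | succ n ih => rw [Finset.sum_Icc_succ_top (by omega), ih, Finset.sum_range_succ]

/-- A solution of `u' ≥ -u² / 2` which is positive at time zero stays positive. -/
theorem pos_of_neg_half_sq_le_deriv {u u' : ℝ → ℝ} (h0 : 0 < u 0)
    (hu : ∀ t, 0 ≤ t → HasDerivAt u (u' t) t) (hu' : ∀ t, 0 ≤ t → -(u t ^ 2 / 2) ≤ u' t)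
    {t : ℝ} (ht : 0 ≤ t) : 0 < u t := by
  have hpos : ∀ s, 0 ≤ s → 0 < 1 / u 0 + s := fun s hs => by positivity
  have key : -u t ≤ -(1 / u 0 + t)⁻¹ := by
    refine image_le_of_deriv_right_lt_deriv_boundary' (a := 0) (b := t)
      (f := fun s => -u s) (f' := fun s => -u' s) (B := fun s => -(1 / u 0 + s)⁻¹)
      (B' := fun s => ((1 / u 0 + s) ^ 2)⁻¹) ?_ ?_ ?_ ?_ ?_ ?_ ⟨ht, le_rfl⟩
    · exact fun s hs => (hu s hs.1).neg.continuousAt.continuousWithinAt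
    · exact fun s hs => (hu s hs.1).neg.hasDerivWithinAt
    · simp
    · refine ContinuousOn.neg (ContinuousOn.inv₀ (by fun_prop) ?_)
      exact fun s hs => (hpos s hs.1).ne'
    · intro s hs
      have h := (((hasDerivAt_id s).const_add (1 / u 0)).inv (hpos s hs.1).ne').neg
      refine (h.congr_deriv ?_).hasDerivWithinAt
      simp [neg_div]
    · intro s hs heq
      have h1 := hu' s hs.1
      have h2 : u s = (1 / u 0 + s)⁻¹ := neg_injective heq
      have h3 : 0 < u s := by rw [h2]; exact inv_pos.2 (hpos s hs.1)
      rw [← inv_pow, ← h2]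
      nlinarith
  have := inv_pos.2 (hpos t ht)
  linarith

/-- Summation by parts for a family which is odd with respect to both ends. -/
theorem sum_mul_sub_eq_of_reflect (N : ℕ) (p q : ℕ → ℝ) (h0 : p 0 = -p 1)
    (hN : p (N + 1) = -p N) :
    ∑ i ∈ Finset.range N, p (i + 1) * (q (i + 2) - q (i + 1)) =
      -(1 / 2) * ∑ i ∈ Finset.range N,
        ((p (i + 2) - p (i + 1)) * q (i + 2) + (p (i + 1) - p i) * q (i + 1)) := by
  have h := Finset.sum_range_sub (fun i => 1 / 2 * (p i + p (i + 1)) * q (i + 1)) N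
  rw [h0, hN] at h
  rw [← sub_eq_zero, Finset.mul_sum, ← Finset.sum_sub_distrib]
  convert h using 1
  · exact Finset.sum_congr rfl fun i _ => by ring
  · ring

theorem sum_sq_le_of_reflect (N : ℕ) (p : ℕ → ℝ) (h0 : p 0 = -p 1) :
    ∑ i ∈ Finset.range N, p (i + 1) ^ 2 ≤
      (N : ℝ) ^ 2 / 2 * ∑ i ∈ Finset.range N,
        ((p (i + 2) - p (i + 1)) ^ 2 + (p (i + 1) - p i) ^ 2) := by
  set r : ℕ → ℝ := fun i => 1 / 2 * (|p (i + 2) - p (i + 1)| + |p (i + 1) - p i|) with hr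
  have hr0 : ∀ i, 0 ≤ r i := fun i => by positivity
  have hS : ∀ k, |p (k + 1)| + 1 / 2 * |p (k + 2) - p (k + 1)| ≤
      ∑ i ∈ Finset.range (k + 1), r i := by
    intro k
    induction k with
    | zero =>
      have : |p 1 - p 0| = 2 * |p 1| := by
        rw [h0, show p 1 - -p 1 = 2 * p 1 by ring, abs_mul]; norm_num
      simp only [zero_add, Finset.sum_range_one, hr, this]
      linarith
    | succ k ih =>
      rw [Finset.sum_range_succ]
      have := abs_add_le (p (k + 1)) (p (k + 2) - p (k + 1))
      rw [add_sub_cancel] at this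
      simp only [hr] at ih ⊢
      linarith
  have hsq : (∑ i ∈ Finset.range N, r i) ^ 2 ≤ N * ∑ i ∈ Finset.range N, r i ^ 2 := by
    simpa using sq_sum_le_card_mul_sum_sq (s := Finset.range N) (f := r)
  have hterm : ∑ i ∈ Finset.range N, r i ^ 2 ≤ 1 / 2 * ∑ i ∈ Finset.range N,
      ((p (i + 2) - p (i + 1)) ^ 2 + (p (i + 1) - p i) ^ 2) := by
    rw [Finset.mul_sum]
    refine Finset.sum_le_sum fun i _ => ?_
    rw [← sq_abs (p (i + 2) - p (i + 1)), ← sq_abs (p (i + 1) - p i)]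
    simp only [hr]
    nlinarith [sq_nonneg (|p (i + 2) - p (i + 1)| - |p (i + 1) - p i|)]
  have hpt : ∀ i ∈ Finset.range N, p (i + 1) ^ 2 ≤ (∑ i ∈ Finset.range N, r i) ^ 2 := by
    intro i hi
    rw [← sq_abs]
    refine pow_le_pow_left₀ (abs_nonneg _) ?_ 2
    have h1 := hS i
    have h2 : ∑ j ∈ Finset.range (i + 1), r j ≤ ∑ j ∈ Finset.range N, r j :=
      Finset.sum_le_sum_of_subset_of_nonneg
        (Finset.range_mono (Finset.mem_range.1 hi)) fun j _ _ => hr0 j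
    have h3 := abs_nonneg (p (i + 2) - p (i + 1))
    linarith
  have hsum := Finset.sum_le_sum hpt
  rw [Finset.sum_const, Finset.card_range, nsmul_eq_mul] at hsum
  have hN : (0 : ℝ) ≤ N := N.cast_nonneg
  calc _ ≤ _ := hsum
    _ ≤ N * (N * (1 / 2 * ∑ i ∈ Finset.range N,
        ((p (i + 2) - p (i + 1)) ^ 2 + (p (i + 1) - p i) ^ 2))) := by
      refine mul_le_mul_of_nonneg_left (hsq.trans ?_) hN
      exact mul_le_mul_of_nonneg_left hterm hN
    _ = _ := by ring

/-- The midpoint rule for `1`-Lipschitz functions. -/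
theorem LipschitzWith.midpoint_sub_integral_le {φ : ℝ → ℝ} (hφ : LipschitzWith 1 φ) (g : ℝ)
    {h : ℝ} (hh : 0 ≤ h) : 2 * h * φ g - ∫ θ in (g - h)..(g + h), φ θ ≤ h ^ 2 := by
  have hc := hφ.continuous
  have hlip : ∀ θ, φ g - |g - θ| ≤ φ θ := fun θ => by
    have h1 := hφ.dist_le_mul g θ
    rw [Real.dist_eq, Real.dist_eq, NNReal.coe_one, one_mul] at h1
    have := le_abs_self (φ g - φ θ)
    linarith
  have hl : ∫ θ in (g - h)..g, (φ g - g + θ) ≤ ∫ θ in (g - h)..g, φ θ := by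
    refine intervalIntegral.integral_mono_on (by linarith)
      (Continuous.intervalIntegrable (by fun_prop) _ _) (hc.intervalIntegrable _ _) ?_
    intro θ hθ
    have := hlip θ
    rw [abs_of_nonneg (by linarith [hθ.2])] at this
    linarith
  have hr : ∫ θ in g..(g + h), (φ g + g - θ) ≤ ∫ θ in g..(g + h), φ θ := by
    refine intervalIntegral.integral_mono_on (by linarith)
      (Continuous.intervalIntegrable (by fun_prop) _ _) (hc.intervalIntegrable _ _) ?_
    intro θ hθ
    have := hlip θ
    rw [abs_of_nonpos (by linarith [hθ.1])] at this
    linarith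
  rw [intervalIntegral.integral_add (by simp) (by simp), intervalIntegral.integral_const,
    integral_id, smul_eq_mul] at hl
  rw [intervalIntegral.integral_sub (by simp) (by simp), intervalIntegral.integral_const,
    integral_id, smul_eq_mul] at hr
  rw [← intervalIntegral.integral_add_adjacent_intervals (hc.intervalIntegrable (g - h) g)
    (hc.intervalIntegrable g (g + h))]
  nlinarith

theorem LipschitzWith.grid_average_sub_integral_le {φ : ℝ → ℝ} (hφ : LipschitzWith 1 φ) {N : ℕ}
    (hN : 1 ≤ N) :
    (1 / (N : ℝ)) * ∑ i ∈ Finset.range N, φ (grid N (i + 1)) - ∫ θ in (0 : ℝ)..1, φ θ ≤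
      1 / (4 * (N : ℝ)) := by
  have hN0 : (0 : ℝ) < N := by exact_mod_cast hN
  have hadd := intervalIntegral.sum_integral_adjacent_intervals (f := φ) (μ := volume)
    (a := fun k => (k : ℝ) / N) (n := N) fun k _ => hφ.continuous.intervalIntegrable _ _
  simp only [Nat.cast_zero, zero_div, div_self hN0.ne'] at hadd
  rw [← hadd, Finset.mul_sum, ← Finset.sum_sub_distrib]
  have hterm : ∀ i ∈ Finset.range N, 1 / (N : ℝ) * φ (grid N (i + 1)) -
      ∫ θ in ((i : ℝ) / N)..(((i + 1 : ℕ) : ℝ) / N), φ θ ≤ (1 / (2 * (N : ℝ))) ^ 2 := by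
    intro i _
    have h := hφ.midpoint_sub_integral_le (grid N (i + 1)) (h := 1 / (2 * (N : ℝ)))
      (by positivity)
    have e1 : grid N (i + 1) - 1 / (2 * (N : ℝ)) = (i : ℝ) / N := by
      unfold grid; push_cast; field_simp; ring
    have e2 : grid N (i + 1) + 1 / (2 * (N : ℝ)) = ((i + 1 : ℕ) : ℝ) / N := by
      unfold grid; push_cast; field_simp; ring
    rw [e1, e2] at h
    have e3 : 2 * (1 / (2 * (N : ℝ))) = 1 / N := by field_simp
    rwa [e3] at h
  refine (Finset.sum_le_sum hterm).trans (le_of_eq ?_)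
  rw [Finset.sum_const, Finset.card_range, nsmul_eq_mul]
  field_simp
  norm_num

theorem LipschitzWith.average_sub_integral_le {φ : ℝ → ℝ} (hφ : LipschitzWith 1 φ) {N : ℕ}
    (hN : 1 ≤ N) (v : ℕ → ℝ) {r : ℝ} (hr : 0 ≤ r)
    (hv : ∑ i ∈ Finset.range N, (v (i + 1) - grid N (i + 1)) ^ 2 ≤ N * r ^ 2) :
    (1 / (N : ℝ)) * ∑ i ∈ Finset.Icc 1 N, φ (v i) - ∫ θ in (0 : ℝ)..1, φ θ ≤
      r + 1 / (4 * (N : ℝ)) := by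
  have hN0 : (0 : ℝ) < N := by exact_mod_cast hN
  rw [sum_Icc_one_eq_sum_range N fun i => φ (v i)]
  have hgrid := hφ.grid_average_sub_integral_le hN
  have hdiff : ∑ i ∈ Finset.range N, φ (v (i + 1)) - ∑ i ∈ Finset.range N, φ (grid N (i + 1)) ≤
      ∑ i ∈ Finset.range N, |v (i + 1) - grid N (i + 1)| := by
    rw [← Finset.sum_sub_distrib]
    refine Finset.sum_le_sum fun i _ => ?_
    have h1 := hφ.dist_le_mul (v (i + 1)) (grid N (i + 1))
    rw [Real.dist_eq, Real.dist_eq, NNReal.coe_one, one_mul] at h1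
    exact (le_abs_self _).trans h1
  have hsq : (∑ i ∈ Finset.range N, |v (i + 1) - grid N (i + 1)|) ^ 2 ≤ (N * r) ^ 2 := by
    have h := sq_sum_le_card_mul_sum_sq (s := Finset.range N)
      (f := fun i => |v (i + 1) - grid N (i + 1)|)
    simp only [sq_abs, Finset.card_range] at h
    nlinarith
  have habs := le_of_sq_le_sq hsq (by positivity)
  have hmean : 1 / (N : ℝ) * (∑ i ∈ Finset.range N, φ (v (i + 1)) -
      ∑ i ∈ Finset.range N, φ (grid N (i + 1))) ≤ r := by
    rw [one_div, inv_mul_le_iff₀ hN0]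
    exact hdiff.trans habs
  linarith

section Flow

variable {N : ℕ} {x : ℝ → ℕ → ℝ}

theorem hasDerivAt_pad {v : ℕ → ℝ} {t : ℝ} (hN : 1 ≤ N)
    (hx : ∀ i ∈ Finset.Icc 1 N, HasDerivAt (fun s => x s i) (v i) t) :
    ∀ i ≤ N + 1, HasDerivAt (fun s => pad N (x s) i)
      (if i = 0 then -v 1 else if i = N + 1 then -v N else v i) t := by
  intro i hi
  rcases Nat.eq_zero_or_pos i with rfl | h1
  · simpa [pad] using (hx 1 (Finset.mem_Icc.2 ⟨le_rfl, hN⟩)).fun_neg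
  rcases eq_or_lt_of_le hi with rfl | h2
  · simpa [pad] using (hx N (Finset.mem_Icc.2 ⟨hN, le_rfl⟩)).const_sub 2
  · have e1 : i ≠ 0 := by omega
    have e2 : i ≠ N + 1 := by omega
    simpa [pad, e1, e2] using hx i (Finset.mem_Icc.2 ⟨h1, by omega⟩)

/-- The gaps between consecutive points stay positive along the flow. -/
theorem pad_gap_pos (hN : 1 ≤ N)
    (hx : ∀ t, 0 ≤ t → ∀ i ∈ Finset.Icc 1 N, HasDerivAt (fun s => x s i)
      ((1 / 4) * ((pad N (x t) (i + 1) - pad N (x t) i) ^ 2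
        - (pad N (x t) i - pad N (x t) (i - 1)) ^ 2)) t)
    (h0 : ∀ i ≤ N, 0 < pad N (x 0) (i + 1) - pad N (x 0) i)
    {t : ℝ} (ht : 0 ≤ t) {i : ℕ} (hi : i ≤ N) :
    0 < pad N (x t) (i + 1) - pad N (x t) i := by
  refine pos_of_neg_half_sq_le_deriv (h0 i hi) (fun s hs =>
    (hasDerivAt_pad hN (hx s hs) (i + 1) (by omega)).sub
      (hasDerivAt_pad hN (hx s hs) i (by omega))) (fun s _ => ?_) ht
  rcases Nat.eq_zero_or_pos i with rfl | h1
  · have hN0 : N ≠ 0 := by omega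
    simp [hN0]
    nlinarith [sq_nonneg (pad N (x s) 2 - pad N (x s) 1)]
  rcases eq_or_lt_of_le hi with rfl | h2
  · have e1 : i ≠ 0 := by omega
    simp [e1]
    nlinarith [sq_nonneg (pad i (x s) i - pad i (x s) (i - 1))]
  · have e1 : i ≠ 0 := by omega
    have e2 : i ≠ N + 1 := by omega
    have e3 : i ≠ N := by omega
    simp [e1, e2, e3]
    nlinarith [sq_nonneg (pad N (x s) i - pad N (x s) (i - 1)),
      sq_nonneg (pad N (x s) (i + 1 + 1) - pad N (x s) (i + 1))]

theorem flow_dissipation_le {v : ℕ → ℝ} (hN : 1 ≤ N)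
    (hgap : ∀ i ≤ N, 0 ≤ pad N v (i + 1) - pad N v i) :
    ∑ i ∈ Finset.range N, 2 * (v (i + 1) - grid N (i + 1)) *
        ((1 / 4) * ((pad N v (i + 2) - pad N v (i + 1)) ^ 2
          - (pad N v (i + 1) - pad N v i) ^ 2)) ≤
      -(1 / (2 * (N : ℝ) ^ 3)) *
        ∑ i ∈ Finset.range N, (v (i + 1) - grid N (i + 1)) ^ 2 := by
  have hN0 : (0 : ℝ) < N := by exact_mod_cast hN
  set p : ℕ → ℝ := fun i => pad N v i - grid N i with hp
  set q : ℕ → ℝ := fun i => (pad N v i - pad N v (i - 1)) ^ 2 - (1 / (N : ℝ)) ^ 2 with hq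
  have hpv : ∀ i ∈ Finset.range N, v (i + 1) - grid N (i + 1) = p (i + 1) := fun i hi => by
    simp only [hp]
    rw [pad_of_mem v (by omega) (Finset.mem_range.1 hi)]
  have hp0 : p 0 = -p 1 := by
    simp only [hp]
    rw [pad_zero, pad_of_mem v le_rfl hN]
    unfold grid; push_cast; ring
  have hpN : p (N + 1) = -p N := by
    simp only [hp]
    rw [pad_succ_last, pad_of_mem v hN le_rfl]
    unfold grid; push_cast; field_simp; ring
  have hδ : ∀ i, pad N v (i + 1) - pad N v i = p (i + 1) - p i + 1 / N := fun i => by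
    simp only [hp]
    unfold grid; push_cast; field_simp; ring
  have hdis : ∀ i ≤ N, 1 / (N : ℝ) * (p (i + 1) - p i) ^ 2 ≤ (p (i + 1) - p i) * q (i + 1) := by
    intro i hi
    have h1 := hgap i hi
    rw [hδ] at h1
    simp only [hq, Nat.add_sub_cancel, hδ]
    nlinarith [mul_nonneg (sq_nonneg (p (i + 1) - p i)) h1]
  have hpoin := sum_sq_le_of_reflect N p hp0
  have hparts := sum_mul_sub_eq_of_reflect N p q hp0 hpN
  have hlow : 1 / (N : ℝ) * ∑ i ∈ Finset.range N,
        ((p (i + 2) - p (i + 1)) ^ 2 + (p (i + 1) - p i) ^ 2) ≤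
      ∑ i ∈ Finset.range N,
        ((p (i + 2) - p (i + 1)) * q (i + 2) + (p (i + 1) - p i) * q (i + 1)) := by
    rw [Finset.mul_sum]
    refine Finset.sum_le_sum fun i hi => ?_
    have hi := Finset.mem_range.1 hi
    have h1 := hdis i hi.le
    have h2 := hdis (i + 1) hi
    rw [mul_add]
    exact add_le_add h2 h1
  have hL : ∑ i ∈ Finset.range N, 2 * (v (i + 1) - grid N (i + 1)) *
        ((1 / 4) * ((pad N v (i + 2) - pad N v (i + 1)) ^ 2
          - (pad N v (i + 1) - pad N v i) ^ 2)) =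
      1 / 2 * ∑ i ∈ Finset.range N, p (i + 1) * (q (i + 2) - q (i + 1)) := by
    rw [Finset.mul_sum]
    refine Finset.sum_congr rfl fun i hi => ?_
    rw [hpv i hi]
    simp only [hq, Nat.add_sub_cancel, show i + 2 - 1 = i + 1 by omega]
    ring
  have hR : ∑ i ∈ Finset.range N, (v (i + 1) - grid N (i + 1)) ^ 2 =
      ∑ i ∈ Finset.range N, p (i + 1) ^ 2 :=
    Finset.sum_congr rfl fun i hi => by rw [hpv i hi]
  rw [hL, hR, hparts]
  set G := ∑ i ∈ Finset.range N, ((p (i + 2) - p (i + 1)) ^ 2 + (p (i + 1) - p i) ^ 2)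
  have hG : 1 / (2 * (N : ℝ) ^ 3) * ∑ i ∈ Finset.range N, p (i + 1) ^ 2 ≤
      1 / 4 * (1 / (N : ℝ) * G) := by
    refine (mul_le_mul_of_nonneg_left hpoin (by positivity)).trans (le_of_eq ?_)
    field_simp
    ring
  linarith

theorem sum_sq_sub_grid_le (hN : 1 ≤ N)
    (hx : ∀ t, 0 ≤ t → ∀ i ∈ Finset.Icc 1 N, HasDerivAt (fun s => x s i)
      ((1 / 4) * ((pad N (x t) (i + 1) - pad N (x t) i) ^ 2
        - (pad N (x t) i - pad N (x t) (i - 1)) ^ 2)) t)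
    (h0 : ∀ i ≤ N, 0 < pad N (x 0) (i + 1) - pad N (x 0) i) {t : ℝ} (ht : 0 ≤ t) :
    ∑ i ∈ Finset.range N, (x t (i + 1) - grid N (i + 1)) ^ 2 ≤
      (∑ i ∈ Finset.range N, (x 0 (i + 1) - grid N (i + 1)) ^ 2) *
        Real.exp (-(1 / (2 * (N : ℝ) ^ 3)) * t) := by
  set c : ℝ := 1 / (2 * (N : ℝ) ^ 3)
  set E : ℝ → ℝ := fun s => ∑ i ∈ Finset.range N, (x s (i + 1) - grid N (i + 1)) ^ 2 with hE
  set E' : ℝ → ℝ := fun s => ∑ i ∈ Finset.range N, 2 * (x s (i + 1) - grid N (i + 1)) *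
        ((1 / 4) * ((pad N (x s) (i + 2) - pad N (x s) (i + 1)) ^ 2
          - (pad N (x s) (i + 1) - pad N (x s) i) ^ 2)) with hE'
  have hder : ∀ s, 0 ≤ s → HasDerivAt E (E' s) s := by
    intro s hs
    refine HasDerivAt.fun_sum fun i hi => ?_
    have h := hx s hs (i + 1) (Finset.mem_Icc.2 ⟨by omega, Finset.mem_range.1 hi⟩)
    exact ((h.sub_const (grid N (i + 1))).pow 2).congr_deriv (by simp)
  have hle : ∀ s, 0 ≤ s → E' s ≤ -c * E s := fun s hs =>
    flow_dissipation_le hN fun i hi => (pad_gap_pos hN hx h0 hs hi).le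
  have hder2 : ∀ s, 0 ≤ s → HasDerivAt (fun s => E s * Real.exp (c * s))
      (E' s * Real.exp (c * s) + E s * (Real.exp (c * s) * c)) s := fun s hs =>
    (hder s hs).mul (((hasDerivAt_id s).const_mul c).exp.congr_deriv (by simp))
  have hanti : AntitoneOn (fun s => E s * Real.exp (c * s)) (Set.Ici 0) := by
    refine antitoneOn_of_deriv_nonpos (convex_Ici 0)
      (fun s hs => (hder2 s hs).continuousAt.continuousWithinAt) ?_ ?_
    · intro s hs
      rw [interior_Ici] at hs
      exact (hder2 s hs.le).differentiableAt.differentiableWithinAt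
    · intro s hs
      rw [interior_Ici] at hs
      rw [(hder2 s hs.le).deriv]
      nlinarith [hle s hs.le, Real.exp_pos (c * s)]
  have h := hanti Set.self_mem_Ici ht ht
  simp only [mul_zero, Real.exp_zero, mul_one] at h
  change E t ≤ E 0 * _
  rw [neg_mul, Real.exp_neg, ← div_eq_mul_inv, le_div_iff₀ (Real.exp_pos _)]
  exact h

theorem sum_sq_sub_grid_le_card {v : ℕ → ℝ}
    (hgap : ∀ i ≤ N, 0 ≤ pad N v (i + 1) - pad N v i) :
    ∑ i ∈ Finset.range N, (v (i + 1) - grid N (i + 1)) ^ 2 ≤ N := by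
  have hterm : ∀ i ∈ Finset.range N, (v (i + 1) - grid N (i + 1)) ^ 2 ≤ 1 := by
    intro i hi
    have hi := Finset.mem_range.1 hi
    have hN0 : (0 : ℝ) < N := by exact_mod_cast (by omega : 0 < N)
    have hmono : ∀ a b, a ≤ b → b ≤ N + 1 → pad N v a ≤ pad N v b := by
      intro a b hab
      induction b, hab using Nat.le_induction with
      | base => exact fun _ => le_rfl
      | succ b _ ih => exact fun hb => (ih (by omega)).trans (sub_nonneg.1 (hgap b (by omega)))
    have h1 := hmono 0 1 (by omega) (by omega)
    have h2 := hmono 1 (i + 1) (by omega) (by omega)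
    have h3 := hmono (i + 1) N hi (by omega)
    have h4 := hmono N (N + 1) (by omega) le_rfl
    rw [pad_zero, pad_of_mem v le_rfl (by omega)] at h1
    rw [pad_of_mem v le_rfl (by omega), pad_of_mem v (by omega) hi] at h2
    rw [pad_of_mem v (by omega) hi, pad_of_mem v (by omega) le_rfl] at h3
    rw [pad_succ_last, pad_of_mem v (by omega) le_rfl] at h4
    have hi' : ((i : ℝ) + 1) ≤ N := by exact_mod_cast hi
    have g0 : 0 ≤ grid N (i + 1) := by
      unfold grid; push_cast
      exact div_nonneg (by linarith [(Nat.cast_nonneg i : (0 : ℝ) ≤ i)]) hN0.le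
    have g1 : grid N (i + 1) ≤ 1 := by
      unfold grid; push_cast
      rw [div_le_one hN0]
      linarith
    rw [sq_le_one_iff_abs_le_one, abs_le]
    constructor <;> linarith
  simpa using Finset.sum_le_sum hterm

end Flow

theorem MK1_convergence_rho_one (c0 C0 K α : ℝ)
    (hc0 : 0 < c0) (hC0 : 0 < C0) (hK : 0 < K) (hα : 0 < α) :
    ∃ cbar Cbar : ℝ, 0 < cbar ∧ 0 < Cbar ∧
      ∀ (N : ℕ), 1 ≤ N →
      ∀ (x : ℝ → ℕ → ℝ) (X : ℝ → ℝ → ℝ),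
        -- the discrete gradient flow (unrescaled)
        (∀ t, 0 ≤ t → ∀ i ∈ Finset.Icc 1 N,
          HasDerivAt (fun s => x s i)
            ((1 / 4) * ((pad N (x t) (i + 1) - pad N (x t) i) ^ 2
              - (pad N (x t) i - pad N (x t) (i - 1)) ^ 2)) t) →
        -- initial spacing of the discrete points
        (∀ i ∈ Finset.Icc 1 (N + 1),
          c0 / N ≤ pad N (x 0) i - pad N (x 0) (i - 1) ∧
            pad N (x 0) i - pad N (x 0) (i - 1) ≤ C0 / N) →
        -- spatial regularity of the continuous solution
        (∀ t, 0 ≤ t → ContDiff ℝ 2 (X t)) →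
        -- the PDE `∂ₜX = (1/2) ∂_θX ∂²_θθX`
        (∀ t, 0 ≤ t → ∀ θ ∈ Set.Icc (0 : ℝ) 1,
          HasDerivAt (fun s => X s θ)
            ((1 / 2) * deriv (X t) θ * deriv (deriv (X t)) θ) t) →
        -- boundary conditions
        (∀ t, 0 ≤ t → X t 0 = 0 ∧ X t 1 = 1) →
        -- `X₀ ∈ C^{4,α}` with norm bounded by `K`, and monotone
        C4HolderBound α K (X 0) →
        (∀ θ ∈ Set.Icc (0 : ℝ) 1, c0 ≤ deriv (X 0) θ ∧ deriv (X 0) θ ≤ C0) →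
        -- conclusion: `MK₁(μ_t^N, dθ) ≤ e^{-c̄t/N³} + C̄/N² + 1/(4N)`
        (∀ t, 0 ≤ t → ∀ φ : ℝ → ℝ, LipschitzWith 1 φ →
          (1 / (N : ℝ)) * ∑ i ∈ Finset.Icc 1 N, φ (x t i) - ∫ θ in (0 : ℝ)..1, φ θ ≤
            Real.exp (-cbar * t / (N : ℝ) ^ 3) + Cbar / (N : ℝ) ^ 2 + 1 / (4 * (N : ℝ)))
        -- in particular, for `t ≥ 2N³ log N / c̄`
        ∧ (∀ t, 2 * (N : ℝ) ^ 3 * Real.log N / cbar ≤ t → ∀ φ : ℝ → ℝ, LipschitzWith 1 φ →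
            (1 / (N : ℝ)) * ∑ i ∈ Finset.Icc 1 N, φ (x t i) - ∫ θ in (0 : ℝ)..1, φ θ ≤
              1 / (4 * (N : ℝ)) + (Cbar + 1) / (N : ℝ) ^ 2) := by
  refine ⟨1 / 4, 1, by norm_num, one_pos, ?_⟩
  intro N hN x X hx hgap0 _ _ _ _ _
  have hN0 : (0 : ℝ) < N := by exact_mod_cast hN
  have h0 : ∀ i ≤ N, 0 < pad N (x 0) (i + 1) - pad N (x 0) i := fun i hi =>
    (div_pos hc0 hN0).trans_le (hgap0 (i + 1) (Finset.mem_Icc.2 ⟨by omega, by omega⟩)).1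
  have main : ∀ t, 0 ≤ t → ∀ φ : ℝ → ℝ, LipschitzWith 1 φ →
      (1 / (N : ℝ)) * ∑ i ∈ Finset.Icc 1 N, φ (x t i) - ∫ θ in (0 : ℝ)..1, φ θ ≤
        Real.exp (-(1 / 4) * t / (N : ℝ) ^ 3) + 1 / (4 * (N : ℝ)) := by
    intro t ht φ hφ
    refine hφ.average_sub_integral_le hN (x t) (Real.exp_pos _).le ?_
    refine (sum_sq_sub_grid_le hN hx h0 ht).trans ?_
    have hexp : Real.exp (-(1 / 4) * t / (N : ℝ) ^ 3) ^ 2 =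
        Real.exp (-(1 / (2 * (N : ℝ) ^ 3)) * t) := by
      rw [← Real.exp_nat_mul]
      congr 1
      push_cast
      field_simp
      norm_num
    rw [hexp]
    exact mul_le_mul_of_nonneg_right (sum_sq_sub_grid_le_card fun i hi => (h0 i hi).le)
      (Real.exp_pos _).le
  refine ⟨fun t ht φ hφ => ?_, fun t ht φ hφ => ?_⟩
  · have h1 := main t ht φ hφ
    have h2 : 0 ≤ 1 / (N : ℝ) ^ 2 := by positivity
    linarith
  · have hlog : 0 ≤ Real.log N := Real.log_nonneg (by exact_mod_cast hN)
    have h1 := main t (le_trans (by positivity) ht) φ hφ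
    have h2 : Real.exp (-(1 / 4) * t / (N : ℝ) ^ 3) ≤ 1 / (N : ℝ) ^ 2 := by
      rw [one_div ((N : ℝ) ^ 2), ← Real.exp_log (by positivity : (0 : ℝ) < ((N : ℝ) ^ 2)⁻¹), Real.exp_le_exp,
        Real.log_inv, Real.log_pow, div_le_iff₀ (by positivity)]
      rw [div_le_iff₀ (by norm_num)] at ht
      push_cast
      linarith
    have h3 : 0 ≤ 1 / (N : ℝ) ^ 2 := by positivity
    rw [add_div (1 : ℝ)]
    linarith
end

section
/- Let ρ:[0,1]→(0,∞) be a periodic probability density of class C^2, extended by ρ(y):=ρ(−y) for y∈[−1,0] and ρ(y):=ρ(2−y) for y∈[1,2]. Let (x̄^i) solve d/dt x̄^i = 2N^3 ∫_{(x̄^i+x̄^{i−1})/2}^{(x̄^i+x̄^{i+1})/2}(z−x̄^i)ρ(z)dz (with x̄^0:=−x̄^1, x̄^{N+1}:=2−x̄^N), and let X^i(t) satisfy ∂_t X^i = 2N^3∫_{(X^i+X^{i−1})/2}^{(X^i+X^{i+1})/2}(z−X^i)ρ(z)dz + R^i with |R^i(t)| ≤ Ĉ/N^2. Let 0 ≤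 T_1 ≤ T_2 ≤ ∞ and assume there are constants c_0, C_0 > 0 such that c_0/N ≤ x̄^i(t)−x̄^{i−1}(t) ≤ C_0/N and c_0/N ≤ X^i(t)−X^{i−1}(t) ≤ C_0/N for all i and all t ∈ [T_1,T_2]. Then there exists ε_0 = ε_0(c_0,C_0) > 0 such that if ‖ρ'‖_∞ + ‖ρ''‖_∞ ≤ ε_0, there are constants c̄, C̄ > 0, depending only on c_0, with: (1/N)Σ_{i=1}^N (x̄^i(t)−X^i(t))^2 ≤ e^{−c̄(t−T_1)}·(1/N)Σ_{i=1}^N (x̄^i(T_1)−X^i(T_1))^2 + C̄(Ĉ/N^2)^2 for all t ∈ [T_1,T_2]. -/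
open MeasureTheory

/-- Second order Taylor estimate for an antiderivative `P` of a function `ρ` with `|ρ''| ≤ ε`. -/
lemma abs_antideriv_taylor_le {ρ ρ' ρ'' P : ℝ → ℝ} {ε : ℝ}
    (h1 : ∀ y, HasDerivAt ρ (ρ' y) y) (h2 : ∀ y, HasDerivAt ρ' (ρ'' y) y)
    (hP : ∀ y, HasDerivAt P (ρ y) y) (hb : ∀ y, |ρ'' y| ≤ ε) (m z : ℝ) :
    |P z - P m - ρ m * (z - m) - ρ' m * (z - m) ^ 2 / 2| ≤ ε * |z - m| ^ 3 := by
  have hmem : ∀ y ∈ Set.uIcc m z, |y - m| ≤ |z - m| := fun y hy => Set.abs_sub_left_of_mem_uIcc hy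
  have hε : 0 ≤ ε := (abs_nonneg _).trans (hb 0)
  have e1 : ∀ y, |ρ' y - ρ' m| ≤ ε * |y - m| := fun y => by
    simpa using Convex.norm_image_sub_le_of_norm_hasDerivWithin_le
      (fun x _ => (h2 x).hasDerivWithinAt) (fun x _ => hb x) convex_univ
      (Set.mem_univ m) (Set.mem_univ y)
  have e2 : ∀ y ∈ Set.uIcc m z, |ρ y - ρ m - ρ' m * (y - m)| ≤ ε * |z - m| ^ 2 := by
    intro y hy
    have hd : ∀ x, HasDerivAt (fun x => ρ x - ρ' m * x) (ρ' x - ρ' m) x := fun x =>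
      ((h1 x).sub ((hasDerivAt_id' x).const_mul (ρ' m))).congr_deriv (by ring)
    have := Convex.norm_image_sub_le_of_norm_hasDerivWithin_le (C := ε * |z - m|)
      (fun x _ => (hd x).hasDerivWithinAt)
      (fun x hx => (e1 x).trans (mul_le_mul_of_nonneg_left (hmem x hx) hε))
      (convex_uIcc m z) Set.left_mem_uIcc hy
    rw [Real.norm_eq_abs, Real.norm_eq_abs] at this
    calc |ρ y - ρ m - ρ' m * (y - m)| = |ρ y - ρ' m * y - (ρ m - ρ' m * m)| := by ring_nf
      _ ≤ ε * |z - m| * |y - m| := this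
      _ ≤ ε * |z - m| * |z - m| := mul_le_mul_of_nonneg_left (hmem y hy) (by positivity)
      _ = _ := by ring
  have hd : ∀ x, HasDerivAt (fun x => P x - ρ m * (x - m) - ρ' m * (x - m) ^ 2 / 2)
      (ρ x - ρ m - ρ' m * (x - m)) x := fun x => by
    have hx : HasDerivAt (fun x => x - m) 1 x := (hasDerivAt_id x).sub_const m
    refine (((hP x).sub (hx.const_mul (ρ m))).sub
      (((hx.fun_pow 2).const_mul (ρ' m)).div_const 2)).congr_deriv ?_
    norm_num
    ring
  have := Convex.norm_image_sub_le_of_norm_hasDerivWithin_le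
    (fun x _ => (hd x).hasDerivWithinAt) e2
    (convex_uIcc m z) Set.left_mem_uIcc Set.right_mem_uIcc
  rw [Real.norm_eq_abs, Real.norm_eq_abs] at this
  calc _ = |P z - ρ m * (z - m) - ρ' m * (z - m) ^ 2 / 2
        - (P m - ρ m * (m - m) - ρ' m * (m - m) ^ 2 / 2)| := by ring_nf
    _ ≤ _ := this
    _ = _ := by ring

/-- The force `∫_p^q (z - x) ρ(z) dz` in terms of antiderivatives `P` of `ρ` and `Q` of `z ρ(z)`. -/
def cellForce (P Q : ℝ → ℝ) (p q x : ℝ) : ℝ := Q q - Q p - x * (P q - P p)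

lemma hasDerivAt_cellForce_comp {ρ P Q : ℝ → ℝ} (hP : ∀ y, HasDerivAt P (ρ y) y)
    (hQ : ∀ y, HasDerivAt Q (y * ρ y) y) {p q x : ℝ → ℝ} {p' q' x' θ : ℝ}
    (hp : HasDerivAt p p' θ) (hq : HasDerivAt q q' θ) (hx : HasDerivAt x x' θ) :
    HasDerivAt (fun s => cellForce P Q (p s) (q s) (x s))
      ((q θ - x θ) * ρ (q θ) * q' - (p θ - x θ) * ρ (p θ) * p' - x' * (P (q θ) - P (p θ))) θ := by
  refine ((((hQ (q θ)).comp θ hq).sub ((hQ (p θ)).comp θ hp)).sub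
    (hx.mul (((hP (q θ)).comp θ hq).sub ((hP (p θ)).comp θ hp)))).congr_deriv ?_
  simp only [Pi.sub_apply, Function.comp]
  ring

/-- Quadratic form of the derivative of the force across an edge with midpoint `m` and half-length
`l`. -/
lemma edge_form_le {c0 C0 ε h r r' I J l ua ub : ℝ} (hc0 : 0 < c0) (hh : 0 < h)
    (hε : 0 ≤ ε) (hε2 : ε * C0 ^ 2 ≤ c0 / 4) (hε3 : ε * C0 ^ 3 ≤ c0 / 16)
    (hr : 1 / 2 ≤ r) (hr' : |r'| ≤ ε) (hl : c0 * h ≤ 2 * l) (hl' : 2 * l ≤ C0 * h)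
    (hI : |I - r * l - r' * l ^ 2 / 2| ≤ ε * l ^ 3)
    (hJ : |J - r * l + r' * l ^ 2 / 2| ≤ ε * l ^ 3) :
    l / 2 * r * (ua + ub) ^ 2 - ub ^ 2 * I - ua ^ 2 * J ≤
      -(c0 * h / 16) * (ub - ua) ^ 2 + c0 * h ^ 3 / 64 * (ua ^ 2 + ub ^ 2) := by
  have hch : 0 < c0 * h := by positivity
  have hl0 : 0 < l := by linarith
  have k2 : ε * l ^ 2 ≤ c0 * h ^ 2 / 16 := by
    have : (2 * l) ^ 2 ≤ (C0 * h) ^ 2 := pow_le_pow_left₀ (by positivity) hl' 2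
    nlinarith [mul_le_mul_of_nonneg_left this hε, mul_le_mul_of_nonneg_right hε2 (sq_nonneg h)]
  have k3 : ε * l ^ 3 ≤ c0 * h ^ 3 / 128 := by
    have : (2 * l) ^ 3 ≤ (C0 * h) ^ 3 := pow_le_pow_left₀ (by positivity) hl' 3
    have h3 : 0 ≤ h ^ 3 := by positivity
    nlinarith [mul_le_mul_of_nonneg_left this hε, mul_le_mul_of_nonneg_right hε3 h3]
  have hI' := (neg_le_of_abs_le hI)
  have hJ' := (neg_le_of_abs_le hJ)
  have k4 : |r' * l ^ 2| ≤ c0 * h ^ 2 / 16 := by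
    rw [abs_mul, abs_of_nonneg (sq_nonneg l)]
    exact (mul_le_mul_of_nonneg_right hr' (sq_nonneg l)).trans k2
  obtain ⟨k4l, k4r⟩ := abs_le.mp k4
  have a1 : -(ub ^ 2 * I) ≤ -(ub ^ 2 * (r * l + r' * l ^ 2 / 2)) + ub ^ 2 * (c0 * h ^ 3 / 128) := by
    nlinarith [mul_nonneg (sq_nonneg ub) (by linarith :
      0 ≤ I - (r * l + r' * l ^ 2 / 2) + c0 * h ^ 3 / 128)]
  have a2 : -(ua ^ 2 * J) ≤ -(ua ^ 2 * (r * l - r' * l ^ 2 / 2)) + ua ^ 2 * (c0 * h ^ 3 / 128) := by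
    nlinarith [mul_nonneg (sq_nonneg ua) (by linarith :
      0 ≤ J - (r * l - r' * l ^ 2 / 2) + c0 * h ^ 3 / 128)]
  have a3 : c0 * h / 4 * (ub - ua) ^ 2 ≤ r * l * (ub - ua) ^ 2 := by
    apply mul_le_mul_of_nonneg_right _ (sq_nonneg _)
    nlinarith
  have a4 : -(r' * l ^ 2 * ((ub - ua) * (ub + ua))) ≤
      c0 * h ^ 2 / 16 * |(ub - ua) * (ub + ua)| := by
    calc _ ≤ |r' * l ^ 2 * ((ub - ua) * (ub + ua))| := neg_le_abs _
      _ = |r' * l ^ 2| * |(ub - ua) * (ub + ua)| := abs_mul _ _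
      _ ≤ _ := by gcongr
  have a5 : c0 * h ^ 2 / 16 * |(ub - ua) * (ub + ua)| ≤
      c0 * h / 8 * (ub - ua) ^ 2 + c0 * h ^ 3 / 128 * (ub + ua) ^ 2 := by
    rw [abs_mul, ← sq_abs (ub - ua), ← sq_abs (ub + ua)]
    nlinarith [mul_nonneg hch.le (sq_nonneg (4 * |ub - ua| - h * |ub + ua|))]
  have a6 : c0 * h ^ 3 / 256 * (ub + ua) ^ 2 ≤ c0 * h ^ 3 / 128 * (ua ^ 2 + ub ^ 2) := by
    have : 0 ≤ c0 * h ^ 3 := by positivity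
    nlinarith [mul_nonneg this (sq_nonneg (ub - ua))]
  linarith [a1, a2, a3, a4, a5, a6]

lemma edge_monotone {ρ ρ' ρ'' P Q : ℝ → ℝ} {c0 C0 ε h : ℝ}
    (h1 : ∀ y, HasDerivAt ρ (ρ' y) y) (h2 : ∀ y, HasDerivAt ρ' (ρ'' y) y)
    (hP : ∀ y, HasDerivAt P (ρ y) y) (hQ : ∀ y, HasDerivAt Q (y * ρ y) y)
    (hb1 : ∀ y, |ρ' y| ≤ ε) (hb2 : ∀ y, |ρ'' y| ≤ ε) (hρ : ∀ y, 1 / 2 ≤ ρ y)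
    (hc0 : 0 < c0) (hh : 0 < h)
    (hε2 : ε * C0 ^ 2 ≤ c0 / 4) (hε3 : ε * C0 ^ 3 ≤ c0 / 16) {a b A B : ℝ}
    (hab : c0 * h ≤ b - a) (hab' : b - a ≤ C0 * h)
    (hAB : c0 * h ≤ B - A) (hAB' : B - A ≤ C0 * h) :
    (b - B) * (cellForce P Q ((b + a) / 2) b b - cellForce P Q ((B + A) / 2) B B) +
      (a - A) * (cellForce P Q a ((a + b) / 2) a - cellForce P Q A ((A + B) / 2) A) ≤
      -(c0 * h / 16) * ((b - B) - (a - A)) ^ 2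
        + c0 * h ^ 3 / 64 * ((a - A) ^ 2 + (b - B) ^ 2) := by
  set ua := a - A with hua
  set ub := b - B with hub
  have hε : 0 ≤ ε := (abs_nonneg _).trans (hb1 0)
  set α : ℝ → ℝ := fun θ => A + θ * ua with hα
  set β : ℝ → ℝ := fun θ => B + θ * ub with hβ
  have dα : ∀ θ, HasDerivAt α ua θ := fun θ =>
    (((hasDerivAt_id' θ).mul_const ua).const_add A).congr_deriv (one_mul ua)
  have dβ : ∀ θ, HasDerivAt β ub θ := fun θ =>
    (((hasDerivAt_id' θ).mul_const ub).const_add B).congr_deriv (one_mul ub)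
  have dm : ∀ θ, HasDerivAt (fun s => (α s + β s) / 2) ((ua + ub) / 2) θ := fun θ =>
    ((dα θ).add (dβ θ)).div_const 2
  set f : ℝ → ℝ := fun θ => ub * cellForce P Q ((α θ + β θ) / 2) (β θ) (β θ) +
    ua * cellForce P Q (α θ) ((α θ + β θ) / 2) (α θ) with hf
  have df : ∀ θ, HasDerivAt f ((β θ - α θ) / 2 / 2 * ρ ((α θ + β θ) / 2) * (ua + ub) ^ 2
      - ub ^ 2 * (P (β θ) - P ((α θ + β θ) / 2)) - ua ^ 2 * (P ((α θ + β θ) / 2) - P (α θ))) θ := by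
    intro θ
    refine (((hasDerivAt_cellForce_comp hP hQ (dm θ) (dβ θ) (dβ θ)).const_mul ub).add
      ((hasDerivAt_cellForce_comp hP hQ (dα θ) (dm θ) (dα θ)).const_mul ua)).congr_deriv ?_
    ring
  have key : ∀ θ ∈ Set.Icc (0 : ℝ) 1, deriv f θ ≤ -(c0 * h / 16) * (ub - ua) ^ 2
        + c0 * h ^ 3 / 64 * (ua ^ 2 + ub ^ 2) := by
    rintro θ ⟨hθ0, hθ1⟩
    rw [(df θ).deriv]
    have hd : β θ - α θ = (1 - θ) * (B - A) + θ * (b - a) := by simp only [hα, hβ, hua, hub]; ring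
    have hl : c0 * h ≤ 2 * ((β θ - α θ) / 2) := by rw [hd]; nlinarith
    have hl' : 2 * ((β θ - α θ) / 2) ≤ C0 * h := by rw [hd]; nlinarith
    have hl0 : 0 ≤ (β θ - α θ) / 2 := by nlinarith
    refine edge_form_le hc0 hh hε hε2 hε3 (hρ _) (hb1 ((α θ + β θ) / 2)) hl hl' ?_ ?_
    · have := abs_antideriv_taylor_le h1 h2 hP hb2 ((α θ + β θ) / 2) (β θ)
      rw [show β θ - (α θ + β θ) / 2 = (β θ - α θ) / 2 by ring, abs_of_nonneg hl0] at this
      exact this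
    · have := abs_antideriv_taylor_le h1 h2 hP hb2 ((α θ + β θ) / 2) (α θ)
      rw [show α θ - (α θ + β θ) / 2 = -((β θ - α θ) / 2) by ring, abs_neg, abs_of_nonneg hl0,
        ← abs_neg] at this
      convert this using 2
      ring
  have := Convex.image_sub_le_mul_sub_of_deriv_le (convex_Icc (0 : ℝ) 1)
    (fun θ _ => (df θ).continuousAt.continuousWithinAt)
    (fun θ _ => (df θ).differentiableAt.differentiableWithinAt)
    (fun θ hθ => key θ (interior_subset hθ)) 0 (by simp) 1 (by simp) zero_le_one
  simp only [hf, hα, hβ, hua, hub] at this ⊢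
  convert this using 1 <;> ring_nf

lemma half_mul_sub_le_antideriv {ρ P : ℝ → ℝ} (hP : ∀ y, HasDerivAt P (ρ y) y)
    (hρ : ∀ y, 1 / 2 ≤ ρ y) {p y : ℝ} (hy : p ≤ y) : 1 / 2 * (y - p) ≤ P y - P p :=
  Convex.mul_sub_le_image_sub_of_le_deriv convex_univ
    (fun x _ => (hP x).continuousAt.continuousWithinAt)
    (fun x _ => (hP x).differentiableAt.differentiableWithinAt)
    (fun x _ => by rw [(hP x).deriv]; exact hρ x) p (Set.mem_univ _) y (Set.mem_univ _) hy

/-- Monotonicity of the force on a point `b` from the half cell between a fixed left endpoint `p`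
and `b`. -/
lemma left_boundary_monotone {ρ P Q : ℝ → ℝ} {δ : ℝ}
    (hP : ∀ y, HasDerivAt P (ρ y) y) (hQ : ∀ y, HasDerivAt Q (y * ρ y) y)
    (hρ : ∀ y, 1 / 2 ≤ ρ y) {p b B : ℝ} (hδ : 0 ≤ δ) (hb : δ ≤ b - p) (hB : δ ≤ B - p) :
    (b - B) * (cellForce P Q p b b - cellForce P Q p B B) ≤ -(δ / 2) * (b - B) ^ 2 := by
  set u := b - B with hu
  set β : ℝ → ℝ := fun θ => B + θ * u with hβ
  have dβ : ∀ θ, HasDerivAt β u θ := fun θ =>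
    (((hasDerivAt_id' θ).mul_const u).const_add B).congr_deriv (one_mul u)
  have df : ∀ θ, HasDerivAt (fun θ => u * cellForce P Q p (β θ) (β θ))
      (-(u ^ 2 * (P (β θ) - P p))) θ := by
    intro θ
    refine ((hasDerivAt_cellForce_comp hP hQ (hasDerivAt_const θ p) (dβ θ)
      (dβ θ)).const_mul u).congr_deriv ?_
    ring
  have key : ∀ θ ∈ Set.Icc (0 : ℝ) 1,
      deriv (fun θ => u * cellForce P Q p (β θ) (β θ)) θ ≤ -(δ / 2) * u ^ 2 := by
    rintro θ ⟨hθ0, hθ1⟩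
    have hd : β θ - p = (1 - θ) * (B - p) + θ * (b - p) := by simp only [hβ, hu]; ring
    have hl : δ ≤ β θ - p := by rw [hd]; nlinarith
    have := half_mul_sub_le_antideriv hP hρ (sub_nonneg.mp (hδ.trans hl))
    rw [(df θ).deriv]
    nlinarith [sq_nonneg u]
  have := Convex.image_sub_le_mul_sub_of_deriv_le (convex_Icc (0 : ℝ) 1)
    (fun θ _ => (df θ).continuousAt.continuousWithinAt)
    (fun θ _ => (df θ).differentiableAt.differentiableWithinAt)
    (fun θ hθ => key θ (interior_subset hθ)) 0 (by simp) 1 (by simp) zero_le_one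
  have e0 : β 0 = B := by simp [hβ]
  have e1 : β 1 = b := by simp [hβ, hu]
  simp only [e0, e1] at this
  linarith

/-- Monotonicity of the force on a point `a` from the half cell between `a` and a fixed right
endpoint `q`. -/
lemma right_boundary_monotone {ρ P Q : ℝ → ℝ} {δ : ℝ}
    (hP : ∀ y, HasDerivAt P (ρ y) y) (hQ : ∀ y, HasDerivAt Q (y * ρ y) y)
    (hρ : ∀ y, 1 / 2 ≤ ρ y) {q a A : ℝ} (hδ : 0 ≤ δ) (ha : δ ≤ q - a) (hA : δ ≤ q - A) :
    (a - A) * (cellForce P Q a q a - cellForce P Q A q A) ≤ -(δ / 2) * (a - A) ^ 2 := by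
  have hP' : ∀ y, HasDerivAt (fun y => -P (-y)) (ρ (-y)) y := fun y =>
    (((hP (-y)).comp y (hasDerivAt_neg y)).neg).congr_deriv (by ring)
  have hQ' : ∀ y, HasDerivAt (fun y => Q (-y)) (y * ρ (-y)) y := fun y =>
    ((hQ (-y)).comp y (hasDerivAt_neg y)).congr_deriv (by ring)
  have := left_boundary_monotone hP' hQ' (fun y => hρ (-y)) (p := -q) (b := -a) (B := -A) hδ
    (by linarith) (by linarith)
  simp only [cellForce, neg_neg] at this ⊢
  linarith

lemma integral_eq_cellForce {ρ P Q : ℝ → ℝ} (hρ : Continuous ρ)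
    (hP : ∀ y, HasDerivAt P (ρ y) y) (hQ : ∀ y, HasDerivAt Q (y * ρ y) y) (p q x : ℝ) :
    ∫ z in p..q, (z - x) * ρ z = cellForce P Q p q x := by
  have hd : ∀ y, HasDerivAt (fun y => Q y - x * P y) ((y - x) * ρ y) y := fun y =>
    ((hQ y).sub ((hP y).const_mul x)).congr_deriv (by ring)
  rw [intervalIntegral.integral_eq_sub_of_hasDerivAt (fun y _ => hd y)
    (Continuous.intervalIntegrable (by fun_prop) _ _), cellForce]
  ring

lemma cellForce_add_cellForce (P Q : ℝ → ℝ) (p r q x : ℝ) :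
    cellForce P Q p r x + cellForce P Q r q x = cellForce P Q p q x := by
  simp only [cellForce]; ring

/-- Discrete Poincaré inequality with one boundary term. -/
lemma sum_sq_le_mul_sum_sub_sq (n : ℕ) (u : ℕ → ℝ) :
    ∑ i ∈ Finset.range (n + 1), u i ^ 2 ≤
      ((n : ℝ) + 1) ^ 2 * (u 0 ^ 2 + ∑ i ∈ Finset.range n, (u (i + 1) - u i) ^ 2) := by
  have hpt : ∀ j, u j ^ 2 ≤
      ((j : ℝ) + 1) * (u 0 ^ 2 + ∑ i ∈ Finset.range j, (u (i + 1) - u i) ^ 2) := by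
    intro j
    induction j with
    | zero => simp
    | succ j ih =>
      rw [Finset.sum_range_succ]
      set S := u 0 ^ 2 + ∑ i ∈ Finset.range j, (u (i + 1) - u i) ^ 2
      push_cast
      have hj : (0 : ℝ) < (j : ℝ) + 1 := by positivity
      refine le_of_mul_le_mul_left ?_ hj
      have hsq := sq_nonneg (u j - ((j : ℝ) + 1) * (u (j + 1) - u j))
      nlinarith [mul_le_mul_of_nonneg_left ih (by positivity : (0 : ℝ) ≤ (j : ℝ) + 2)]
  calc ∑ i ∈ Finset.range (n + 1), u i ^ 2
      ≤ ∑ _i ∈ Finset.range (n + 1),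
          ((n : ℝ) + 1) * (u 0 ^ 2 + ∑ i ∈ Finset.range n, (u (i + 1) - u i) ^ 2) := by
        refine Finset.sum_le_sum fun j hj => (hpt j).trans ?_
        have hjn : j ≤ n := Nat.lt_succ_iff.mp (Finset.mem_range.mp hj)
        gcongr
    _ = _ := by simp; ring

lemma sum_range_succ_add_regroup (n : ℕ) (f g : ℕ → ℝ) :
    ∑ i ∈ Finset.range (n + 1), (f i + g i) =
      f 0 + g n + ∑ i ∈ Finset.range n, (f (i + 1) + g i) := by
  rw [Finset.sum_add_distrib, Finset.sum_range_succ', Finset.sum_range_succ g,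
    Finset.sum_add_distrib]
  ring

lemma pad_succ_of_le {n i : ℕ} (v : ℕ → ℝ) (hi : i ≤ n) : pad (n + 1) v (i + 1) = v (i + 1) := by
  simp only [pad]
  rw [if_neg (by omega), if_neg (by omega)]

/-- Strong monotonicity of the force of the discrete flow with `n + 1` points. -/
lemma force_monotone {ρ ρ' ρ'' P Q : ℝ → ℝ} {c0 C0 ε : ℝ}
    (h1 : ∀ y, HasDerivAt ρ (ρ' y) y) (h2 : ∀ y, HasDerivAt ρ' (ρ'' y) y)
    (hP : ∀ y, HasDerivAt P (ρ y) y) (hQ : ∀ y, HasDerivAt Q (y * ρ y) y)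
    (hb1 : ∀ y, |ρ' y| ≤ ε) (hb2 : ∀ y, |ρ'' y| ≤ ε) (hρ : ∀ y, 1 / 2 ≤ ρ y)
    (hc0 : 0 < c0) (hε2 : ε * C0 ^ 2 ≤ c0 / 4) (hε3 : ε * C0 ^ 3 ≤ c0 / 16)
    (n : ℕ) (v w : ℕ → ℝ)
    (hv : ∀ i ∈ Finset.Icc 1 (n + 2), c0 / (n + 1) ≤ pad (n + 1) v i - pad (n + 1) v (i - 1) ∧
      pad (n + 1) v i - pad (n + 1) v (i - 1) ≤ C0 / (n + 1))
    (hw : ∀ i ∈ Finset.Icc 1 (n + 2), c0 / (n + 1) ≤ pad (n + 1) w i - pad (n + 1) w (i - 1) ∧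
      pad (n + 1) w i - pad (n + 1) w (i - 1) ≤ C0 / (n + 1)) :
    ∑ i ∈ Finset.Icc 1 (n + 1), (v i - w i) * (2 * ((n : ℝ) + 1) ^ 3 *
      (cellForce P Q ((v i + pad (n + 1) v (i - 1)) / 2) ((v i + pad (n + 1) v (i + 1)) / 2) (v i)
      - cellForce P Q ((w i + pad (n + 1) w (i - 1)) / 2) ((w i + pad (n + 1) w (i + 1)) / 2)
        (w i)))
      ≤ -(c0 / 16) * ∑ i ∈ Finset.Icc 1 (n + 1), (v i - w i) ^ 2 := by
  have hN : (0 : ℝ) < (n : ℝ) + 1 := by positivity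
  set h : ℝ := 1 / ((n : ℝ) + 1) with hh_def
  have hh : 0 < h := by positivity
  have hNh : ((n : ℝ) + 1) * h = 1 := by rw [hh_def]; field_simp
  have hshift : ∀ f : ℕ → ℝ, ∑ i ∈ Finset.Icc 1 (n + 1), f i
      = ∑ i ∈ Finset.range (n + 1), f (i + 1) := fun f => by
    rw [Finset.range_eq_Ico, Finset.sum_Ico_add' f 0 (n + 1) 1]
    rfl
  have hp0 : ∀ z : ℕ → ℝ, pad (n + 1) z 0 = -z 1 := fun z => by simp [pad]
  have hpN : ∀ z : ℕ → ℝ, pad (n + 1) z (n + 2) = 2 - z (n + 1) := fun z => by simp [pad]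
  have hleft : ∀ z : ℕ → ℝ, (z 1 + pad (n + 1) z 0) / 2 = 0 := fun z => by rw [hp0]; ring
  have hright : ∀ z : ℕ → ℝ, (z (n + 1) + pad (n + 1) z (n + 2)) / 2 = 1 := fun z => by
    rw [hpN]; ring
  have spacing : ∀ z : ℕ → ℝ, (∀ i ∈ Finset.Icc 1 (n + 2),
      c0 / (n + 1) ≤ pad (n + 1) z i - pad (n + 1) z (i - 1) ∧
      pad (n + 1) z i - pad (n + 1) z (i - 1) ≤ C0 / (n + 1)) →
      c0 * h / 2 ≤ z 1 - 0 ∧ c0 * h / 2 ≤ 1 - z (n + 1) ∧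
      ∀ i < n, c0 * h ≤ z (i + 1 + 1) - z (i + 1) ∧ z (i + 1 + 1) - z (i + 1) ≤ C0 * h := by
    intro z hz
    have hc : c0 * h = c0 / (n + 1) := by rw [hh_def]; ring
    have hC : C0 * h = C0 / (n + 1) := by rw [hh_def]; ring
    rw [hc, hC]
    refine ⟨?_, ?_, fun i hi => ?_⟩
    · have := (hz 1 (by simp)).1
      rw [Nat.sub_self, hp0, pad_succ_of_le z (Nat.zero_le n), zero_add] at this
      linarith
    · have := (hz (n + 2) (by simp)).1
      rw [hpN, show n + 2 - 1 = n + 1 by omega, pad_succ_of_le z le_rfl] at this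
      linarith
    · have := hz (i + 1 + 1) (by simp; omega)
      rwa [Nat.add_sub_cancel, pad_succ_of_le z (by omega : i + 1 ≤ n),
        pad_succ_of_le z hi.le] at this
  obtain ⟨hv0, hv1, hvi⟩ := spacing v hv
  obtain ⟨hw0, hw1, hwi⟩ := spacing w hw
  rw [hshift, hshift]
  set u : ℕ → ℝ := fun i => v (i + 1) - w (i + 1) with hu
  set f : ℕ → ℝ := fun i => u i *
    (cellForce P Q ((v (i + 1) + pad (n + 1) v i) / 2) (v (i + 1)) (v (i + 1)) -
      cellForce P Q ((w (i + 1) + pad (n + 1) w i) / 2) (w (i + 1)) (w (i + 1))) with hf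
  set g : ℕ → ℝ := fun i => u i *
    (cellForce P Q (v (i + 1)) ((v (i + 1) + pad (n + 1) v (i + 2)) / 2) (v (i + 1)) -
      cellForce P Q (w (i + 1)) ((w (i + 1) + pad (n + 1) w (i + 2)) / 2) (w (i + 1))) with hg
  have hf0 : f 0 ≤ -(c0 * h / 4) * u 0 ^ 2 := by
    simp only [hf, hu, zero_add, hleft]
    have := left_boundary_monotone hP hQ hρ (by positivity) hv0 hw0
    linarith
  have hgn : g n ≤ 0 := by
    simp only [hg, hu, hright]
    have := right_boundary_monotone hP hQ hρ (by positivity) hv1 hw1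
    nlinarith [mul_nonneg (mul_pos hc0 hh).le (sq_nonneg (v (n + 1) - w (n + 1)))]
  have hfg : ∀ i ∈ Finset.range n, f (i + 1) + g i ≤
      -(c0 * h / 16) * (u (i + 1) - u i) ^ 2 + c0 * h ^ 3 / 64 * (u i ^ 2 + u (i + 1) ^ 2) := by
    intro i hi
    have hi' := Finset.mem_range.mp hi
    simp only [hf, hg, hu, pad_succ_of_le _ hi'.le, pad_succ_of_le _ (Nat.succ_le_of_lt hi')]
    exact edge_monotone h1 h2 hP hQ hb1 hb2 hρ hc0 hh hε2 hε3 (hvi i hi').1 (hvi i hi').2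
      (hwi i hi').1 (hwi i hi').2
  set S := ∑ i ∈ Finset.range (n + 1), u i ^ 2 with hS
  set D := ∑ i ∈ Finset.range n, (u (i + 1) - u i) ^ 2 with hD
  have hsum : ∑ i ∈ Finset.range (n + 1), (f i + g i) ≤
      -(c0 * h / 16) * (u 0 ^ 2 + D) + c0 * h ^ 3 / 32 * S := by
    have e1 := Finset.sum_le_sum hfg
    simp only [Finset.sum_add_distrib, ← Finset.mul_sum] at e1
    have e2 : ∑ i ∈ Finset.range n, u i ^ 2 ≤ S := by
      rw [hS, Finset.sum_range_succ]; linarith [sq_nonneg (u n)]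
    have e3 : ∑ i ∈ Finset.range n, u (i + 1) ^ 2 ≤ S := by
      rw [hS, Finset.sum_range_succ']; linarith [sq_nonneg (u 0)]
    have e4 : 0 ≤ c0 * h ^ 3 / 64 := by positivity
    have e5 : 0 ≤ c0 * h := by positivity
    rw [sum_range_succ_add_regroup, Finset.sum_add_distrib]
    nlinarith [mul_le_mul_of_nonneg_left (add_le_add e2 e3) e4,
      mul_nonneg e5 (sq_nonneg (u 0))]
  have hpoin : S ≤ ((n : ℝ) + 1) ^ 2 * (u 0 ^ 2 + D) := sum_sq_le_mul_sum_sub_sq n u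
  calc _ = 2 * ((n : ℝ) + 1) ^ 3 * ∑ i ∈ Finset.range (n + 1), (f i + g i) := by
        rw [Finset.mul_sum]
        refine Finset.sum_congr rfl fun i _ => ?_
        simp only [hf, hg, hu, Nat.add_sub_cancel]
        rw [← cellForce_add_cellForce P Q _ (v (i + 1)) _ (v (i + 1)),
          ← cellForce_add_cellForce P Q _ (w (i + 1)) _ (w (i + 1))]
        ring
    _ ≤ 2 * ((n : ℝ) + 1) ^ 3 * (-(c0 * h / 16) * (u 0 ^ 2 + D) + c0 * h ^ 3 / 32 * S) := by
        gcongr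
    _ = -(c0 / 8) * (((n : ℝ) + 1) * h) * (((n : ℝ) + 1) ^ 2 * (u 0 ^ 2 + D))
          + c0 / 16 * (((n : ℝ) + 1) * h) ^ 3 * S := by ring
    _ ≤ -(c0 / 16) * S := by
        rw [hNh]
        nlinarith

lemma le_exp_mul_add_of_hasDerivAt_le {y y' : ℝ → ℝ} {c K T1 T2 : ℝ}
    (hy : ∀ t ∈ Set.Icc T1 T2, HasDerivAt y (y' t) t)
    (hle : ∀ t ∈ Set.Icc T1 T2, y' t ≤ -c * y t + c * K) (hK : 0 ≤ K) :
    ∀ t ∈ Set.Icc T1 T2, y t ≤ Real.exp (-c * (t - T1)) * y T1 + K := by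
  intro t ht
  have hg : ∀ s ∈ Set.Icc T1 T2, HasDerivAt (fun s => Real.exp (c * (s - T1)) * (y s - K))
      (Real.exp (c * (s - T1)) * (c * (y s - K) + y' s)) s := by
    intro s hs
    have h1 : HasDerivAt (fun s => c * (s - T1)) c s :=
      (((hasDerivAt_id' s).sub_const T1).const_mul c).congr_deriv (mul_one c)
    exact (h1.exp.mul ((hy s hs).sub_const K)).congr_deriv (by ring)
  have hanti : AntitoneOn (fun s => Real.exp (c * (s - T1)) * (y s - K)) (Set.Icc T1 T2) := by
    refine antitoneOn_of_deriv_nonpos (convex_Icc _ _)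
      (fun s hs => (hg s hs).continuousAt.continuousWithinAt)
      (fun s hs => (hg s (interior_subset hs)).differentiableAt.differentiableWithinAt)
      (fun s hs => ?_)
    rw [(hg s (interior_subset hs)).deriv]
    exact mul_nonpos_of_nonneg_of_nonpos (Real.exp_pos _).le
      (by linarith [hle s (interior_subset hs)])
  have hle' := hanti (Set.left_mem_Icc.mpr (ht.1.trans ht.2)) ht ht.1
  simp only [sub_self, mul_zero, Real.exp_zero, one_mul] at hle'
  have hexp : Real.exp (-c * (t - T1)) * Real.exp (c * (t - T1)) = 1 := by
    rw [← Real.exp_add]; simp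
  have := mul_le_mul_of_nonneg_left hle' (Real.exp_pos (-c * (t - T1))).le
  rw [← mul_assoc, hexp, one_mul, mul_sub] at this
  nlinarith [mul_nonneg (Real.exp_pos (-c * (t - T1))).le hK]

lemma one_sub_le_of_abs_deriv_le {ρ ρ' : ℝ → ℝ} {ε : ℝ} (h1 : ∀ y, HasDerivAt ρ (ρ' y) y)
    (hper : Function.Periodic ρ 1) (hint : ∫ y in (0 : ℝ)..1, ρ y = 1)
    (hb : ∀ y, |ρ' y| ≤ ε) (y : ℝ) : 1 - ε ≤ ρ y := by
  obtain ⟨w, hw, hyw⟩ := hper.exists_mem_Ico₀ one_pos y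
  have hcont : Continuous ρ := continuous_iff_continuousAt.mpr fun z => (h1 z).continuousAt
  have hε : 0 ≤ ε := (abs_nonneg _).trans (hb 0)
  have hle : ∀ z ∈ Set.Icc (0 : ℝ) 1, ρ z ≤ ρ w + ε := by
    intro z hz
    have := Convex.norm_image_sub_le_of_norm_hasDerivWithin_le
      (fun x _ => (h1 x).hasDerivWithinAt) (fun x _ => hb x) convex_univ
      (Set.mem_univ w) (Set.mem_univ z)
    rw [Real.norm_eq_abs, Real.norm_eq_abs] at this
    have hzw : |z - w| ≤ 1 := abs_le.mpr ⟨by linarith [hz.1, hw.2], by linarith [hz.2, hw.1]⟩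
    linarith [le_abs_self (ρ z - ρ w), mul_le_mul_of_nonneg_left hzw hε]
  have := intervalIntegral.integral_mono_on (μ := volume) (g := fun _ => ρ w + ε) zero_le_one
    (hcont.intervalIntegrable 0 1) (continuous_const.intervalIntegrable 0 1) hle
  rw [hint] at this
  simp at this
  linarith

lemma Function.Periodic.deriv_real {f : ℝ → ℝ} {c : ℝ} (hf : Function.Periodic f c) :
    Function.Periodic (deriv f) c := fun x => by
  rw [← deriv_comp_add_const, funext hf]

theorem L2_stability_general_rho (c0 : ℝ) (hc0 : 0 < c0) :
    -- `c̄, C̄` depend only on `c0`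
    ∃ cbar Cbar : ℝ, 0 < cbar ∧ 0 < Cbar ∧
      ∀ C0 : ℝ, 0 < C0 →
        -- `ε₀` depends only on `c0, C0`
        ∃ ε0 : ℝ, 0 < ε0 ∧
          ∀ (N : ℕ), 1 ≤ N →
          ∀ (ρ : ℝ → ℝ) (x X : ℝ → ℕ → ℝ) (Chat T1 T2 : ℝ),
            0 < Chat → 0 ≤ T1 → T1 ≤ T2 →
            -- `ρ` is a periodic probability density of class `C²`
            ContDiff ℝ 2 ρ → Function.Periodic ρ 1 → (∀ y, 0 < ρ y) →
            (∫ y in (0 : ℝ)..1, ρ y) = 1 →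
            -- `‖ρ'‖_∞ + ‖ρ''‖_∞ ≤ ε₀`
            (∀ y ∈ Set.Icc (0 : ℝ) 1, ∀ y' ∈ Set.Icc (0 : ℝ) 1,
              |deriv ρ y| + |deriv (deriv ρ) y'| ≤ ε0) →
            -- the rescaled discrete gradient flow on `[T1, T2]`
            (∀ t ∈ Set.Icc T1 T2, ∀ i ∈ Finset.Icc 1 N,
              HasDerivAt (fun s => x s i)
                (2 * (N : ℝ) ^ 3 *
                  ∫ z in ((x t i + pad N (x t) (i - 1)) / 2)..(
                      (x t i + pad N (x t) (i + 1)) / 2),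
                    (z - x t i) * ρ z) t) →
            -- `Xⁱ` satisfies the same system up to an error `Rⁱ` with `|Rⁱ| ≤ Ĉ/N²`
            (∀ t ∈ Set.Icc T1 T2, ∀ i ∈ Finset.Icc 1 N, ∃ R : ℝ,
              |R| ≤ Chat / (N : ℝ) ^ 2 ∧
              HasDerivAt (fun s => X s i)
                (2 * (N : ℝ) ^ 3 *
                  (∫ z in ((X t i + pad N (X t) (i - 1)) / 2)..(
                      (X t i + pad N (X t) (i + 1)) / 2),
                    (z - X t i) * ρ z) + R) t) →
            -- spacing assumptions on `[T1, T2]`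
            (∀ t ∈ Set.Icc T1 T2, ∀ i ∈ Finset.Icc 1 (N + 1),
              c0 / N ≤ pad N (x t) i - pad N (x t) (i - 1) ∧
                pad N (x t) i - pad N (x t) (i - 1) ≤ C0 / N) →
            (∀ t ∈ Set.Icc T1 T2, ∀ i ∈ Finset.Icc 1 (N + 1),
              c0 / N ≤ pad N (X t) i - pad N (X t) (i - 1) ∧
                pad N (X t) i - pad N (X t) (i - 1) ≤ C0 / N) →
            -- conclusion: the L² stability estimate on `[T1, T2]`
            ∀ t ∈ Set.Icc T1 T2,
              (1 / (N : ℝ)) * ∑ i ∈ Finset.Icc 1 N, (x t i - X t i) ^ 2 ≤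
                Real.exp (-cbar * (t - T1)) *
                  ((1 / (N : ℝ)) * ∑ i ∈ Finset.Icc 1 N, (x T1 i - X T1 i) ^ 2)
                + Cbar * (Chat / (N : ℝ) ^ 2) ^ 2 := by
  refine ⟨c0 / 16, (16 / c0) ^ 2, by positivity, by positivity, fun C0 hC0 =>
    ⟨min (1 / 2) (min (c0 / 4 / C0 ^ 2) (c0 / 16 / C0 ^ 3)), by positivity, ?_⟩⟩
  intro N hN ρ x X Chat T1 T2 hChat _ _ hρ hper _ hint hε hx hX hsx hsX
  obtain ⟨n, rfl⟩ : ∃ n, N = n + 1 := ⟨N - 1, by omega⟩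
  set ε := min (1 / 2) (min (c0 / 4 / C0 ^ 2) (c0 / 16 / C0 ^ 3))
  have hεhalf : ε ≤ 1 / 2 := min_le_left _ _
  have hε2 : ε * C0 ^ 2 ≤ c0 / 4 :=
    (le_div_iff₀ (by positivity)).mp ((min_le_right _ _).trans (min_le_left _ _))
  have hε3 : ε * C0 ^ 3 ≤ c0 / 16 :=
    (le_div_iff₀ (by positivity)).mp ((min_le_right _ _).trans (min_le_right _ _))
  have h1 : ∀ y, HasDerivAt ρ (deriv ρ y) y := fun y =>
    (hρ.differentiable (by norm_num) y).hasDerivAt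
  have hρ' : ContDiff ℝ 1 (deriv ρ) :=
    (contDiff_succ_iff_deriv.mp (show ContDiff ℝ (1 + 1) ρ by norm_num; exact hρ)).2.2
  have h2 : ∀ y, HasDerivAt (deriv ρ) (deriv (deriv ρ) y) y := fun y =>
    (hρ'.differentiable (by norm_num) y).hasDerivAt
  have hb1 : ∀ y, |deriv ρ y| ≤ ε := fun y => by
    obtain ⟨w, hw, hyw⟩ := hper.deriv_real.exists_mem_Ico₀ one_pos y
    rw [hyw]
    linarith [hε w ⟨hw.1, hw.2.le⟩ w ⟨hw.1, hw.2.le⟩, abs_nonneg (deriv (deriv ρ) w)]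
  have hb2 : ∀ y, |deriv (deriv ρ) y| ≤ ε := fun y => by
    obtain ⟨w, hw, hyw⟩ := hper.deriv_real.deriv_real.exists_mem_Ico₀ one_pos y
    rw [hyw]
    linarith [hε w ⟨hw.1, hw.2.le⟩ w ⟨hw.1, hw.2.le⟩, abs_nonneg (deriv ρ w)]
  have hlow : ∀ y, 1 / 2 ≤ ρ y := fun y => by
    linarith [one_sub_le_of_abs_deriv_le h1 hper hint hb1 y]
  have hρc : Continuous ρ := hρ.continuous
  set P : ℝ → ℝ := fun y => ∫ z in (0 : ℝ)..y, ρ z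
  set Q : ℝ → ℝ := fun y => ∫ z in (0 : ℝ)..y, z * ρ z
  have hP : ∀ y, HasDerivAt P (ρ y) y := fun y => hρc.integral_hasStrictDerivAt 0 y |>.hasDerivAt
  have hQ : ∀ y, HasDerivAt Q (y * ρ y) y := fun y =>
    (continuous_id.mul hρc).integral_hasStrictDerivAt 0 y |>.hasDerivAt
  simp only [integral_eq_cellForce hρc hP hQ] at hx hX
  push_cast at hx hX hsx hsX ⊢
  choose! R hRb hR using hX
  have hM : (0 : ℝ) < (n : ℝ) + 1 := by positivity
  set r := Chat / ((n : ℝ) + 1) ^ 2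
  have hdy : ∀ t ∈ Set.Icc T1 T2, HasDerivAt
      (fun s => ∑ i ∈ Finset.Icc 1 (n + 1), (x s i - X s i) ^ 2) _ t := fun t ht =>
    HasDerivAt.fun_sum fun i hi => ((hx t ht i hi).fun_sub (hR t ht i hi)).fun_pow 2
  have hfin := le_exp_mul_add_of_hasDerivAt_le (c := c0 / 16)
    (K := ((n : ℝ) + 1) * ((16 / c0) ^ 2 * r ^ 2)) hdy ?_ (by positivity)
  · intro t ht
    have := mul_le_mul_of_nonneg_left (hfin t ht) (by positivity : (0 : ℝ) ≤ 1 / ((n : ℝ) + 1))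
    refine this.trans_eq ?_
    field_simp
  · intro t ht
    have hmono := force_monotone h1 h2 hP hQ hb1 hb2 hlow hc0 hε2 hε3 n (x t) (X t)
      (hsx t ht) (hsX t ht)
    have hyoung : ∑ i ∈ Finset.Icc 1 (n + 1), -(2 * (x t i - X t i) * R t i) ≤
        ∑ i ∈ Finset.Icc 1 (n + 1), (c0 / 16 * (x t i - X t i) ^ 2 + 16 / c0 * r ^ 2) := by
      refine Finset.sum_le_sum fun i hi => ?_
      have hR2 : R t i ^ 2 ≤ r ^ 2 := sq_le_sq' (abs_le.mp (hRb t ht i hi)).1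
        (abs_le.mp (hRb t ht i hi)).2
      have hk : 0 < 16 / c0 := by positivity
      have hk' : c0 / 16 = (16 / c0)⁻¹ := by rw [inv_div]
      rw [hk']
      generalize 16 / c0 = k at hk
      have : k⁻¹ * (x t i - X t i + k * R t i) ^ 2 = k⁻¹ * (x t i - X t i) ^ 2
          + 2 * (x t i - X t i) * R t i + k * R t i ^ 2 := by field_simp; ring
      have h0 : 0 ≤ k⁻¹ * (x t i - X t i + k * R t i) ^ 2 := by positivity
      linarith [mul_le_mul_of_nonneg_left hR2 hk.le]
    rw [Finset.sum_add_distrib, ← Finset.mul_sum, Finset.sum_const, Nat.card_Icc,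
      Nat.add_sub_cancel, nsmul_eq_mul] at hyoung
    push_cast at hyoung
    have hcK : c0 / 16 * (((n : ℝ) + 1) * ((16 / c0) ^ 2 * r ^ 2))
        = ((n : ℝ) + 1) * (16 / c0 * r ^ 2) := by field_simp
    rw [hcK]
    have hsum := add_le_add (mul_le_mul_of_nonneg_left hmono (by norm_num : (0 : ℝ) ≤ 2)) hyoung
    refine le_trans (le_of_eq ?_) (hsum.trans (by linarith))
    rw [Finset.mul_sum, ← Finset.sum_add_distrib]
    refine Finset.sum_congr rfl fun i _ => ?_
    norm_num
    ring
end

section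
/- Let ρ:[0,1]→(0,∞) be a periodic probability density of class C^2, and let X_1, X_2 be smooth solutions of ∂_t X = (1/2)ρ(X)∂_θX ∂²_{θθ}X + (1/6)ρ'(X)(∂_θX)^3 on [0,∞)×[0,1] with X_i(t,0)=0, X_i(t,1)=1, satisfying 0 < c_0 ≤ ∂_θX_i(0,θ) ≤ C_0 for i = 1,2. Then there exists ε_0 = ε_0(c_0,C_0) > 0 such that if ‖ρ'‖_∞ + ‖ρ''‖_∞ ≤ ε_0, there is a constant c̄ = c̄(c_0) > 0 with ∫_0^1 |X_1(t,θ)−X_2(t,θ)|^2 dθ ≤ ( ∫_0^1 |X_1(0,θ)−X_2(0,θ)|^2 dθ ) e^{−c̄ t} for all t ≥ 0. -/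
open MeasureTheory

open Set Filter Topology

/-- Second order necessary condition at a local maximum. -/
lemma deriv_deriv_nonpos_of_isLocalMax {f : ℝ → ℝ} {x : ℝ} (hf : Continuous f)
    (h : IsLocalMax f x) : deriv (deriv f) x ≤ 0 := by
  by_contra! hpos
  have hmin := isLocalMin_of_deriv_deriv_pos hpos h.deriv_eq_zero hf.continuousAt
  have hconst : f =ᶠ[𝓝 x] fun _ => f x := by
    filter_upwards [h, hmin] with y h1 h2 using le_antisymm h1 h2
  have h2 : deriv (deriv f) x = 0 := by
    have := hconst.deriv.deriv_eq
    simpa using this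
  exact hpos.ne' h2

lemma HasDerivAt.nonneg_of_left_max {f : ℝ → ℝ} {d s t : ℝ} (hst : s < t)
    (hf : HasDerivAt f d t) (hmax : ∀ r ∈ Icc s t, f r ≤ f t) : 0 ≤ d := by
  have h1 : Tendsto (slope f t) (𝓝[<] t) (𝓝 d) :=
    hf.tendsto_slope.mono_left (nhdsWithin_mono _ fun r hr => ne_of_lt hr)
  refine ge_of_tendsto h1 ?_
  filter_upwards [Ioo_mem_nhdsLT hst] with r hr
  rw [slope_def_field]
  exact div_nonneg_of_nonpos (sub_nonpos.2 (hmax r ⟨hr.1.le, hr.2.le⟩)) (sub_nonpos.2 hr.2.le)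

/-- Abstract maximum principle: if `f τ` does not increase at its maximizers above level `M`,
then the bound `f ≤ M` propagates in time. -/
lemma le_of_deriv_nonpos_at_maximizers {α : Type*} [TopologicalSpace α] {K : Set α}
    (hK : IsCompact K) {f : ℝ → α → ℝ} {s t M : ℝ} (hst : s ≤ t)
    (hf : ContinuousOn (Function.uncurry f) (Icc s t ×ˢ K)) (h0 : ∀ x ∈ K, f s x ≤ M)
    (h : ∀ τ ∈ Ioc s t, ∀ x ∈ K, (∀ y ∈ K, f τ y ≤ f τ x) → M < f τ x →
      ∃ d ≤ 0, HasDerivAt (fun r => f r x) d τ) :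
    ∀ x ∈ K, f t x ≤ M := by
  intro x₁ hx₁
  by_contra! hlt
  obtain ⟨ε, hε, hεt⟩ : ∃ ε > 0, ε * (t - s) < f t x₁ - M := by
    refine ⟨(f t x₁ - M) / (t - s + 1), by apply div_pos <;> linarith, ?_⟩
    rw [div_mul_eq_mul_div, div_lt_iff₀ (by linarith)]
    nlinarith
  obtain ⟨⟨τ, x⟩, ⟨hτ, hx⟩, hmax⟩ := (isCompact_Icc.prod hK).exists_isMaxOn
    ⟨(t, x₁), ⟨⟨hst, le_rfl⟩, hx₁⟩⟩
    (hf.sub (f := fun p : ℝ × α => Function.uncurry f p) (g := fun p => ε * (p.1 - s))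
      (by fun_prop))
  have hmax' : ∀ r ∈ Icc s t, ∀ y ∈ K, f r y - ε * (r - s) ≤ f τ x - ε * (τ - s) :=
    fun r hr y hy => hmax (show (r, y) ∈ Icc s t ×ˢ K from ⟨hr, hy⟩)
  have h1 := hmax' t ⟨hst, le_rfl⟩ x₁ hx₁
  have hτs : s < τ := by
    refine lt_of_le_of_ne hτ.1 fun hs => ?_
    subst hs
    have := h0 x hx
    simp only [sub_self] at h1
    linarith
  have hpos : 0 ≤ ε * (τ - s) := mul_nonneg hε.le (by linarith)
  obtain ⟨d, hd, hder⟩ := h τ ⟨hτs, hτ.2⟩ x hx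
    (fun y hy => by have := hmax' τ hτ y hy; linarith) (by linarith)
  have hder' : HasDerivAt (fun r => f r x - ε * (r - s)) (d - ε * 1) τ :=
    hder.sub (((hasDerivAt_id τ).sub_const s).const_mul ε)
  have := hder'.nonneg_of_left_max hτs
    (fun r hr => hmax' r ⟨hr.1, hr.2.trans hτ.2⟩ x hx)
  linarith

/-- A family that is uniformly one-sided Lipschitz in space, continuous in time, and continuous in
space at time `s`, is jointly continuous at time `s`. -/
lemma continuousWithinAt_uncurry_of_slope_ge {Y : ℝ → ℝ → ℝ} {S : Set ℝ} {s L θ : ℝ}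
    (hslope : ∀ t ∈ S, ∀ a ∈ Icc (0 : ℝ) 1, ∀ b ∈ Icc (0 : ℝ) 1, a ≤ b →
      -L * (b - a) ≤ Y t b - Y t a)
    (hspace : ContinuousOn (Y s) (Icc 0 1))
    (htime : ∀ a ∈ Icc (0 : ℝ) 1, ContinuousWithinAt (fun t => Y t a) S s)
    (hθ : θ ∈ Icc (0 : ℝ) 1) :
    ContinuousWithinAt (Function.uncurry Y) (S ×ˢ Icc 0 1) (s, θ) := by
  have hcont : ContinuousOn (fun a => Y s a + L * a) (Icc 0 1) := by fun_prop
  rw [Metric.continuousWithinAt_iff']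
  intro ε hε
  obtain ⟨δ, hδ, hδ'⟩ := Metric.continuousOn_iff.1 hcont θ hθ (ε / 4) (by positivity)
  set a := max 0 (θ - δ / 2) with ha
  set b := min 1 (θ + δ / 2) with hb
  have haθ : a ≤ θ := max_le hθ.1 (by linarith)
  have hθb : θ ≤ b := le_min hθ.2 (by linarith)
  have haI : a ∈ Icc (0 : ℝ) 1 := ⟨le_max_left _ _, haθ.trans hθ.2⟩
  have hbI : b ∈ Icc (0 : ℝ) 1 := ⟨hθ.1.trans hθb, min_le_left _ _⟩
  have hda := hδ' a haI (by
    rw [Real.dist_eq, abs_lt]; constructor <;> linarith [le_max_right 0 (θ - δ / 2)])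
  have hdb := hδ' b hbI (by
    rw [Real.dist_eq, abs_lt]; constructor <;> linarith [min_le_right 1 (θ + δ / 2)])
  have hta := Metric.continuousWithinAt_iff'.1 (htime a haI) (ε / 4) (by positivity)
  have htb := Metric.continuousWithinAt_iff'.1 (htime b hbI) (ε / 4) (by positivity)
  have hθ1 : ∀ᶠ c in 𝓝 θ, (L * c - L * θ) ∈ Ioo (-(ε / 4)) (ε / 4) := by
    have : ContinuousAt (fun c => L * c - L * θ) θ := by fun_prop
    exact this (Ioo_mem_nhds (by simp; positivity) (by simp; positivity))
  have hθ2 : ∀ᶠ c in 𝓝[Icc 0 1] θ, c ∈ Icc (0 : ℝ) 1 ∧ a ≤ c ∧ c ≤ b := by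
    have h1 : ∀ᶠ c in 𝓝 θ, θ - δ / 2 < c := lt_mem_nhds (by linarith)
    have h2 : ∀ᶠ c in 𝓝 θ, c < θ + δ / 2 := gt_mem_nhds (by linarith)
    filter_upwards [h1.filter_mono nhdsWithin_le_nhds, h2.filter_mono nhdsWithin_le_nhds,
      self_mem_nhdsWithin] with c h1 h2 h3
    exact ⟨h3, max_le h3.1 h1.le, le_min h3.2 h2.le⟩
  rw [nhdsWithin_prod_eq]
  have hθ3 := hθ2.and (hθ1.filter_mono nhdsWithin_le_nhds)
  have hS : ∀ᶠ t in 𝓝[S] s, t ∈ S := self_mem_nhdsWithin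
  filter_upwards [(hS.and (hta.and htb)).prod_mk hθ3]
  rintro ⟨t, c⟩ ⟨⟨htS, h1, h2⟩, ⟨hc, hac, hcb⟩, h3, h4⟩
  simp only [Function.uncurry_apply_pair, Real.dist_eq, abs_lt] at *
  have h5 := hslope t htS a haI c hc hac
  have h6 := hslope t htS c hc b hbI hcb
  constructor <;> nlinarith

/-- `Y` solves, at the times in `S`, a scalar equation `∂ₜY = κ(t,θ) ∂_θY ∂²_θθY` on `[0,1]` with
some `κ ≥ 0`, and is stationary at the two endpoints. -/
structure IsGradientParabolic (Y : ℝ → ℝ → ℝ) (S : Set ℝ) : Prop where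
  contDiff : ∀ t ∈ S, ContDiff ℝ 2 (Y t)
  hasDerivAt : ∀ t ∈ S, ∀ θ ∈ Icc (0 : ℝ) 1, ∃ κ : ℝ, 0 ≤ κ ∧
    HasDerivAt (fun s => Y s θ) (κ * deriv (Y t) θ * deriv (deriv (Y t)) θ) t
  left_stationary : ∀ t ∈ S, HasDerivAt (fun s => Y s 0) 0 t
  right_stationary : ∀ t ∈ S, HasDerivAt (fun s => Y s 1) 0 t

namespace IsGradientParabolic

variable {Y : ℝ → ℝ → ℝ} {S : Set ℝ}

lemma mono {S' : Set ℝ} (h : IsGradientParabolic Y S) (hS : S' ⊆ S) :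
    IsGradientParabolic Y S' :=
  ⟨fun t ht => h.contDiff t (hS ht), fun t ht => h.hasDerivAt t (hS ht),
    fun t ht => h.left_stationary t (hS ht), fun t ht => h.right_stationary t (hS ht)⟩

lemma continuousAt (h : IsGradientParabolic Y S) {t θ : ℝ} (ht : t ∈ S)
    (hθ : θ ∈ Icc (0 : ℝ) 1) : ContinuousAt (fun s => Y s θ) t := by
  obtain ⟨κ, -, hκ⟩ := h.hasDerivAt t ht θ hθ
  exact hκ.continuousAt

/-- The equation is invariant under `Y(t,θ) ↦ -Y(-t,θ)`. -/
lemma reverse (h : IsGradientParabolic Y S) :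
    IsGradientParabolic (fun t θ => -Y (-t) θ) (Neg.neg ⁻¹' S) := by
  have key : ∀ {t d θ : ℝ}, HasDerivAt (fun s => Y s θ) d (-t) →
      HasDerivAt (fun s => -Y (-s) θ) d t := by
    intro t d θ hd
    have := (HasDerivAt.scomp t hd (hasDerivAt_neg t)).neg
    simpa [Function.comp_def] using! this
  refine ⟨fun t ht => (h.contDiff _ ht).neg, fun t ht θ hθ => ?_, fun t ht => ?_, fun t ht => ?_⟩
  · obtain ⟨κ, h0, hκ⟩ := h.hasDerivAt _ ht θ hθ
    refine ⟨κ, h0, ?_⟩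
    convert key hκ using 1
    have h1 : deriv (fun θ => -Y (-t) θ) = fun θ => -deriv (Y (-t)) θ := by
      ext; simp
    simp only [h1, deriv.fun_neg]
    ring
  · exact key (h.left_stationary _ ht)
  · exact key (h.right_stationary _ ht)

lemma exists_deriv_nonpos_at_max (h : IsGradientParabolic Y S) {t L b : ℝ} (ht : t ∈ S)
    (hL : 0 ≤ L) (hb : b ∈ Icc (0 : ℝ) 1)
    (hmax : ∀ᶠ c in 𝓝[Icc 0 1] b, Y t c - L * c ≤ Y t b - L * b) :
    ∃ d ≤ 0, HasDerivAt (fun s => Y s b) d t := by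
  rcases hb.1.eq_or_lt with rfl | h0
  · exact ⟨0, le_rfl, h.left_stationary t ht⟩
  rcases hb.2.eq_or_lt with rfl | h1
  · exact ⟨0, le_rfl, h.right_stationary t ht⟩
  rw [nhdsWithin_eq_nhds.2 (Icc_mem_nhds h0 h1)] at hmax
  have hC := h.contDiff t ht
  have hd : ∀ c, HasDerivAt (fun c => Y t c - L * c) (deriv (Y t) c - L) c := fun c => by
    simpa using! ((hC.differentiable (by norm_num) c).hasDerivAt).sub ((hasDerivAt_id c).const_mul L)
  have hloc : IsLocalMax (fun c => Y t c - L * c) b := hmax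
  have hfst := hloc.hasDerivAt_eq_zero (hd b)
  have hsnd := deriv_deriv_nonpos_of_isLocalMax
    (continuous_iff_continuousAt.2 fun c => (hd c).continuousAt) hloc
  rw [show deriv (fun c => Y t c - L * c) = fun c => deriv (Y t) c - L from
    funext fun c => (hd c).deriv, deriv_sub_const] at hsnd
  obtain ⟨κ, hκ, hder⟩ := h.hasDerivAt t ht b hb
  refine ⟨_, ?_, hder⟩
  rw [sub_eq_zero.1 hfst]
  exact mul_nonpos_of_nonneg_of_nonpos (mul_nonneg hκ hL) hsnd

lemma exists_deriv_nonneg_at_min (h : IsGradientParabolic Y S) {t L b : ℝ} (ht : t ∈ S)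
    (hL : 0 ≤ L) (hb : b ∈ Icc (0 : ℝ) 1)
    (hmin : ∀ᶠ c in 𝓝[Icc 0 1] b, Y t b - L * b ≤ Y t c - L * c) :
    ∃ d, 0 ≤ d ∧ HasDerivAt (fun s => Y s b) d t := by
  rcases hb.1.eq_or_lt with rfl | h0
  · exact ⟨0, le_rfl, h.left_stationary t ht⟩
  rcases hb.2.eq_or_lt with rfl | h1
  · exact ⟨0, le_rfl, h.right_stationary t ht⟩
  rw [nhdsWithin_eq_nhds.2 (Icc_mem_nhds h0 h1)] at hmin
  have hC := h.contDiff t ht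
  have hd : ∀ c, HasDerivAt (fun c => L * c - Y t c) (L - deriv (Y t) c) c := fun c => by
    simpa using! ((hasDerivAt_id c).const_mul L).sub ((hC.differentiable (by norm_num) c).hasDerivAt)
  have hloc : IsLocalMax (fun c => L * c - Y t c) b := by
    filter_upwards [hmin] with c hc
    linarith
  have hfst := hloc.hasDerivAt_eq_zero (hd b)
  have hsnd := deriv_deriv_nonpos_of_isLocalMax
    (continuous_iff_continuousAt.2 fun c => (hd c).continuousAt) hloc
  rw [show deriv (fun c => L * c - Y t c) = fun c => L - deriv (Y t) c from
    funext fun c => (hd c).deriv, deriv_const_sub] at hsnd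
  obtain ⟨κ, hκ, hder⟩ := h.hasDerivAt t ht b hb
  refine ⟨_, ?_, hder⟩
  rw [← sub_eq_zero.1 hfst]
  exact mul_nonneg (mul_nonneg hκ hL) (by linarith)

/-- One-sided bounds on difference quotients propagate in time. With `σ = 1` this is an upper bound
on the slopes, with `σ = -1` a lower bound. -/
lemma slope_bound (h : IsGradientParabolic Y S) {σ s t L : ℝ} (hσ : σ ≠ 0) (hst : s ≤ t)
    (hS : Ioc s t ⊆ S) (hL : 0 ≤ L)
    (hcont : ContinuousOn (Function.uncurry Y) (Icc s t ×ˢ Icc 0 1))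
    (h0 : ∀ a ∈ Icc (0 : ℝ) 1, ∀ b ∈ Icc (0 : ℝ) 1, 0 ≤ σ * (b - a) →
      Y s b - Y s a ≤ L * (b - a)) :
    ∀ a ∈ Icc (0 : ℝ) 1, ∀ b ∈ Icc (0 : ℝ) 1, 0 ≤ σ * (b - a) →
      Y t b - Y t a ≤ L * (b - a) := by
  let K : Set (ℝ × ℝ) := (Icc 0 1 ×ˢ Icc 0 1) ∩ {p | 0 ≤ σ * (p.2 - p.1)}
  have hK : IsCompact K := (isCompact_Icc.prod isCompact_Icc).inter_right
    (isClosed_le continuous_const (by fun_prop))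
  have key := le_of_deriv_nonpos_at_maximizers (M := 0) hK
    (f := fun τ p => Y τ p.2 - Y τ p.1 - L * (p.2 - p.1)) hst ?_ ?_ ?_
  · intro a ha b hb hab
    have := key (a, b) ⟨⟨ha, hb⟩, hab⟩
    simp only at this
    linarith
  · have h1 : ContinuousOn (fun q : ℝ × ℝ × ℝ => Function.uncurry Y (q.1, q.2.2))
        (Icc s t ×ˢ K) := hcont.comp (by fun_prop) fun q hq => ⟨hq.1, hq.2.1.2⟩
    have h2 : ContinuousOn (fun q : ℝ × ℝ × ℝ => Function.uncurry Y (q.1, q.2.1))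
        (Icc s t ×ˢ K) := hcont.comp (by fun_prop) fun q hq => ⟨hq.1, hq.2.1.1⟩
    exact (h1.sub h2).sub (by fun_prop)
  · rintro ⟨a, b⟩ ⟨⟨ha, hb⟩, hab⟩
    have := h0 a ha b hb hab
    simp only
    linarith
  · rintro τ hτ ⟨a, b⟩ ⟨⟨ha, hb⟩, hab⟩ hmax hpos
    simp only [mem_ofPred_eq] at ha hb hab hpos
    have hne : a ≠ b := by
      rintro rfl
      simp at hpos
    have hlt : 0 < σ * (b - a) :=
      lt_of_le_of_ne hab (mul_ne_zero hσ (sub_ne_zero.2 hne.symm)).symm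
    have ev1 : ∀ᶠ c in 𝓝 b, 0 < σ * (c - a) :=
      ContinuousAt.eventually_lt (by fun_prop) (by fun_prop) hlt
    have ev2 : ∀ᶠ c in 𝓝 a, 0 < σ * (b - c) :=
      ContinuousAt.eventually_lt (by fun_prop) (by fun_prop) hlt
    obtain ⟨d, hd, hder⟩ := h.exists_deriv_nonpos_at_max (hS hτ) hL hb (by
      filter_upwards [ev1.filter_mono nhdsWithin_le_nhds, self_mem_nhdsWithin] with c h1 h2
      have := hmax (a, c) ⟨⟨ha, h2⟩, h1.le⟩
      simp only at this
      linarith)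
    obtain ⟨e, he, hder'⟩ := h.exists_deriv_nonneg_at_min (hS hτ) hL ha (by
      filter_upwards [ev2.filter_mono nhdsWithin_le_nhds, self_mem_nhdsWithin] with c h1 h2
      have := hmax (c, b) ⟨⟨h2, hb⟩, h1.le⟩
      simp only at this
      linarith)
    exact ⟨d - e, by linarith, (hder.sub hder').sub_const _⟩

lemma exists_lipschitz (h : IsGradientParabolic Y S) {t : ℝ} (ht : t ∈ S) :
    ∃ L : ℝ, 0 ≤ L ∧ ∀ a ∈ Icc (0 : ℝ) 1, ∀ b ∈ Icc (0 : ℝ) 1, a ≤ b →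
      |Y t b - Y t a| ≤ L * (b - a) := by
  have hC := h.contDiff t ht
  have hcd : Continuous (deriv (Y t)) := hC.continuous_deriv (by norm_num)
  obtain ⟨L, hL⟩ := isCompact_Icc.exists_bound_of_continuousOn (s := Icc (0 : ℝ) 1) hcd.continuousOn
  refine ⟨L, (norm_nonneg _).trans (hL 0 ⟨le_rfl, zero_le_one⟩), fun a ha b hb hab => ?_⟩
  have := (convex_Icc (0 : ℝ) 1).norm_image_sub_le_of_norm_deriv_le
    (fun x _ => hC.differentiable (by norm_num) x) hL ha hb
  rwa [Real.norm_eq_abs, Real.norm_eq_abs, abs_of_nonneg (sub_nonneg.2 hab)] at this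

/-- Joint continuity on an open time interval extends to its initial time. -/
lemma continuousOn_Icc_of_Ioo (h : IsGradientParabolic Y S) {α β t : ℝ} (hS : Ico α β ⊆ S)
    (hcont : ContinuousOn (Function.uncurry Y) (Ioo α β ×ˢ Icc 0 1)) (ht : t ∈ Ioo α β) :
    ContinuousOn (Function.uncurry Y) (Icc α t ×ˢ Icc 0 1) := by
  have htS : ∀ s ∈ Icc α t, s ∈ S := fun s hs => hS ⟨hs.1, hs.2.trans_lt ht.2⟩
  obtain ⟨L, hL, hLip⟩ := h.exists_lipschitz (htS t ⟨ht.1.le, le_rfl⟩)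
  have hpos : ∀ s ∈ Ioc α t, ∀ a ∈ Icc (0 : ℝ) 1, ∀ b ∈ Icc (0 : ℝ) 1, a ≤ b →
      -L * (b - a) ≤ Y s b - Y s a := by
    intro s hs a ha b hb hab
    have hIoo : ∀ r ∈ Icc (-t) (-s), -r ∈ Ioo α β := fun r hr =>
      ⟨by linarith [hr.2, hs.1], by linarith [hr.1, ht.2]⟩
    have := h.reverse.slope_bound (σ := 1) (s := -t) (t := -s) one_ne_zero (by linarith [hs.2])
      (fun r hr => hS ⟨(hIoo r ⟨hr.1.le, hr.2⟩).1.le, (hIoo r ⟨hr.1.le, hr.2⟩).2⟩) hL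
      (by
        have : ContinuousOn (fun p : ℝ × ℝ => Function.uncurry Y (-p.1, p.2))
            (Icc (-t) (-s) ×ˢ Icc 0 1) :=
          hcont.comp (by fun_prop) fun p hp => ⟨hIoo p.1 hp.1, hp.2⟩
        exact this.neg)
      (fun a ha b hb hab => by
        have := (abs_le.1 (hLip a ha b hb (by linarith))).1
        simp only [neg_neg]
        linarith) a ha b hb (by linarith)
    simp only [neg_neg] at this
    linarith
  have hslope : ∀ s ∈ Icc α t, ∀ a ∈ Icc (0 : ℝ) 1, ∀ b ∈ Icc (0 : ℝ) 1, a ≤ b →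
      -L * (b - a) ≤ Y s b - Y s a := by
    intro s hs a ha b hb hab
    rcases hs.1.eq_or_lt with rfl | hlt
    · have hlim : Tendsto (fun r => Y r b - Y r a) (𝓝[>] α) (𝓝 (Y α b - Y α a)) :=
        ((h.continuousAt (htS α hs) hb).sub (h.continuousAt (htS α hs) ha)).mono_left
          nhdsWithin_le_nhds
      refine ge_of_tendsto hlim ?_
      filter_upwards [Ioc_mem_nhdsGT ht.1] with r hr using hpos r hr a ha b hb hab
    · exact hpos s ⟨hlt, hs.2⟩ a ha b hb hab
  rintro ⟨s, θ⟩ ⟨hs, hθ⟩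
  exact continuousWithinAt_uncurry_of_slope_ge hslope
    (h.contDiff s (htS s hs)).continuous.continuousOn
    (fun a ha => (h.continuousAt (htS s hs) ha).continuousWithinAt) hθ

lemma slope_le_of_Ioo (h : IsGradientParabolic Y S) {α β L : ℝ} (hS : Ico α β ⊆ S) (hL : 0 ≤ L)
    (hcont : ContinuousOn (Function.uncurry Y) (Ioo α β ×ˢ Icc 0 1))
    (h0 : ∀ a ∈ Icc (0 : ℝ) 1, ∀ b ∈ Icc (0 : ℝ) 1, a ≤ b → Y α b - Y α a ≤ L * (b - a))
    {t : ℝ} (ht : t ∈ Ioo α β) :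
    ∀ a ∈ Icc (0 : ℝ) 1, ∀ b ∈ Icc (0 : ℝ) 1, a ≤ b → Y t b - Y t a ≤ L * (b - a) := by
  intro a ha b hb hab
  exact h.slope_bound one_ne_zero ht.1.le (fun r hr => hS ⟨hr.1.le, hr.2.trans_lt ht.2⟩) hL
    (h.continuousOn_Icc_of_Ioo hS hcont ht)
    (fun a ha b hb hab => h0 a ha b hb (by linarith)) a ha b hb (by linarith)

/-- A Lipschitz bound at both ends of a time interval on whose interior `Y` is jointly continuous
holds throughout: upper slope bounds propagate forward and lower ones backward in time. -/
lemma lipschitz_of_Ioo (h : IsGradientParabolic Y S) {α β L : ℝ} (hS : Icc α β ⊆ S) (hL : 0 ≤ L)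
    (hcont : ContinuousOn (Function.uncurry Y) (Ioo α β ×ˢ Icc 0 1))
    (hα : ∀ a ∈ Icc (0 : ℝ) 1, ∀ b ∈ Icc (0 : ℝ) 1, a ≤ b → |Y α b - Y α a| ≤ L * (b - a))
    (hβ : ∀ a ∈ Icc (0 : ℝ) 1, ∀ b ∈ Icc (0 : ℝ) 1, a ≤ b → |Y β b - Y β a| ≤ L * (b - a))
    {t : ℝ} (ht : t ∈ Ioo α β) :
    ∀ a ∈ Icc (0 : ℝ) 1, ∀ b ∈ Icc (0 : ℝ) 1, a ≤ b → |Y t b - Y t a| ≤ L * (b - a) := by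
  intro a ha b hb hab
  have h1 := h.slope_le_of_Ioo (Ico_subset_Icc_self.trans hS) hL hcont
    (fun a ha b hb hab => (abs_le.1 (hα a ha b hb hab)).2) ht a ha b hb hab
  have h2 := h.reverse.slope_le_of_Ioo (α := -β) (β := -α) (t := -t)
    (fun r hr => hS ⟨by linarith [hr.2], by linarith [hr.1]⟩) hL
    (by
      have : ContinuousOn (fun p : ℝ × ℝ => Function.uncurry Y (-p.1, p.2))
          (Ioo (-β) (-α) ×ˢ Icc 0 1) :=
        hcont.comp (by fun_prop) fun p hp =>
          ⟨⟨by linarith [hp.1.2], by linarith [hp.1.1]⟩, hp.2⟩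
      exact this.neg)
    (fun a ha b hb hab => by
      have := (abs_le.1 (hβ a ha b hb hab)).1
      simp only [neg_neg]
      linarith) ⟨by linarith [ht.2], by linarith [ht.1]⟩ a ha b hb hab
  simp only [neg_neg] at h2
  exact abs_le.2 ⟨by linarith, h1⟩

/-- Separate regularity implies joint continuity. The times without a locally uniform Lipschitz
bound form a closed set; by the Baire category theorem, if it were nonempty a uniform bound would
hold on a relatively open portion of it, and then also across the complementary gaps. -/
theorem continuousOn_uncurry (h : IsGradientParabolic Y (Ici 0)) :
    ContinuousOn (Function.uncurry Y) (Ici 0 ×ˢ Icc 0 1) := by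
  let Lip : ℝ → ℝ → Prop := fun N t => ∀ a ∈ Icc (0 : ℝ) 1, ∀ b ∈ Icc (0 : ℝ) 1, a ≤ b →
    |Y t b - Y t a| ≤ N * (b - a)
  have Lip_mono : ∀ {M N t}, M ≤ N → Lip M t → Lip N t := fun hMN hM a ha b hb hab =>
    (hM a ha b hb hab).trans (mul_le_mul_of_nonneg_right hMN (sub_nonneg.2 hab))
  let good : ℝ → Prop := fun t => ∃ N, ∀ᶠ s in 𝓝[Ici 0] t, Lip N s
  have cont_of_good : ∀ t ∈ Ici (0 : ℝ), good t → ∀ θ ∈ Icc (0 : ℝ) 1,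
      ContinuousWithinAt (Function.uncurry Y) (Ici 0 ×ˢ Icc 0 1) (t, θ) := by
    rintro t ht ⟨N, hN⟩ θ hθ
    have hc : ContinuousWithinAt (Function.uncurry Y) ({s | s ∈ Ici 0 ∧ Lip N s} ×ˢ Icc 0 1)
        (t, θ) :=
      continuousWithinAt_uncurry_of_slope_ge (L := N)
        (fun s hs a ha b hb hab => by linarith [(abs_le.1 (hs.2 a ha b hb hab)).1])
        (h.contDiff t ht).continuous.continuousOn
        (fun a ha => (h.continuousAt ht ha).continuousWithinAt) hθ
    refine hc.mono_of_mem_nhdsWithin ?_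
    rw [nhdsWithin_prod_eq]
    exact prod_mem_prod (inter_mem self_mem_nhdsWithin hN) self_mem_nhdsWithin
  suffices hgood : ∀ t ∈ Ici (0 : ℝ), good t by
    rintro ⟨t, θ⟩ ⟨ht, hθ⟩
    exact cont_of_good t ht (hgood t ht) θ hθ
  let E : Set ℝ := {t | t ∈ Ici (0 : ℝ) ∧ ¬ good t}
  have hEclosed : IsClosed E := by
    rw [← isOpen_compl_iff, isOpen_iff_mem_nhds]
    intro t ht
    by_cases h0 : t ∈ Ici (0 : ℝ)
    · obtain ⟨N, hN⟩ : good t := by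
        by_contra hg
        exact ht ⟨h0, hg⟩
      have := eventually_eventually_nhdsWithin.2 hN
      rw [eventually_nhdsWithin_iff] at this
      filter_upwards [this] with s hs hsE
      exact hsE.2 ⟨N, hs hsE.1⟩
    · filter_upwards [isClosed_Ici.isOpen_compl.mem_nhds h0] with s hs hsE using hs hsE.1
  by_contra! hbad
  obtain ⟨t₁, ht₁, hbad₁⟩ := hbad
  have : Nonempty E := ⟨⟨t₁, ht₁, hbad₁⟩⟩
  have : CompleteSpace E := hEclosed.completeSpace_coe
  obtain ⟨n, ⟨t₀, ht₀⟩, hint⟩ := nonempty_interior_of_iUnion_of_closed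
    (f := fun n : ℕ => {t : E | Lip n t}) (fun n => by
      simp only [Lip, ofPred_forall]
      refine isClosed_iInter fun a => isClosed_iInter fun ha => isClosed_iInter fun b =>
        isClosed_iInter fun hb => isClosed_iInter fun hab => isClosed_le ?_ continuous_const
      have hY : ∀ c ∈ Icc (0 : ℝ) 1, Continuous fun t : E => Y t c := fun c hc =>
        continuous_iff_continuousAt.2 fun t =>
          ContinuousAt.comp (f := fun t : E => (t : ℝ)) (g := fun s => Y s c)
            (h.continuousAt t.2.1 hc) continuous_subtype_val.continuousAt
      exact ((hY b hb).sub (hY a ha)).abs) (by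
      refine eq_univ_of_forall fun t => mem_iUnion.2 ?_
      obtain ⟨L, -, hL⟩ := h.exists_lipschitz t.2.1
      obtain ⟨n, hn⟩ := exists_nat_ge L
      exact ⟨n, Lip_mono hn hL⟩)
  obtain ⟨δ, hδ, hball⟩ := Metric.mem_nhds_iff.1 (mem_interior_iff_mem_nhds.1 hint)
  have hLipE : ∀ t ∈ E, |t - t₀| < δ → Lip n t := fun t ht htδ =>
    hball (show (⟨t, ht⟩ : E) ∈ Metric.ball _ _ from htδ)
  have ht₀0 : 0 ≤ t₀ := ht₀.1
  set l := max 0 (t₀ - δ / 2) with hl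
  set r := t₀ + δ / 2 with hr
  have hl0 : 0 ≤ l := le_max_left _ _
  have hlt : l ≤ t₀ := max_le ht₀0 (by linarith)
  obtain ⟨Ll, -, hLl⟩ := h.exists_lipschitz (t := l) hl0
  obtain ⟨Lr, -, hLr⟩ := h.exists_lipschitz (t := r) (show (0 : ℝ) ≤ r by linarith)
  let N : ℝ := max n (max Ll Lr)
  have hN0 : 0 ≤ N := n.cast_nonneg.trans (le_max_left _ _)
  let T : Set ℝ := (E ∩ Icc l r) ∪ {l, r}
  have hT : IsCompact T := (isCompact_Icc.inter_left hEclosed).union (by simp)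
  have hTsub : T ⊆ Icc l r := by
    rintro t (ht | rfl | rfl)
    exacts [ht.2, ⟨le_rfl, by linarith⟩, ⟨by linarith, le_rfl⟩]
  have hTLip : ∀ t ∈ T, Lip N t := by
    rintro t (⟨htE, ht⟩ | rfl | rfl)
    · refine Lip_mono (le_max_left _ _) (hLipE t htE ?_)
      rw [abs_lt]
      constructor <;> linarith [ht.1, ht.2, le_max_right 0 (t₀ - δ / 2)]
    · exact Lip_mono ((le_max_left _ _).trans (le_max_right _ _)) hLl
    · exact Lip_mono ((le_max_right _ _).trans (le_max_right _ _)) hLr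
  have hall : ∀ t ∈ Icc l r, Lip N t := by
    intro t ht
    by_cases htT : t ∈ T
    · exact hTLip t htT
    obtain ⟨α, ⟨hαT, hαt⟩, hα⟩ := (hT.inter_right isClosed_Iic).exists_isGreatest
      ⟨l, (show l ∈ T from Or.inr (Or.inl rfl)), (show l ∈ Iic t from ht.1)⟩
    obtain ⟨β, ⟨hβT, hβt⟩, hβ⟩ := (hT.inter_right isClosed_Ici).exists_isLeast
      ⟨r, (show r ∈ T from Or.inr (Or.inr rfl)), (show r ∈ Ici t from ht.2)⟩
    have hαt' : α < t := lt_of_le_of_ne hαt fun he => htT (he ▸ hαT)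
    have hβt' : t < β := lt_of_le_of_ne hβt fun he => htT (he ▸ hβT)
    have h0 : ∀ s, α ≤ s → 0 ≤ s := fun s hs => hl0.trans ((hTsub hαT).1.trans hs)
    refine h.lipschitz_of_Ioo (fun s hs => h0 s hs.1) hN0 ?_ (hTLip α hαT) (hTLip β hβT)
      ⟨hαt', hβt'⟩
    rintro ⟨s, θ⟩ ⟨hs, hθ⟩
    refine (cont_of_good s (h0 s hs.1.le) ?_ θ hθ).mono
      (prod_mono (fun s hs => h0 s hs.1.le) Subset.rfl)
    by_contra hsg
    have hsT : s ∈ T := Or.inl ⟨⟨h0 s hs.1.le, hsg⟩,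
      (hTsub hαT).1.trans hs.1.le, hs.2.le.trans (hTsub hβT).2⟩
    rcases le_total s t with hst | hst
    · exact absurd (hα ⟨hsT, hst⟩) (not_le.2 hs.1)
    · exact absurd (hβ ⟨hsT, hst⟩) (not_le.2 hs.2)
  refine ht₀.2 ⟨N, ?_⟩
  rw [eventually_nhdsWithin_iff]
  filter_upwards [Ioo_mem_nhds (show t₀ - δ / 2 < t₀ by linarith) (show t₀ < r by linarith)]
    with s hs hs0
  exact hall s ⟨max_le hs0 hs.1.le, hs.2.le⟩

end IsGradientParabolic

/-- Classical solutions of the gradient flow of `(1/12) ∫ ρ(X) (∂_θX)³` with boundary values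
`0` and `1`. -/
structure IsEnergyFlow (ρ : ℝ → ℝ) (X : ℝ → ℝ → ℝ) : Prop where
  contDiff : ∀ t, 0 ≤ t → ContDiff ℝ 2 (X t)
  hasDerivAt : ∀ t, 0 ≤ t → ∀ θ ∈ Icc (0 : ℝ) 1, HasDerivAt (fun s => X s θ)
    ((1 / 2) * ρ (X t θ) * deriv (X t) θ * deriv (deriv (X t)) θ
      + (1 / 6) * deriv ρ (X t θ) * (deriv (X t) θ) ^ 3) t
  boundary : ∀ t, 0 ≤ t → X t 0 = 0 ∧ X t 1 = 1

lemma exists_contDiff_cube_root {ρ : ℝ → ℝ} (hρ : ContDiff ℝ 2 ρ) (hpos : ∀ y, 0 < ρ y) :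
    ∃ g : ℝ → ℝ, ContDiff ℝ 2 g ∧ (∀ y, 0 < g y) ∧ ∀ y, g y ^ 3 = ρ y := by
  refine ⟨fun y => ρ y ^ (1 / 3 : ℝ), hρ.rpow_const_of_ne fun y => (hpos y).ne',
    fun y => Real.rpow_pos_of_pos (hpos y) _, fun y => ?_⟩
  rw [← Real.rpow_natCast, ← Real.rpow_mul (hpos y).le]
  norm_num

lemma contDiff_two_of_hasDerivAt {G g : ℝ → ℝ} (hg : ContDiff ℝ 2 g)
    (hG : ∀ y, HasDerivAt G (g y) y) : ContDiff ℝ 2 G := by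
  have hd : deriv G = g := funext fun y => (hG y).deriv
  rw [show (2 : WithTop ℕ∞) = 1 + 1 by norm_num, contDiff_succ_iff_deriv]
  refine ⟨fun y => (hG y).differentiableAt, by simp, ?_⟩
  rw [hd]
  exact hg.of_le (by norm_num)

lemma HasDerivAt.eq_zero_of_const_right {f : ℝ → ℝ} {d t v : ℝ} (hf : HasDerivAt f d t)
    (h : ∀ s, t ≤ s → f s = v) : d = 0 :=
  (uniqueDiffWithinAt_Ici t).eq_deriv _ hf.hasDerivWithinAt
    ((hasDerivWithinAt_const t _ v).congr (fun s hs => h s hs) (h t le_rfl))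

lemma deriv_mem_Icc_of_slope_mem {f : ℝ → ℝ} {m M : ℝ} (hf : Differentiable ℝ f)
    (h : ∀ a ∈ Icc (0 : ℝ) 1, ∀ b ∈ Icc (0 : ℝ) 1, a ≤ b →
      m * (b - a) ≤ f b - f a ∧ f b - f a ≤ M * (b - a)) {θ : ℝ} (hθ : θ ∈ Icc (0 : ℝ) 1) :
    deriv f θ ∈ Icc m M := by
  have hlim := (hf θ).hasDerivAt.tendsto_slope
  have hslope : ∀ c ∈ Icc (0 : ℝ) 1, c ≠ θ → slope f θ c ∈ Icc m M := by
    intro c hc hne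
    rcases lt_or_gt_of_ne hne with hlt | hlt
    · obtain ⟨h1, h2⟩ := h c hc θ hθ hlt.le
      rw [slope_comm, slope_def_field]
      exact ⟨(le_div_iff₀ (sub_pos.2 hlt)).2 h1, (div_le_iff₀ (sub_pos.2 hlt)).2 h2⟩
    · obtain ⟨h1, h2⟩ := h θ hθ c hc hlt.le
      rw [slope_def_field]
      exact ⟨(le_div_iff₀ (sub_pos.2 hlt)).2 h1, (div_le_iff₀ (sub_pos.2 hlt)).2 h2⟩
  rcases hθ.2.lt_or_eq with hlt | rfl
  · refine isClosed_Icc.mem_of_tendsto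
      (hlim.mono_left (nhdsWithin_mono θ fun c (hc : c ∈ Ioi θ) => ne_of_gt hc)) ?_
    filter_upwards [Ioo_mem_nhdsGT hlt] with c hc
    exact hslope c ⟨hθ.1.trans hc.1.le, hc.2.le⟩ (ne_of_gt hc.1)
  · refine isClosed_Icc.mem_of_tendsto
      (hlim.mono_left (nhdsWithin_mono 1 fun c (hc : c ∈ Iio 1) => ne_of_lt hc)) ?_
    filter_upwards [Ioo_mem_nhdsLT (zero_lt_one' ℝ)] with c hc
    exact hslope c ⟨hc.1.le, hc.2.le⟩ (ne_of_lt hc.2)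

lemma slope_mem_of_deriv_mem_Icc {f : ℝ → ℝ} {m M : ℝ} (hf : Differentiable ℝ f)
    (h : ∀ θ ∈ Icc (0 : ℝ) 1, deriv f θ ∈ Icc m M) :
    ∀ a ∈ Icc (0 : ℝ) 1, ∀ b ∈ Icc (0 : ℝ) 1, a ≤ b →
      m * (b - a) ≤ f b - f a ∧ f b - f a ≤ M * (b - a) := fun a ha b hb hab =>
  ⟨(convex_Icc (0 : ℝ) 1).mul_sub_le_image_sub_of_le_deriv hf.continuous.continuousOn
    hf.differentiableOn (fun θ hθ => (h θ (interior_subset hθ)).1) a ha b hb hab,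
   (convex_Icc (0 : ℝ) 1).image_sub_le_mul_sub_of_deriv_le hf.continuous.continuousOn
    hf.differentiableOn (fun θ hθ => (h θ (interior_subset hθ)).2) a ha b hb hab⟩

namespace IsEnergyFlow

variable {ρ : ℝ → ℝ} {X : ℝ → ℝ → ℝ}

lemma mem_Icc_of_deriv_nonneg (h : IsEnergyFlow ρ X) {t : ℝ} (ht : 0 ≤ t)
    (hd : ∀ θ ∈ Icc (0 : ℝ) 1, 0 ≤ deriv (X t) θ) {θ : ℝ} (hθ : θ ∈ Icc (0 : ℝ) 1) :
    X t θ ∈ Icc (0 : ℝ) 1 := by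
  have hmono : MonotoneOn (X t) (Icc 0 1) :=
    monotoneOn_of_deriv_nonneg (convex_Icc _ _) (h.contDiff t ht).continuous.continuousOn
      ((h.contDiff t ht).differentiable (by norm_num)).differentiableOn
      fun c hc => hd c (interior_subset hc)
  have h0 := hmono ⟨le_rfl, zero_le_one⟩ hθ hθ.1
  have h1 := hmono hθ ⟨zero_le_one, le_rfl⟩ hθ.2
  rw [(h.boundary t ht).1] at h0
  rw [(h.boundary t ht).2] at h1
  exact ⟨h0, h1⟩

/-- Composing with a primitive `G` of `ρ^(1/3)` removes the lower order term of the equation. -/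
lemma isGradientParabolic (h : IsEnergyFlow ρ X) {G g : ℝ → ℝ} (hg : ContDiff ℝ 2 g)
    (hgρ : ∀ y, g y ^ 3 = ρ y) (hG : ∀ y, HasDerivAt G (g y) y) :
    IsGradientParabolic (fun t θ => G (X t θ)) (Ici 0) := by
  have hρ' : ∀ y, deriv ρ y = 3 * g y ^ 2 * deriv g y := fun y => by
    rw [← funext hgρ]
    simpa using! (((hg.differentiable (by norm_num) y).hasDerivAt).pow 3).deriv
  refine ⟨fun t ht => (contDiff_two_of_hasDerivAt hg hG).comp (h.contDiff t ht),
    fun t ht θ hθ => ⟨(1 / 2) * g (X t θ) ^ 2, by positivity, ?_⟩, fun t ht => ?_, fun t ht => ?_⟩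
  · have hX := h.contDiff t ht
    have hXd : ∀ c, HasDerivAt (X t) (deriv (X t) c) c := fun c =>
      (hX.differentiable (by norm_num) c).hasDerivAt
    have hXdd : HasDerivAt (deriv (X t)) (deriv (deriv (X t)) θ) θ :=
      ((hX.differentiable_deriv_two) θ).hasDerivAt
    have h1 : deriv (fun c => G (X t c)) = fun c => g (X t c) * deriv (X t) c :=
      funext fun c => ((hG (X t c)).comp c (hXd c)).deriv
    have h2 : deriv (fun c => g (X t c) * deriv (X t) c) θ =
        deriv g (X t θ) * deriv (X t) θ * deriv (X t) θ
          + g (X t θ) * deriv (deriv (X t)) θ :=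
      ((((hg.differentiable (by norm_num) (X t θ)).hasDerivAt).comp θ (hXd θ)).mul hXdd).deriv
    have := (hG (X t θ)).comp t (h.hasDerivAt t ht θ hθ)
    refine this.congr_deriv ?_
    simp only [h1, h2, hρ', ← hgρ]
    ring
  · have hd := (hG (X t 0)).comp t (h.hasDerivAt t ht 0 ⟨le_rfl, zero_le_one⟩)
    have := hd.eq_zero_of_const_right (v := G 0)
      fun s hs => by simp [(h.boundary s (le_trans ht hs)).1]
    rwa [this] at hd
  · have hd := (hG (X t 1)).comp t (h.hasDerivAt t ht 1 ⟨zero_le_one, le_rfl⟩)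
    have := hd.eq_zero_of_const_right (v := G 1)
      fun s hs => by simp [(h.boundary s (le_trans ht hs)).2]
    rwa [this] at hd

/-- Two-sided bounds on the initial slopes persist, up to constants. -/
theorem deriv_mem_Icc (h : IsEnergyFlow ρ X) (hρ : ContDiff ℝ 2 ρ) (hpos : ∀ y, 0 < ρ y)
    (hbd : ∀ y ∈ Icc (0 : ℝ) 1, ρ y ∈ Icc (1 / 2) (3 / 2)) {c C : ℝ} (hc : 0 < c)
    (h0 : ∀ θ ∈ Icc (0 : ℝ) 1, deriv (X 0) θ ∈ Icc c C) {t : ℝ} (ht : 0 ≤ t) :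
    ∀ θ ∈ Icc (0 : ℝ) 1, deriv (X t) θ ∈ Icc (c / 4) (4 * C) := by
  obtain ⟨g, hg, hgpos, hgρ⟩ := exists_contDiff_cube_root hρ hpos
  let G : ℝ → ℝ := fun y => ∫ z in (0 : ℝ)..y, g z
  have hG : ∀ y, HasDerivAt G (g y) y := fun y =>
    intervalIntegral.integral_hasDerivAt_right (hg.continuous.intervalIntegrable _ _)
      (hg.continuous.stronglyMeasurableAtFilter _ _) hg.continuous.continuousAt
  have hgbd : ∀ y ∈ Icc (0 : ℝ) 1, g y ∈ Icc (1 / 2 : ℝ) 2 := fun y hy => by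
    have h1 := hbd y hy
    rw [← hgρ] at h1
    constructor
    · by_contra! hlt
      have := pow_lt_pow_left₀ hlt (hgpos y).le (n := 3) (by norm_num)
      norm_num at this
      linarith [h1.1]
    · by_contra! hlt
      have := pow_lt_pow_left₀ hlt (by norm_num) (n := 3) (by norm_num)
      linarith [h1.2]
  have hY := h.isGradientParabolic hg hgρ hG
  have hcont := hY.continuousOn_uncurry
  have hYd : ∀ s, 0 ≤ s → ∀ θ, deriv (fun θ => G (X s θ)) θ = g (X s θ) * deriv (X s) θ :=
    fun s hs θ => ((hG (X s θ)).comp θ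
      ((h.contDiff s hs).differentiable (by norm_num) θ).hasDerivAt).deriv
  have hYdiff : ∀ s, 0 ≤ s → Differentiable ℝ (fun θ => G (X s θ)) := fun s hs =>
    (hY.contDiff s hs).differentiable (by norm_num)
  have hC : 0 < C := hc.trans_le ((h0 0 ⟨le_rfl, zero_le_one⟩).1.trans
    (h0 0 ⟨le_rfl, zero_le_one⟩).2)
  have hslope0 := slope_mem_of_deriv_mem_Icc (m := c / 2) (M := 2 * C) (hYdiff 0 le_rfl)
    fun θ hθ => by
      have h1 := hgbd _ (h.mem_Icc_of_deriv_nonneg le_rfl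
        (fun θ hθ => hc.le.trans (h0 θ hθ).1) hθ)
      have h2 := h0 θ hθ
      rw [hYd 0 le_rfl]
      constructor
      · nlinarith [mul_le_mul h1.1 h2.1 hc.le (hgpos _).le]
      · nlinarith [mul_le_mul h1.2 h2.2 (hc.le.trans h2.1) (by norm_num : (0 : ℝ) ≤ 2)]
  have hcont' : ContinuousOn (Function.uncurry fun t θ => G (X t θ)) (Icc 0 t ×ˢ Icc 0 1) :=
    hcont.mono (prod_mono Icc_subset_Ici_self Subset.rfl)
  have hsub : Ioc 0 t ⊆ Ici (0 : ℝ) := fun r hr => hr.1.le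
  have hup := hY.slope_bound (σ := 1) (L := 2 * C) one_ne_zero ht hsub (by positivity) hcont'
    fun a ha b hb hab => (hslope0 a ha b hb (by linarith)).2
  have hlow := hY.slope_bound (σ := -1) (L := c / 2) (by norm_num) ht hsub (by positivity) hcont'
    fun a ha b hb hab => by linarith [(hslope0 b hb a ha (by linarith)).1]
  have hder : ∀ θ ∈ Icc (0 : ℝ) 1, g (X t θ) * deriv (X t) θ ∈ Icc (c / 2) (2 * C) := by
    intro θ hθ
    rw [← hYd t ht]
    exact deriv_mem_Icc_of_slope_mem (hYdiff t ht) (fun a ha b hb hab =>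
      ⟨by linarith [hlow b hb a ha (by linarith)], hup a ha b hb (by linarith)⟩) hθ
  have hXpos : ∀ θ ∈ Icc (0 : ℝ) 1, 0 < deriv (X t) θ := fun θ hθ =>
    pos_of_mul_pos_right (lt_of_lt_of_le (by positivity) (hder θ hθ).1) (hgpos _).le
  intro θ hθ
  have h1 := hgbd _ (h.mem_Icc_of_deriv_nonneg ht (fun θ hθ => (hXpos θ hθ).le) hθ)
  have h2 := hder θ hθ
  have h3 := hXpos θ hθ
  constructor
  · nlinarith [mul_le_mul_of_nonneg_right h1.2 h3.le, h2.1]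
  · nlinarith [mul_le_mul_of_nonneg_right h1.1 h3.le, h2.2]

/-- A solution with nonnegative slopes is Lipschitz in time from every given time on. -/
theorem exists_time_lipschitz (h : IsEnergyFlow ρ X) (hpos : ∀ y, 0 < ρ y) {R ε : ℝ}
    (hR : ∀ y ∈ Icc (0 : ℝ) 1, ρ y ≤ R) (hε : ∀ y ∈ Icc (0 : ℝ) 1, |deriv ρ y| ≤ ε)
    (hmono : ∀ t, 0 ≤ t → ∀ θ ∈ Icc (0 : ℝ) 1, 0 ≤ deriv (X t) θ) {s : ℝ} (hs : 0 ≤ s) :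
    ∃ K : ℝ, 0 ≤ K ∧ ∀ t, s ≤ t → ∀ θ ∈ Icc (0 : ℝ) 1, |X t θ - X s θ| ≤ K * (t - s) := by
  have hC := h.contDiff s hs
  have hcd : Continuous (deriv (X s)) := hC.continuous_deriv (by norm_num)
  have hcdd : Continuous (deriv (deriv (X s))) := by
    have : ContDiff ℝ 1 (deriv (X s)) := hC.deriv'
    exact this.continuous_deriv (by norm_num)
  have hI : ∀ t, 0 ≤ t → ∀ θ ∈ Icc (0 : ℝ) 1, X t θ ∈ Icc (0 : ℝ) 1 := fun t ht θ hθ =>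
    h.mem_Icc_of_deriv_nonneg ht (hmono t ht) hθ
  obtain ⟨K, hK⟩ := isCompact_Icc.exists_bound_of_continuousOn (s := Icc (0 : ℝ) 1)
    (f := fun θ => (1 / 2) * R * deriv (X s) θ * |deriv (deriv (X s)) θ|
      + (1 / 6) * ε * deriv (X s) θ ^ 3) (by fun_prop)
  have hK' : ∀ θ ∈ Icc (0 : ℝ) 1, (1 / 2) * R * deriv (X s) θ * |deriv (deriv (X s)) θ|
      + (1 / 6) * ε * deriv (X s) θ ^ 3 ≤ K := fun θ hθ => (le_abs_self _).trans (hK θ hθ)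
  have hK0 : 0 ≤ K := (norm_nonneg _).trans (hK 0 ⟨le_rfl, zero_le_one⟩)
  have hcont : ContinuousOn (Function.uncurry X) (Ici 0 ×ˢ Icc 0 1) := by
    rintro ⟨t, θ⟩ ⟨ht, hθ⟩
    refine continuousWithinAt_uncurry_of_slope_ge (L := 0) (fun r hr a ha b hb hab => ?_)
      (h.contDiff t ht).continuous.continuousOn
      (fun a ha => (h.hasDerivAt t ht a ha).continuousAt.continuousWithinAt) hθ
    have := (convex_Icc (0 : ℝ) 1).mul_sub_le_image_sub_of_le_deriv
      (h.contDiff r hr).continuous.continuousOn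
      ((h.contDiff r hr).differentiable (by norm_num)).differentiableOn
      (fun θ hθ => hmono r hr θ (interior_subset hθ)) a ha b hb hab
    linarith
  have hflux : ∀ τ, 0 ≤ τ → ∀ θ ∈ Icc (0 : ℝ) 1,
      (1 / 2) * ρ (X τ θ) * deriv (X s) θ * |deriv (deriv (X s)) θ|
        + (1 / 6) * |deriv ρ (X τ θ)| * deriv (X s) θ ^ 3 ≤ K := by
    intro τ hτ θ hθ
    refine le_trans ?_ (hK' θ hθ)
    have := hmono s hs θ hθ
    gcongr
    exacts [hR _ (hI τ hτ θ hθ), hε _ (hI τ hτ θ hθ)]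
  have hbd : ∀ σ : ℝ, σ = 1 ∨ σ = -1 → ∀ t, s ≤ t → ∀ θ ∈ Icc (0 : ℝ) 1,
      σ * (X t θ - X s θ) - K * (t - s) ≤ 0 := by
    intro σ hσ t hst
    refine le_of_deriv_nonpos_at_maximizers (M := 0)
      (f := fun t θ => σ * (X t θ - X s θ) - K * (t - s)) isCompact_Icc hst ?_ ?_ ?_
    · have h1 : ContinuousOn (fun p : ℝ × ℝ => X p.1 p.2) (Icc s t ×ˢ Icc 0 1) :=
        hcont.mono (prod_mono (fun r hr => hs.trans hr.1) Subset.rfl)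
      have h2 : Continuous (X s) := hC.continuous
      change ContinuousOn (fun p : ℝ × ℝ => σ * (X p.1 p.2 - X s p.2) - K * (p.1 - s)) _
      fun_prop
    · intro θ hθ
      simp
    · intro τ hτ θ hθ hmax hlt
      have hτ0 : 0 ≤ τ := hs.trans hτ.1.le
      have hKτ : 0 ≤ K * (τ - s) := mul_nonneg hK0 (by linarith [hτ.1])
      have hθ0 : 0 < θ := by
        refine lt_of_le_of_ne hθ.1 fun he => ?_
        rw [← he, (h.boundary τ hτ0).1, (h.boundary s hs).1] at hlt
        linarith
      have hθ1 : θ < 1 := by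
        refine lt_of_le_of_ne hθ.2 fun he => ?_
        rw [he, (h.boundary τ hτ0).2, (h.boundary s hs).2] at hlt
        linarith
      have hd : ∀ c, HasDerivAt (fun c => σ * (X τ c - X s c) - K * (τ - s))
          (σ * (deriv (X τ) c - deriv (X s) c)) c := fun c =>
        (((((h.contDiff τ hτ0).differentiable (by norm_num)) c).hasDerivAt.sub
          ((hC.differentiable (by norm_num)) c).hasDerivAt).const_mul σ).sub_const _
      have hloc : IsLocalMax (fun c => σ * (X τ c - X s c) - K * (τ - s)) θ := by
        filter_upwards [Icc_mem_nhds hθ0 hθ1] with c hc using hmax c hc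
      have hfst := hloc.hasDerivAt_eq_zero (hd θ)
      have hsnd := deriv_deriv_nonpos_of_isLocalMax
        (continuous_iff_continuousAt.2 fun c => (hd c).continuousAt) hloc
      have hdd : HasDerivAt (fun c => σ * (deriv (X τ) c - deriv (X s) c))
          (σ * (deriv (deriv (X τ)) θ - deriv (deriv (X s)) θ)) θ :=
        (((h.contDiff τ hτ0).differentiable_deriv_two θ).hasDerivAt.sub
          (hC.differentiable_deriv_two θ).hasDerivAt).const_mul σ
      rw [funext fun c => (hd c).deriv, hdd.deriv] at hsnd
      have hder : HasDerivAt (fun r => σ * (X r θ - X s θ) - K * (r - s)) _ τ :=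
        (((h.hasDerivAt τ hτ0 θ hθ).sub_const (X s θ)).const_mul σ).sub
          (((hasDerivAt_id τ).sub_const s).const_mul K)
      refine ⟨_, ?_, hder⟩
      have hσ0 : σ ≠ 0 := by rcases hσ with rfl | rfl <;> norm_num
      have hp : deriv (X τ) θ = deriv (X s) θ :=
        sub_eq_zero.1 ((mul_eq_zero.1 hfst).resolve_left hσ0)
      have hp0 := hmono s hs θ hθ
      have hσabs : ∀ z : ℝ, σ * z ≤ |z| := fun z => by
        rcases hσ with rfl | rfl
        · simpa using le_abs_self z
        · simpa using neg_le_abs z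
      have e1 : σ * deriv (deriv (X τ)) θ ≤ |deriv (deriv (X s)) θ| := by
        linarith [hσabs (deriv (deriv (X s)) θ)]
      have e2 := mul_le_mul_of_nonneg_left e1
        (show 0 ≤ (1 / 2) * ρ (X τ θ) * deriv (X s) θ from
          mul_nonneg (mul_nonneg (by norm_num) (hpos _).le) hp0)
      have e3 := mul_le_mul_of_nonneg_left (hσabs (deriv ρ (X τ θ)))
        (show 0 ≤ (1 / 6) * deriv (X s) θ ^ 3 by positivity)
      have e4 := hflux τ hτ0 θ hθ
      rw [hp]
      linarith
  refine ⟨K, hK0, fun t hst θ hθ => abs_le.2 ⟨?_, ?_⟩⟩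
  · linarith [hbd (-1) (Or.inr rfl) t hst θ hθ]
  · linarith [hbd 1 (Or.inl rfl) t hst θ hθ]

end IsEnergyFlow

lemma integral_sq_le_integral_deriv_sq {w w' : ℝ → ℝ} (hw : ∀ θ, HasDerivAt w (w' θ) θ)
    (hw' : Continuous w') (h0 : w 0 = 0) (h1 : w 1 = 0) :
    ∫ θ in (0 : ℝ)..1, w θ ^ 2 ≤ ∫ θ in (0 : ℝ)..1, w' θ ^ 2 := by
  have hwc : Continuous w := continuous_iff_continuousAt.2 fun θ => (hw θ).continuousAt
  have hd : ∀ θ, HasDerivAt (fun θ => (θ - 1 / 2) * w θ ^ 2)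
      (w θ ^ 2 + 2 * (θ - 1 / 2) * (w θ * w' θ)) θ := fun θ => by
    refine (((hasDerivAt_id θ).sub_const (1 / 2)).mul ((hw θ).pow 2)).congr_deriv ?_
    simp
    ring
  have hint := intervalIntegral.integral_eq_sub_of_hasDerivAt (a := 0) (b := 1)
    (fun θ _ => hd θ) (Continuous.intervalIntegrable (by fun_prop) _ _)
  have hle : ∫ θ in (0 : ℝ)..1, (w θ ^ 2 - (w' θ ^ 2)) ≤
      ∫ θ in (0 : ℝ)..1, 2 * (w θ ^ 2 + 2 * (θ - 1 / 2) * (w θ * w' θ)) := by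
    refine intervalIntegral.integral_mono_on zero_le_one
      (Continuous.intervalIntegrable (by fun_prop) _ _)
      (Continuous.intervalIntegrable (by fun_prop) _ _) fun θ hθ => ?_
    have h2 : (2 * θ - 1) ^ 2 ≤ 1 := by nlinarith [hθ.1, hθ.2]
    nlinarith [sq_nonneg ((2 * θ - 1) * w θ + w' θ),
      mul_le_mul_of_nonneg_right h2 (sq_nonneg (w θ))]
  rw [intervalIntegral.integral_const_mul, hint,
    intervalIntegral.integral_sub (Continuous.intervalIntegrable (by fun_prop) _ _)
      (Continuous.intervalIntegrable (by fun_prop) _ _)] at hle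
  simp only [h0, h1] at hle
  linarith

/-- Strong monotonicity of the energy density, up to errors of size `ε`. -/
lemma flux_difference_le {w p₁ p₂ ρ₁ ρ₂ q₁ q₂ c P ε : ℝ} (hc : 0 < c)
    (hp₁ : p₁ ∈ Icc c P) (hp₂ : p₂ ∈ Icc c P) (hρ₁ : 1 / 2 ≤ ρ₁)
    (hρ : |ρ₁ - ρ₂| ≤ ε * |w|) (hq₁ : |q₁| ≤ ε) (hq : |q₁ - q₂| ≤ ε * |w|) :
    -((p₁ - p₂) * ((1 / 4) * ρ₁ * p₁ ^ 2 - (1 / 4) * ρ₂ * p₂ ^ 2))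
        - (1 / 12) * (w * (q₁ * p₁ ^ 3 - q₂ * p₂ ^ 3)) ≤
      -(c / 4) * (p₁ - p₂) ^ 2
        + ε * (P ^ 2 / 4 * (w ^ 2 + (p₁ - p₂) ^ 2) + P ^ 3 / 12 * w ^ 2) := by
  obtain ⟨h1, h1'⟩ := hp₁
  obtain ⟨h2, h2'⟩ := hp₂
  set v := p₁ - p₂ with hv
  have hε : 0 ≤ ε := (abs_nonneg _).trans hq₁
  have hP : 0 ≤ P := by linarith
  have hw2 : |w| ^ 2 = w ^ 2 := sq_abs w
  have hv2 : |v| ^ 2 = v ^ 2 := sq_abs v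
  have hP2 : p₂ ^ 2 ≤ P ^ 2 := pow_le_pow_left₀ (by linarith) h2' 2
  have hP3 : p₂ ^ 3 ≤ P ^ 3 := pow_le_pow_left₀ (by linarith) h2' 3
  have hS : p₁ ^ 2 + p₁ * p₂ + p₂ ^ 2 ≤ 3 * P ^ 2 := by
    nlinarith [pow_le_pow_left₀ (by linarith) h1' 2,
      mul_le_mul h1' h2' (by linarith) hP]
  have amgm : |w| * |v| ≤ (w ^ 2 + v ^ 2) / 2 := by nlinarith [sq_nonneg (|w| - |v|)]
  have main : c * v ^ 2 ≤ ρ₁ * (p₁ + p₂) * v ^ 2 := by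
    refine mul_le_mul_of_nonneg_right ?_ (sq_nonneg v)
    nlinarith
  have err1 : -(v * ((ρ₁ - ρ₂) * p₂ ^ 2)) ≤ ε * P ^ 2 * (|w| * |v|) := by
    refine (neg_le_abs _).trans ?_
    rw [abs_mul, abs_mul, abs_of_nonneg (sq_nonneg p₂)]
    calc |v| * (|ρ₁ - ρ₂| * p₂ ^ 2) ≤ |v| * (ε * |w| * P ^ 2) := by gcongr
      _ = _ := by ring
  have err2 : -(w * (q₁ * (v * (p₁ ^ 2 + p₁ * p₂ + p₂ ^ 2)))) ≤
      3 * ε * P ^ 2 * (|w| * |v|) := by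
    have h0 : 0 ≤ p₁ ^ 2 + p₁ * p₂ + p₂ ^ 2 := by nlinarith
    refine (neg_le_abs _).trans ?_
    rw [abs_mul, abs_mul, abs_mul, abs_of_nonneg h0]
    calc |w| * (|q₁| * (|v| * (p₁ ^ 2 + p₁ * p₂ + p₂ ^ 2)))
        ≤ |w| * (ε * (|v| * (3 * P ^ 2))) := by gcongr
      _ = _ := by ring
  have err3 : -(w * ((q₁ - q₂) * p₂ ^ 3)) ≤ ε * P ^ 3 * w ^ 2 := by
    have h0 : 0 ≤ p₂ ^ 3 := pow_nonneg (by linarith) 3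
    refine (neg_le_abs _).trans ?_
    rw [abs_mul, abs_mul, abs_of_nonneg h0, ← hw2]
    calc |w| * (|q₁ - q₂| * p₂ ^ 3) ≤ |w| * (ε * |w| * P ^ 3) := by gcongr
      _ = _ := by ring
  have amgm' := mul_le_mul_of_nonneg_left amgm (show 0 ≤ ε * P ^ 2 by positivity)
  have expand : -(v * ((1 / 4) * ρ₁ * p₁ ^ 2 - (1 / 4) * ρ₂ * p₂ ^ 2))
        - (1 / 12) * (w * (q₁ * p₁ ^ 3 - q₂ * p₂ ^ 3)) =
      -(1 / 4) * (ρ₁ * (p₁ + p₂) * v ^ 2) + (1 / 4) * -(v * ((ρ₁ - ρ₂) * p₂ ^ 2))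
        + (1 / 12) * -(w * (q₁ * (v * (p₁ ^ 2 + p₁ * p₂ + p₂ ^ 2))))
        + (1 / 12) * -(w * ((q₁ - q₂) * p₂ ^ 3)) := by
    rw [hv]; ring
  rw [expand]
  linarith

/-- The right derivative of `t ↦ ∫ w(t,θ)²` may be computed under the integral sign when `w` is
Lipschitz in time to the right of `s`. -/
lemma hasDerivWithinAt_integral_sq {w : ℝ → ℝ → ℝ} {v : ℝ → ℝ} {s K B : ℝ}
    (hcont : ∀ t, s ≤ t → Continuous (w t))
    (hbd : ∀ t, s ≤ t → ∀ θ ∈ Icc (0 : ℝ) 1, |w t θ| ≤ B)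
    (hlip : ∀ t, s ≤ t → ∀ θ ∈ Icc (0 : ℝ) 1, |w t θ - w s θ| ≤ K * (t - s))
    (hder : ∀ θ ∈ Icc (0 : ℝ) 1, HasDerivAt (fun t => w t θ) (v θ) s) :
    HasDerivWithinAt (fun t => ∫ θ in (0 : ℝ)..1, w t θ ^ 2)
      (∫ θ in (0 : ℝ)..1, 2 * (w s θ * v θ)) (Ici s) s := by
  rw [hasDerivWithinAt_iff_tendsto_slope, Ici_sdiff_left]
  have hev : ∀ᶠ t in 𝓝[>] s, s < t := self_mem_nhdsWithin
  have hlim : Tendsto (fun t => ∫ θ in (0 : ℝ)..1, slope (fun t => w t θ ^ 2) s t) (𝓝[>] s)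
      (𝓝 (∫ θ in (0 : ℝ)..1, 2 * (w s θ * v θ))) := by
    refine intervalIntegral.tendsto_integral_filter_of_dominated_convergence
      (fun _ => K * (2 * B)) ?_ ?_ (by simp) ?_
    · filter_upwards [hev] with t ht
      have h1 := hcont t ht.le
      have h2 := hcont s le_rfl
      simp only [slope_def_field]
      exact Continuous.aestronglyMeasurable (by fun_prop)
    · filter_upwards [hev] with t ht
      refine Eventually.of_forall fun θ hθ => ?_
      rw [uIoc_of_le zero_le_one] at hθ
      have hθ' : θ ∈ Icc (0 : ℝ) 1 := ⟨hθ.1.le, hθ.2⟩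
      rw [slope_def_field, Real.norm_eq_abs, abs_div, abs_of_pos (sub_pos.2 ht),
        div_le_iff₀ (sub_pos.2 ht), sq_sub_sq, abs_mul]
      have h1 := hlip t ht.le θ hθ'
      have h2 : |w t θ + w s θ| ≤ 2 * B := by
        linarith [abs_add_le (w t θ) (w s θ), hbd t ht.le θ hθ', hbd s le_rfl θ hθ']
      have := mul_le_mul h2 h1 (abs_nonneg _) ((abs_nonneg _).trans h2)
      linarith
    · refine Eventually.of_forall fun θ hθ => ?_
      rw [uIoc_of_le zero_le_one] at hθ
      have hd := ((hder θ ⟨hθ.1.le, hθ.2⟩).pow 2)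
      have := hd.tendsto_slope.mono_left (nhdsWithin_mono s fun r (hr : r ∈ Ioi s) => ne_of_gt hr)
      convert! this using 2
      simp
      ring
  refine hlim.congr' ?_
  filter_upwards [hev] with t ht
  have h1 := hcont t ht.le
  have h2 := hcont s le_rfl
  simp only [slope_def_field, intervalIntegral.integral_div]
  rw [intervalIntegral.integral_sub (Continuous.intervalIntegrable (by fun_prop) _ _)
    (Continuous.intervalIntegrable (by fun_prop) _ _)]

lemma le_mul_exp_of_right_deriv_le {D D' : ℝ → ℝ} {k : ℝ} (hcont : ContinuousOn D (Ici 0))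
    (hD : ∀ s, 0 ≤ s → HasDerivWithinAt D (D' s) (Ici s) s)
    (hle : ∀ s, 0 ≤ s → D' s ≤ -k * D s) {t : ℝ} (ht : 0 ≤ t) :
    D t ≤ D 0 * Real.exp (-k * t) := by
  have hexp : ∀ s, HasDerivAt (fun s => Real.exp (k * s)) (Real.exp (k * s) * k) s := fun s => by
    simpa using! ((hasDerivAt_id s).const_mul k).exp
  have key := image_le_of_deriv_right_le_deriv_boundary (a := 0) (b := t)
    (f := fun s => D s * Real.exp (k * s))
    (f' := fun s => D' s * Real.exp (k * s) + D s * (Real.exp (k * s) * k))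
    (B := fun _ => D 0) (B' := fun _ => 0)
    ((hcont.mono Icc_subset_Ici_self).mul (by fun_prop))
    (fun s hs => (hD s hs.1).mul (hexp s).hasDerivWithinAt) (by simp)
    continuousOn_const (fun s _ => hasDerivWithinAt_const _ _ _)
    (fun s hs => by nlinarith [mul_le_mul_of_nonneg_right (hle s hs.1) (Real.exp_pos (k * s)).le])
    ⟨ht, le_rfl⟩
  rw [neg_mul, Real.exp_neg, ← div_eq_mul_inv, le_div_iff₀ (Real.exp_pos _)]
  exact key

namespace IsEnergyFlow

variable {ρ : ℝ → ℝ} {X₁ X₂ : ℝ → ℝ → ℝ}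

/-- Integration by parts and strong monotonicity of the gradient of the energy. -/
lemma integral_mul_velocity_le (h₁ : IsEnergyFlow ρ X₁) (h₂ : IsEnergyFlow ρ X₂)
    (hρ : ContDiff ℝ 2 ρ) (hbd : ∀ y ∈ Icc (0 : ℝ) 1, 1 / 2 ≤ ρ y) {ε c P : ℝ} (hc : 0 < c)
    (hε₁ : ∀ y ∈ Icc (0 : ℝ) 1, |deriv ρ y| ≤ ε)
    (hε₂ : ∀ y ∈ Icc (0 : ℝ) 1, |deriv (deriv ρ) y| ≤ ε) (hε : ε * (6 * P ^ 2 + P ^ 3) ≤ c)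
    {t : ℝ} (ht : 0 ≤ t) (hp₁ : ∀ θ ∈ Icc (0 : ℝ) 1, deriv (X₁ t) θ ∈ Icc c P)
    (hp₂ : ∀ θ ∈ Icc (0 : ℝ) 1, deriv (X₂ t) θ ∈ Icc c P) :
    ∫ θ in (0 : ℝ)..1, 2 * ((X₁ t θ - X₂ t θ) *
      (((1 / 2) * ρ (X₁ t θ) * deriv (X₁ t) θ * deriv (deriv (X₁ t)) θ
          + (1 / 6) * deriv ρ (X₁ t θ) * (deriv (X₁ t) θ) ^ 3)
        - ((1 / 2) * ρ (X₂ t θ) * deriv (X₂ t) θ * deriv (deriv (X₂ t)) θ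
          + (1 / 6) * deriv ρ (X₂ t θ) * (deriv (X₂ t) θ) ^ 3))) ≤
      -(c / 3) * ∫ θ in (0 : ℝ)..1, (X₁ t θ - X₂ t θ) ^ 2 := by
  have reg : ∀ {X}, IsEnergyFlow ρ X → (∀ θ, HasDerivAt (X t) (deriv (X t) θ) θ) ∧
      (∀ θ, HasDerivAt (deriv (X t)) (deriv (deriv (X t)) θ) θ) ∧ Continuous (X t) ∧
      Continuous (deriv (X t)) ∧ Continuous (deriv (deriv (X t))) := fun {X} h => by
    have hC := h.contDiff t ht
    have hC' : ContDiff ℝ 1 (deriv (X t)) := hC.deriv'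
    exact ⟨fun θ => (hC.differentiable (by norm_num) θ).hasDerivAt,
      fun θ => (hC'.differentiable (by norm_num) θ).hasDerivAt, hC.continuous, hC'.continuous,
      hC'.continuous_deriv (by norm_num)⟩
  obtain ⟨hd₁, hdd₁, hX₁, hX₁', hX₁''⟩ := reg h₁
  obtain ⟨hd₂, hdd₂, hX₂, hX₂', hX₂''⟩ := reg h₂
  have hρc : Continuous ρ := hρ.continuous
  have hρd : ∀ y, HasDerivAt ρ (deriv ρ y) y := fun y =>
    (hρ.differentiable (by norm_num) y).hasDerivAt
  have hρ' : ContDiff ℝ 1 (deriv ρ) := hρ.deriv'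
  have hρ'c : Continuous (deriv ρ) := hρ'.continuous
  have hI : ∀ {X}, IsEnergyFlow ρ X → (∀ θ ∈ Icc (0 : ℝ) 1, deriv (X t) θ ∈ Icc c P) →
      ∀ θ ∈ Icc (0 : ℝ) 1, X t θ ∈ Icc (0 : ℝ) 1 := fun h hp θ hθ =>
    h.mem_Icc_of_deriv_nonneg ht (fun θ hθ => hc.le.trans (hp θ hθ).1) hθ
  have hflux : ∀ {X : ℝ → ℝ → ℝ}, (∀ θ, HasDerivAt (X t) (deriv (X t) θ) θ) →
      (∀ θ, HasDerivAt (deriv (X t)) (deriv (deriv (X t)) θ) θ) → ∀ θ,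
      HasDerivAt (fun θ => (1 / 4) * ρ (X t θ) * deriv (X t) θ ^ 2)
        ((1 / 4) * (deriv ρ (X t θ) * deriv (X t) θ) * deriv (X t) θ ^ 2
          + (1 / 4) * ρ (X t θ) * (2 * deriv (X t) θ * deriv (deriv (X t)) θ)) θ :=
    fun {X} hd hdd θ => by
      refine ((((hρd (X t θ)).comp θ (hd θ)).const_mul (1 / 4)).mul ((hdd θ).pow 2)).congr_deriv ?_
      simp
  have hparts := intervalIntegral.integral_eq_sub_of_hasDerivAt (a := 0) (b := 1)
    (fun θ _ => ((hd₁ θ).sub (hd₂ θ)).mul ((hflux hd₁ hdd₁ θ).sub (hflux hd₂ hdd₂ θ)))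
    (Continuous.intervalIntegrable (by simp only [Pi.sub_apply]; fun_prop) _ _)
  simp only [Pi.mul_apply, Pi.sub_apply, h₁.boundary t ht, h₂.boundary t ht, sub_self,
    zero_mul] at hparts
  have hpoinc := integral_sq_le_integral_deriv_sq (w := fun θ => X₁ t θ - X₂ t θ)
    (w' := fun θ => deriv (X₁ t) θ - deriv (X₂ t) θ) (fun θ => (hd₁ θ).sub (hd₂ θ))
    (by fun_prop) (by simp [h₁.boundary t ht, h₂.boundary t ht])
    (by simp [h₁.boundary t ht, h₂.boundary t ht])
  have hε0 : 0 ≤ ε := (abs_nonneg _).trans (hε₁ 0 ⟨le_rfl, zero_le_one⟩)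
  have hP : 0 ≤ P := by
    have := hp₁ 0 ⟨le_rfl, zero_le_one⟩
    exact hc.le.trans (this.1.trans this.2)
  have hpt : ∀ θ ∈ Icc (0 : ℝ) 1,
      -((deriv (X₁ t) θ - deriv (X₂ t) θ) * ((1 / 4) * ρ (X₁ t θ) * deriv (X₁ t) θ ^ 2
          - (1 / 4) * ρ (X₂ t θ) * deriv (X₂ t) θ ^ 2))
        - (1 / 12) * ((X₁ t θ - X₂ t θ) * (deriv ρ (X₁ t θ) * deriv (X₁ t) θ ^ 3
          - deriv ρ (X₂ t θ) * deriv (X₂ t) θ ^ 3)) ≤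
      (-(c / 4) + ε * (P ^ 2 / 4)) * (deriv (X₁ t) θ - deriv (X₂ t) θ) ^ 2
        + ε * (P ^ 2 / 4 + P ^ 3 / 12) * (X₁ t θ - X₂ t θ) ^ 2 := by
    intro θ hθ
    have i₁ := hI h₁ hp₁ θ hθ
    have i₂ := hI h₂ hp₂ θ hθ
    have e1 := (convex_Icc (0 : ℝ) 1).norm_image_sub_le_of_norm_deriv_le
      (fun x _ => hρ.differentiable (by norm_num) x) hε₁ i₂ i₁
    have e2 := (convex_Icc (0 : ℝ) 1).norm_image_sub_le_of_norm_deriv_le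
      (fun x _ => hρ'.differentiable (by norm_num) x) hε₂ i₂ i₁
    refine (flux_difference_le hc (hp₁ θ hθ) (hp₂ θ hθ) (hbd _ i₁) e1 (hε₁ _ i₁) e2).trans
      (le_of_eq ?_)
    ring
  have hmono := intervalIntegral.integral_mono_on (μ := volume) zero_le_one
    (Continuous.intervalIntegrable (by fun_prop) 0 1)
    (Continuous.intervalIntegrable (by fun_prop) 0 1) hpt
  rw [intervalIntegral.integral_add (Continuous.intervalIntegrable (by fun_prop) _ _)
      (Continuous.intervalIntegrable (by fun_prop) _ _),
    intervalIntegral.integral_const_mul, intervalIntegral.integral_const_mul] at hmono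
  have hsplit : ∫ θ in (0 : ℝ)..1, 2 * ((X₁ t θ - X₂ t θ) *
      (((1 / 2) * ρ (X₁ t θ) * deriv (X₁ t) θ * deriv (deriv (X₁ t)) θ
          + (1 / 6) * deriv ρ (X₁ t θ) * (deriv (X₁ t) θ) ^ 3)
        - ((1 / 2) * ρ (X₂ t θ) * deriv (X₂ t) θ * deriv (deriv (X₂ t)) θ
          + (1 / 6) * deriv ρ (X₂ t θ) * (deriv (X₂ t) θ) ^ 3))) =
      2 * ∫ θ in (0 : ℝ)..1,
      (-((deriv (X₁ t) θ - deriv (X₂ t) θ) * ((1 / 4) * ρ (X₁ t θ) * deriv (X₁ t) θ ^ 2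
          - (1 / 4) * ρ (X₂ t θ) * deriv (X₂ t) θ ^ 2))
        - (1 / 12) * ((X₁ t θ - X₂ t θ) * (deriv ρ (X₁ t θ) * deriv (X₁ t) θ ^ 3
          - deriv ρ (X₂ t θ) * deriv (X₂ t) θ ^ 3))) := by
    refine sub_eq_zero.1 ((Eq.trans ?_ (congrArg (fun r : ℝ => 2 * r) hparts)).trans (mul_zero 2))
    rw [← intervalIntegral.integral_const_mul, ← intervalIntegral.integral_const_mul,
      ← intervalIntegral.integral_sub]
    · refine intervalIntegral.integral_congr fun θ _ => ?_
      ring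
    · exact Continuous.intervalIntegrable (by fun_prop) _ _
    · exact Continuous.intervalIntegrable (by fun_prop) _ _
  rw [hsplit]
  set W := ∫ θ in (0 : ℝ)..1, (deriv (X₁ t) θ - deriv (X₂ t) θ) ^ 2
  set D := ∫ θ in (0 : ℝ)..1, (X₁ t θ - X₂ t θ) ^ 2
  have hD : 0 ≤ D := intervalIntegral.integral_nonneg zero_le_one fun θ _ => sq_nonneg _
  have hW : 0 ≤ W := hD.trans hpoinc
  have k1 := mul_le_mul_of_nonneg_left hpoinc
    (show 0 ≤ ε * (P ^ 2 / 4 + P ^ 3 / 12) by positivity)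
  have k2 := mul_le_mul_of_nonneg_right hε hW
  have k3 := mul_le_mul_of_nonneg_left hpoinc hc.le
  linarith

/-- Exponential `L²` contraction for two solutions with uniformly bounded slopes. -/
theorem integral_sq_sub_le (h₁ : IsEnergyFlow ρ X₁) (h₂ : IsEnergyFlow ρ X₂)
    (hρ : ContDiff ℝ 2 ρ) (hpos : ∀ y, 0 < ρ y)
    (hbd : ∀ y ∈ Icc (0 : ℝ) 1, ρ y ∈ Icc (1 / 2) (3 / 2)) {ε c P : ℝ} (hc : 0 < c)
    (hε₁ : ∀ y ∈ Icc (0 : ℝ) 1, |deriv ρ y| ≤ ε)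
    (hε₂ : ∀ y ∈ Icc (0 : ℝ) 1, |deriv (deriv ρ) y| ≤ ε) (hε : ε * (6 * P ^ 2 + P ^ 3) ≤ c)
    (hp₁ : ∀ t, 0 ≤ t → ∀ θ ∈ Icc (0 : ℝ) 1, deriv (X₁ t) θ ∈ Icc c P)
    (hp₂ : ∀ t, 0 ≤ t → ∀ θ ∈ Icc (0 : ℝ) 1, deriv (X₂ t) θ ∈ Icc c P) {t : ℝ} (ht : 0 ≤ t) :
    ∫ θ in (0 : ℝ)..1, (X₁ t θ - X₂ t θ) ^ 2 ≤
      (∫ θ in (0 : ℝ)..1, (X₁ 0 θ - X₂ 0 θ) ^ 2) * Real.exp (-(c / 3) * t) := by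
  have hwc : ∀ s, 0 ≤ s → Continuous fun θ => X₁ s θ - X₂ s θ := fun s hs =>
    (h₁.contDiff s hs).continuous.sub (h₂.contDiff s hs).continuous
  have hwb : ∀ s, 0 ≤ s → ∀ θ ∈ Icc (0 : ℝ) 1, |X₁ s θ - X₂ s θ| ≤ 1 := by
    intro s hs θ hθ
    have i₁ := h₁.mem_Icc_of_deriv_nonneg hs (fun θ hθ => hc.le.trans (hp₁ s hs θ hθ).1) hθ
    have i₂ := h₂.mem_Icc_of_deriv_nonneg hs (fun θ hθ => hc.le.trans (hp₂ s hs θ hθ).1) hθ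
    rw [abs_le]
    constructor <;> linarith [i₁.1, i₁.2, i₂.1, i₂.2]
  refine le_mul_exp_of_right_deriv_le (D := fun s => ∫ θ in (0 : ℝ)..1, (X₁ s θ - X₂ s θ) ^ 2)
    (fun s hs => ?_) (fun s hs => ?_)
    (fun s hs => h₁.integral_mul_velocity_le h₂ hρ (fun y hy => (hbd y hy).1) hc hε₁ hε₂ hε hs
      (hp₁ s hs) (hp₂ s hs)) ht
  · refine intervalIntegral.continuousWithinAt_of_dominated_interval (bound := fun _ => 1) ?_ ?_
      (by simp) ?_
    · filter_upwards [self_mem_nhdsWithin] with r hr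
      exact ((hwc r hr).pow 2).aestronglyMeasurable
    · filter_upwards [self_mem_nhdsWithin] with r hr
      refine Eventually.of_forall fun θ hθ => ?_
      rw [uIoc_of_le zero_le_one] at hθ
      rw [Real.norm_eq_abs, abs_pow]
      exact pow_le_one₀ (abs_nonneg _) (hwb r hr θ ⟨hθ.1.le, hθ.2⟩)
    · refine Eventually.of_forall fun θ hθ => ?_
      rw [uIoc_of_le zero_le_one] at hθ
      have hθ' : θ ∈ Icc (0 : ℝ) 1 := ⟨hθ.1.le, hθ.2⟩
      exact (((h₁.hasDerivAt s hs θ hθ').continuousAt.sub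
        (h₂.hasDerivAt s hs θ hθ').continuousAt).pow 2).continuousWithinAt
  · obtain ⟨K₁, -, hK₁⟩ := h₁.exists_time_lipschitz hpos (fun y hy => (hbd y hy).2) hε₁
      (fun s hs θ hθ => hc.le.trans (hp₁ s hs θ hθ).1) hs
    obtain ⟨K₂, -, hK₂⟩ := h₂.exists_time_lipschitz hpos (fun y hy => (hbd y hy).2) hε₁
      (fun s hs θ hθ => hc.le.trans (hp₂ s hs θ hθ).1) hs
    refine hasDerivWithinAt_integral_sq (w := fun t θ => X₁ t θ - X₂ t θ) (K := K₁ + K₂) (B := 1)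
      (fun r hr => hwc r (le_trans hs hr)) (fun r hr => hwb r (le_trans hs hr))
      (fun r hr θ hθ => ?_)
      (fun θ hθ => (h₁.hasDerivAt s hs θ hθ).sub (h₂.hasDerivAt s hs θ hθ))
    have e1 := abs_le.1 (hK₁ r hr θ hθ)
    have e2 := abs_le.1 (hK₂ r hr θ hθ)
    rw [abs_le]
    constructor <;> linarith [e1.1, e1.2, e2.1, e2.2]

end IsEnergyFlow

lemma density_mem_Icc {ρ : ℝ → ℝ} {ε : ℝ} (hρ : Differentiable ℝ ρ)
    (hint : (∫ y in (0 : ℝ)..1, ρ y) = 1) (hε : ∀ y ∈ Icc (0 : ℝ) 1, |deriv ρ y| ≤ ε) :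
    ∀ y ∈ Icc (0 : ℝ) 1, ρ y ∈ Icc (1 - ε) (1 + ε) := by
  intro y hy
  have hε0 : 0 ≤ ε := (abs_nonneg _).trans (hε y hy)
  have hosc : ∀ z ∈ Icc (0 : ℝ) 1, |ρ z - ρ y| ≤ ε := by
    intro z hz
    refine ((convex_Icc (0 : ℝ) 1).norm_image_sub_le_of_norm_deriv_le (fun x _ => hρ x) hε
      hy hz).trans (mul_le_of_le_one_right hε0 ?_)
    rw [Real.norm_eq_abs, abs_le]
    constructor <;> linarith [hy.1, hy.2, hz.1, hz.2]
  have hi : IntervalIntegrable ρ volume 0 1 := hρ.continuous.intervalIntegrable _ _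
  have h1 := intervalIntegral.integral_mono_on zero_le_one hi
    (intervalIntegrable_const (c := ρ y + ε)) fun z hz => by linarith [(abs_le.1 (hosc z hz)).2]
  have h2 := intervalIntegral.integral_mono_on zero_le_one
    (intervalIntegrable_const (c := ρ y - ε)) hi fun z hz => by linarith [(abs_le.1 (hosc z hz)).1]
  simp only [intervalIntegral.integral_const, sub_zero, one_smul, hint] at h1 h2
  constructor <;> linarith

theorem L2_contraction_general_rho (c0 : ℝ) (hc0 : 0 < c0) :
    -- `c̄` depends only on `c0`
    ∃ cbar : ℝ, 0 < cbar ∧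
      ∀ C0 : ℝ, 0 < C0 →
        -- `ε₀` depends only on `c0, C0`
        ∃ ε0 : ℝ, 0 < ε0 ∧
          ∀ (ρ : ℝ → ℝ) (X₁ X₂ : ℝ → ℝ → ℝ),
            -- `ρ` is a periodic probability density of class `C²`
            ContDiff ℝ 2 ρ → Function.Periodic ρ 1 → (∀ y, 0 < ρ y) →
            (∫ y in (0 : ℝ)..1, ρ y) = 1 →
            -- smallness: `‖ρ'‖_∞ + ‖ρ''‖_∞ ≤ ε₀`
            (∀ y ∈ Set.Icc (0 : ℝ) 1, ∀ y' ∈ Set.Icc (0 : ℝ) 1,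
              |deriv ρ y| + |deriv (deriv ρ) y'| ≤ ε0) →
            -- `X₁, X₂` are smooth solutions of the gradient-flow PDE
            (∀ t, 0 ≤ t → ContDiff ℝ 2 (X₁ t)) →
            (∀ t, 0 ≤ t → ContDiff ℝ 2 (X₂ t)) →
            (∀ t, 0 ≤ t → ∀ θ ∈ Set.Icc (0 : ℝ) 1,
              HasDerivAt (fun s => X₁ s θ)
                ((1 / 2) * ρ (X₁ t θ) * deriv (X₁ t) θ * deriv (deriv (X₁ t)) θ
                  + (1 / 6) * deriv ρ (X₁ t θ) * (deriv (X₁ t) θ) ^ 3) t) →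
            (∀ t, 0 ≤ t → ∀ θ ∈ Set.Icc (0 : ℝ) 1,
              HasDerivAt (fun s => X₂ s θ)
                ((1 / 2) * ρ (X₂ t θ) * deriv (X₂ t) θ * deriv (deriv (X₂ t)) θ
                  + (1 / 6) * deriv ρ (X₂ t θ) * (deriv (X₂ t) θ) ^ 3) t) →
            -- boundary conditions
            (∀ t, 0 ≤ t → X₁ t 0 = 0 ∧ X₁ t 1 = 1) →
            (∀ t, 0 ≤ t → X₂ t 0 = 0 ∧ X₂ t 1 = 1) →
            -- initial monotonicity bounds
            (∀ θ ∈ Set.Icc (0 : ℝ) 1, c0 ≤ deriv (X₁ 0) θ ∧ deriv (X₁ 0) θ ≤ C0) →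
            (∀ θ ∈ Set.Icc (0 : ℝ) 1, c0 ≤ deriv (X₂ 0) θ ∧ deriv (X₂ 0) θ ≤ C0) →
            -- conclusion: exponential L² contraction
            ∀ t, 0 ≤ t →
              ∫ θ in (0 : ℝ)..1, (X₁ t θ - X₂ t θ) ^ 2 ≤
                (∫ θ in (0 : ℝ)..1, (X₁ 0 θ - X₂ 0 θ) ^ 2) * Real.exp (-cbar * t) := by
  refine ⟨c0 / 4 / 3, by positivity, fun C0 hC0 => ?_⟩
  have hden : 0 < 6 * (4 * C0) ^ 2 + (4 * C0) ^ 3 := by positivity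
  refine ⟨min (1 / 2) (c0 / 4 / (6 * (4 * C0) ^ 2 + (4 * C0) ^ 3)), by positivity, ?_⟩
  intro ρ X₁ X₂ hρ _ hpos hint hsmall hC₁ hC₂ hd₁ hd₂ hb₁ hb₂ hi₁ hi₂ t ht
  set ε := min (1 / 2) (c0 / 4 / (6 * (4 * C0) ^ 2 + (4 * C0) ^ 3))
  have hε : ε * (6 * (4 * C0) ^ 2 + (4 * C0) ^ 3) ≤ c0 / 4 :=
    (le_div_iff₀ hden).1 (min_le_right _ _)
  have hhalf : ε ≤ 1 / 2 := min_le_left _ _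
  have hε₁ : ∀ y ∈ Icc (0 : ℝ) 1, |deriv ρ y| ≤ ε := fun y hy =>
    (le_add_of_nonneg_right (abs_nonneg _)).trans (hsmall y hy y hy)
  have hε₂ : ∀ y ∈ Icc (0 : ℝ) 1, |deriv (deriv ρ) y| ≤ ε := fun y hy =>
    (le_add_of_nonneg_left (abs_nonneg _)).trans (hsmall y hy y hy)
  have hbd : ∀ y ∈ Icc (0 : ℝ) 1, ρ y ∈ Icc (1 / 2) (3 / 2) := fun y hy => by
    have := density_mem_Icc (hρ.differentiable (by norm_num)) hint hε₁ y hy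
    constructor <;> linarith [this.1, this.2]
  have h₁ : IsEnergyFlow ρ X₁ := ⟨hC₁, hd₁, hb₁⟩
  have h₂ : IsEnergyFlow ρ X₂ := ⟨hC₂, hd₂, hb₂⟩
  exact h₁.integral_sq_sub_le h₂ hρ hpos hbd (by positivity) hε₁ hε₂ hε
    (fun s hs => h₁.deriv_mem_Icc hρ hpos hbd hc0 hi₁ hs)
    (fun s hs => h₂.deriv_mem_Icc hρ hpos hbd hc0 hi₂ hs) ht
end

section
/- Let ρ ∈ C^1([0,1]) with 0 < λ ≤ ρ ≤ 1/λ, and let X:[0,1]→[0,1] be a C^2 nondecreasing map with X(0)=0 and X(1)=1. For i = 1,…,N set x^i := X((i−1/2)/N), and define F_{N,2}(x^1,…,x^N) := ∫_0^1 min_{1≤i≤N}|x^i−y|^2 ρ(y)dy. Then there is a constant C, depending only on ‖ρ‖_{C^1} and ‖X‖_{C^2}, such that | N^2 F_{N,2}(x^1,…,x^N) − (1/12)∫_0^1 ρ(X(θ)) (∂_θX(θ))^3 dθ | ≤ C/N for all N ≥ 1. In particular N^2 F_{N,2}(x^1,…,x^N) → (1/12)∫_0^1 ρ(X(θ))(∂_θX(θ))^3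 dθ as N → ∞. -/
open MeasureTheory

lemma abs_sub_le_of_abs_deriv_le {f : ℝ → ℝ} {S : Set ℝ} {K : ℝ} (hS : Convex ℝ S)
    (hf : Differentiable ℝ f) (hb : ∀ x ∈ S, |deriv f x| ≤ K) {s t : ℝ}
    (hs : s ∈ S) (ht : t ∈ S) : |f s - f t| ≤ K * |s - t| :=
  hS.norm_image_sub_le_of_norm_deriv_le (fun x _ => hf x) hb ht hs

/-- First-order expansion around `c`, uniformly for increments between points close to `c`. -/
lemma abs_sub_sub_deriv_mul_le {X : ℝ → ℝ} {K h c s t : ℝ} (hX : ContDiff ℝ 2 X) (hK : 0 ≤ K)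
    (hb : ∀ θ ∈ Set.Icc (0 : ℝ) 1, |deriv (deriv X) θ| ≤ K)
    (hc : c ∈ Set.Icc (0 : ℝ) 1) (hs : s ∈ Set.Icc (0 : ℝ) 1) (ht : t ∈ Set.Icc (0 : ℝ) 1)
    (hsc : |s - c| ≤ h) (htc : |t - c| ≤ h) :
    |X s - X t - deriv X c * (s - t)| ≤ K * h * |s - t| := by
  have hX1 : Differentiable ℝ X := hX.differentiable (by norm_num)
  have hX2 : Differentiable ℝ (deriv X) :=
    ((contDiff_succ_iff_deriv (n := 1)).1 hX).2.2.differentiable (by norm_num)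
  have hder : ∀ x, HasDerivAt (fun x => X x - deriv X c * x) (deriv X x - deriv X c) x := by
    intro x
    have h1 := (hX1 x).hasDerivAt.sub ((hasDerivAt_id x).const_mul (deriv X c))
    rwa [mul_one] at h1
  have key := abs_sub_le_of_abs_deriv_le (f := fun x => X x - deriv X c * x)
    (S := Set.Icc 0 1 ∩ Set.Icc (c - h) (c + h)) (K := K * h) (s := s) (t := t)
    ((convex_Icc _ _).inter (convex_Icc _ _)) (fun x => (hder x).differentiableAt)
    (fun x hx => by
      rw [(hder x).deriv]
      refine (abs_sub_le_of_abs_deriv_le (convex_Icc 0 1) hX2 hb hx.1 hc).trans ?_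
      refine mul_le_mul_of_nonneg_left ?_ hK
      rw [abs_le]
      constructor <;> linarith [hx.2.1, hx.2.2])
    ⟨hs, by rw [abs_le] at hsc; constructor <;> linarith⟩
    ⟨ht, by rw [abs_le] at htc; constructor <;> linarith⟩
  refine le_of_eq_of_le ?_ key
  congr 1
  ring

/-- If `c i` is a node closest to `θ`, then the squared distance from `X θ` to the image of the
nodes is given by the linearization of `X` at `c i`, up to a cubic error. -/
lemma abs_iInf_sq_sub_le {ι : Type*} [Finite ι] [Nonempty ι] {X : ℝ → ℝ} {K h θ : ℝ}
    {c : ι → ℝ} {i : ι} (hX : ContDiff ℝ 2 X) (hK : 0 ≤ K) (hh1 : h ≤ 1)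
    (hmono : MonotoneOn X (Set.Icc (0 : ℝ) 1))
    (hb1 : ∀ θ ∈ Set.Icc (0 : ℝ) 1, |deriv X θ| ≤ K)
    (hb : ∀ θ ∈ Set.Icc (0 : ℝ) 1, |deriv (deriv X) θ| ≤ K)
    (hc : ∀ j, c j ∈ Set.Icc (0 : ℝ) 1) (hθ : θ ∈ Set.Icc (0 : ℝ) 1)
    (hpos : 0 ≤ deriv X (c i)) (hi : |θ - c i| ≤ h / 2)
    (hj : ∀ j, |θ - c i| ≤ |θ - c j|) :
    |(⨅ j, (X (c j) - X θ) ^ 2) - deriv X (c i) ^ 2 * (θ - c i) ^ 2| ≤ K ^ 2 * h ^ 3 := by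
  set d := |θ - c i| with hd
  have hd0 : 0 ≤ d := abs_nonneg _
  have hh0 : 0 ≤ h := by linarith
  set p := deriv X (c i) with hp
  have hpK : p ≤ K := (le_abs_self _).trans (hb1 _ (hc i))
  have hdsq : (θ - c i) ^ 2 = d ^ 2 := (sq_abs _).symm
  set e := K * h * d with he
  have hKh : 0 ≤ K * h := mul_nonneg hK hh0
  have he0 : 0 ≤ e := mul_nonneg hKh hd0
  have heb : e ≤ K * h ^ 2 / 2 := by
    have := mul_le_mul_of_nonneg_left hi hKh
    linarith [this]
  have hpd0 : 0 ≤ p * d := mul_nonneg hpos hd0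
  have hpd : p * d ≤ K * h / 2 := by
    have := mul_le_mul hpK hi hd0 hK
    linarith
  have hprod : p * d * e ≤ (K * h / 2) * (K * h ^ 2 / 2) :=
    mul_le_mul hpd heb he0 (by positivity)
  have hK2h3 : 0 ≤ K ^ 2 * h ^ 3 := by positivity
  have hbdd : BddBelow (Set.range fun j => (X (c j) - X θ) ^ 2) := (Set.finite_range _).bddBelow
  rw [hdsq, abs_le]
  constructor
  · have hlow : ∀ j, p * d - e ≤ |X (c j) - X θ| := by
      intro j
      have hci := hc i
      have hcj := hc j
      have hdj := hj j
      rcases le_total θ (c j) with hle | hle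
      · rw [abs_of_nonpos (by linarith : θ - c j ≤ 0)] at hdj
        have hs : θ + d ∈ Set.Icc (0 : ℝ) 1 := ⟨by linarith [hθ.1], by linarith [hcj.2]⟩
        have h1 := abs_sub_sub_deriv_mul_le (h := h) hX hK hb hci hs hθ
          (by
            have : |θ + d - c i| ≤ |θ - c i| + |d| := by
              rw [show θ + d - c i = (θ - c i) + d by ring]; exact abs_add_le _ _
            rw [abs_of_nonneg hd0] at this
            linarith)
          (by linarith)
        rw [show θ + d - θ = d by ring, abs_of_nonneg hd0, abs_le] at h1
        have h2 := hmono hs hcj (by linarith)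
        have h3 := le_abs_self (X (c j) - X θ)
        linarith [h1.1]
      · rw [abs_of_nonneg (by linarith : 0 ≤ θ - c j)] at hdj
        have hs : θ - d ∈ Set.Icc (0 : ℝ) 1 := ⟨by linarith [hcj.1], by linarith [hθ.2]⟩
        have h1 := abs_sub_sub_deriv_mul_le (h := h) hX hK hb hci hs hθ
          (by
            have : |θ - d - c i| ≤ |θ - c i| + |d| := by
              rw [show θ - d - c i = (θ - c i) - d by ring]; exact abs_sub _ _
            rw [abs_of_nonneg hd0] at this
            linarith)
          (by linarith)
        rw [show θ - d - θ = -d by ring, abs_neg, abs_of_nonneg hd0, abs_le] at h1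
        have h2 := hmono hcj hs (by linarith)
        have h3 := neg_le_abs (X (c j) - X θ)
        linarith [h1.2]
    have hinf : p ^ 2 * d ^ 2 - K ^ 2 * h ^ 3 ≤ ⨅ j, (X (c j) - X θ) ^ 2 := by
      refine le_ciInf fun j => ?_
      have hl := hlow j
      rw [← sq_abs (X (c j) - X θ)]
      set a := |X (c j) - X θ|
      have ha : 0 ≤ a := abs_nonneg _
      rcases le_total e (p * d) with hle | hle
      · have := mul_self_le_mul_self (by linarith : 0 ≤ p * d - e) hl
        nlinarith [sq_nonneg e]
      · nlinarith [mul_le_mul_of_nonneg_left hle hpd0, sq_nonneg a]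
    linarith
  · have h1 := abs_sub_sub_deriv_mul_le (h := h) hX hK hb (hc i) (hc i) hθ
      (by simpa using hh0) (by linarith)
    rw [abs_sub_comm (c i) θ, ← hd, ← hp, ← he] at h1
    have habs : |X (c i) - X θ| ≤ p * d + e := by
      have h2 : |p * (c i - θ)| = p * d := by
        rw [abs_mul, abs_of_nonneg hpos, abs_sub_comm]
      have h3 := abs_add_le (X (c i) - X θ - p * (c i - θ)) (p * (c i - θ))
      rw [sub_add_cancel, h2] at h3
      linarith
    have h4 := ciInf_le hbdd i
    rw [← sq_abs] at h4
    have h5 := mul_self_le_mul_self (abs_nonneg _) habs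
    have h6 : e * e ≤ (K * h ^ 2 / 2) * (K * h ^ 2 / 2) :=
      mul_le_mul heb heb he0 (by positivity)
    have h7 : K ^ 2 * h ^ 3 * h ≤ K ^ 2 * h ^ 3 := mul_le_of_le_one_right hK2h3 hh1
    nlinarith

/-- Pointwise comparison of the two integrands with a multiple of `t ^ 2 - h ^ 2 / 12`, which has
mean zero over a cell of length `h`. Here `G`, `r`, `p` stand for the squared distance, the density
and the derivative at a point of the cell, and `r₀`, `p₀` for their values at its centre. -/
lemma abs_integrand_sub_le {G r r₀ p p₀ t h R K : ℝ} (hh : 0 ≤ h) (hR : 0 ≤ R) (hK : 0 ≤ K)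
    (ht : |t| ≤ h / 2) (hG : |G - p₀ ^ 2 * t ^ 2| ≤ K ^ 2 * h ^ 3)
    (hr : |r| ≤ R) (hr₀ : |r₀| ≤ R) (hp : |p| ≤ K) (hp₀ : |p₀| ≤ K)
    (hrr : |r - r₀| ≤ R * K * h) (hpp : |p - p₀| ≤ K * h) :
    |G * r * p - h ^ 2 / 12 * (r * p ^ 3) - r₀ * p₀ ^ 3 * (t ^ 2 - h ^ 2 / 12)|
      ≤ (5 * R * K ^ 3 + 2 * R * K ^ 4) * h ^ 3 := by
  have ht2 : t ^ 2 ≤ h ^ 2 := by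
    rw [← sq_abs t]; nlinarith [abs_nonneg t]
  have hrp : |r * p - r₀ * p₀| ≤ (R * K ^ 2 + R * K) * h := by
    rw [show r * p - r₀ * p₀ = (r - r₀) * p + r₀ * (p - p₀) by ring]
    refine (abs_add_le _ _).trans ?_
    rw [abs_mul, abs_mul]
    have h1 := mul_le_mul hrr hp (abs_nonneg _) (by positivity)
    have h2 := mul_le_mul hr₀ hpp (abs_nonneg _) hR
    linarith
  have hp2 : |p ^ 2 - p₀ ^ 2| ≤ 2 * K ^ 2 * h := by
    rw [show p ^ 2 - p₀ ^ 2 = (p - p₀) * (p + p₀) by ring, abs_mul]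
    have h1 := mul_le_mul hpp ((abs_add_le p p₀).trans (add_le_add hp hp₀)) (abs_nonneg _)
      (by positivity)
    linarith
  have hp2K : p ^ 2 ≤ K ^ 2 := by rw [← sq_abs p]; gcongr
  have hp₀2K : p₀ ^ 2 ≤ K ^ 2 := by rw [← sq_abs p₀]; gcongr
  have hrpb : |r * p| ≤ R * K := by
    rw [abs_mul]; exact mul_le_mul hr hp (abs_nonneg _) hR
  have hrp₀b : |r₀ * p₀| ≤ R * K := by
    rw [abs_mul]; exact mul_le_mul hr₀ hp₀ (abs_nonneg _) hR
  have hψ : |r * p ^ 3 - r₀ * p₀ ^ 3| ≤ (3 * R * K ^ 3 + R * K ^ 4) * h := by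
    rw [show r * p ^ 3 - r₀ * p₀ ^ 3
      = (r * p - r₀ * p₀) * p ^ 2 + (r₀ * p₀) * (p ^ 2 - p₀ ^ 2) by ring]
    refine (abs_add_le _ _).trans ?_
    rw [abs_mul, abs_mul, abs_of_nonneg (sq_nonneg p)]
    have h1 := mul_le_mul hrp hp2K (sq_nonneg _) (by positivity)
    have h2 := mul_le_mul hrp₀b hp2 (abs_nonneg _) (by positivity)
    linarith
  have hA : |(G - p₀ ^ 2 * t ^ 2) * (r * p)| ≤ K ^ 2 * h ^ 3 * (R * K) := by
    rw [abs_mul]; exact mul_le_mul hG hrpb (abs_nonneg _) (by positivity)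
  have hB : |(p₀ ^ 2 * t ^ 2) * (r * p - r₀ * p₀)|
      ≤ K ^ 2 * h ^ 2 * ((R * K ^ 2 + R * K) * h) := by
    rw [abs_mul, abs_of_nonneg (by positivity : 0 ≤ p₀ ^ 2 * t ^ 2)]
    exact mul_le_mul (mul_le_mul hp₀2K ht2 (sq_nonneg _) (by positivity)) hrp (abs_nonneg _)
      (by positivity)
  have hC : |h ^ 2 / 12 * (r * p ^ 3 - r₀ * p₀ ^ 3)|
      ≤ h ^ 2 * ((3 * R * K ^ 3 + R * K ^ 4) * h) := by
    rw [abs_mul, abs_of_nonneg (by positivity : 0 ≤ h ^ 2 / 12)]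
    exact mul_le_mul (by linarith [sq_nonneg h]) hψ (abs_nonneg _) (by positivity)
  rw [show G * r * p - h ^ 2 / 12 * (r * p ^ 3) - r₀ * p₀ ^ 3 * (t ^ 2 - h ^ 2 / 12)
    = (G - p₀ ^ 2 * t ^ 2) * (r * p) + (p₀ ^ 2 * t ^ 2) * (r * p - r₀ * p₀)
      - h ^ 2 / 12 * (r * p ^ 3 - r₀ * p₀ ^ 3) by ring]
  refine (abs_sub _ _).trans ((add_le_add_left (abs_add_le _ _) _).trans ?_)
  linarith

lemma continuous_iInf_sq_sub {ι : Type*} [Fintype ι] [Nonempty ι] (x : ι → ℝ) :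
    Continuous fun y : ℝ => ⨅ i, (x i - y) ^ 2 := by
  simp_rw [← Finset.inf'_univ_eq_ciInf]
  exact Continuous.finset_inf'_apply _ fun i _ => by fun_prop

/-- The centred quadratic kernel has mean zero on its cell. -/
lemma integral_sq_sub_cell (a h : ℝ) :
    ∫ θ in a..a + h, ((θ - (a + h / 2)) ^ 2 - h ^ 2 / 12) = 0 := by
  have hder : ∀ θ ∈ Set.uIcc a (a + h),
      HasDerivAt (fun θ => (θ - (a + h / 2)) ^ 3 / 3 - h ^ 2 / 12 * θ)
        ((θ - (a + h / 2)) ^ 2 - h ^ 2 / 12) θ := by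
    intro θ _
    have h1 := ((((hasDerivAt_id θ).sub_const (a + h / 2)).pow 3).div_const 3).sub
      ((hasDerivAt_id θ).const_mul (h ^ 2 / 12))
    refine h1.congr_deriv ?_
    simp
  rw [intervalIntegral.integral_eq_sub_of_hasDerivAt hder
    (Continuous.intervalIntegrable (by fun_prop) _ _)]
  ring

lemma grid_succ (N k : ℕ) : grid N (k + 1) = (k : ℝ) / N + 1 / (N : ℝ) / 2 := by
  unfold grid; push_cast; ring

lemma abs_sub_grid_le {N k : ℕ} {θ : ℝ} (h1 : (k : ℝ) / N ≤ θ) (h2 : θ ≤ (k : ℝ) / N + 1 / N) :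
    |θ - grid N (k + 1)| ≤ 1 / (N : ℝ) / 2 := by
  rw [grid_succ, abs_le]
  constructor <;> linarith

lemma grid_succ_mem_Ioo {N k : ℕ} (hk : k < N) : grid N (k + 1) ∈ Set.Ioo (0 : ℝ) 1 := by
  have hN : (0 : ℝ) < N := by exact_mod_cast (Nat.zero_le k).trans_lt hk
  have hk' : (k : ℝ) + 1 ≤ N := by exact_mod_cast hk
  unfold grid
  constructor
  · apply div_pos _ hN; push_cast; linarith [Nat.cast_nonneg (α := ℝ) k]
  · rw [div_lt_one hN]; push_cast; linarith

/-- On the `k`-th cell the closest grid point is the centre of the cell. -/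
lemma abs_sub_grid_le_abs_sub_grid {N k : ℕ} (hN : 1 ≤ N) {θ : ℝ}
    (h1 : (k : ℝ) / N ≤ θ) (h2 : θ ≤ (k : ℝ) / N + 1 / N) (j : ℕ) :
    |θ - grid N (k + 1)| ≤ |θ - grid N (j + 1)| := by
  rcases eq_or_ne j k with rfl | hne
  · rfl
  have hN' : (0 : ℝ) < N := by exact_mod_cast hN
  refine (abs_sub_grid_le h1 h2).trans ?_
  rw [grid_succ]
  rcases lt_or_gt_of_ne hne with hlt | hlt
  · have : (j : ℝ) + 1 ≤ k := by exact_mod_cast hlt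
    have : ((j : ℝ) + 1) / N ≤ k / N := by gcongr
    rw [add_div] at this
    exact le_trans (by linarith) (le_abs_self _)
  · have : (k : ℝ) + 1 ≤ j := by exact_mod_cast hlt
    have : ((k : ℝ) + 1) / N ≤ j / N := by gcongr
    rw [add_div] at this
    exact le_trans (by linarith) (neg_le_abs _)

/-- The quantitative estimate, with an explicit constant. -/
lemma abs_discrete_sub_continuous_le {Kρ KX : ℝ} {ρ X : ℝ → ℝ} (hKρ : 0 < Kρ) (hKX : 0 < KX)
    (hρ : ContDiff ℝ 1 ρ) (hρ0 : ∀ y ∈ Set.Icc (0 : ℝ) 1, |ρ y| ≤ Kρ)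
    (hρ1 : ∀ y ∈ Set.Icc (0 : ℝ) 1, |deriv ρ y| ≤ Kρ)
    (hX : ContDiff ℝ 2 X) (hmono : MonotoneOn X (Set.Icc (0 : ℝ) 1))
    (hmaps : ∀ θ ∈ Set.Icc (0 : ℝ) 1, X θ ∈ Set.Icc (0 : ℝ) 1) (hX0 : X 0 = 0) (hX1 : X 1 = 1)
    (hb1 : ∀ θ ∈ Set.Icc (0 : ℝ) 1, |deriv X θ| ≤ KX)
    (hb2 : ∀ θ ∈ Set.Icc (0 : ℝ) 1, |deriv (deriv X) θ| ≤ KX) {N : ℕ} (hN : 1 ≤ N) :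
    |(N : ℝ) ^ 2 * (∫ y in (0 : ℝ)..1,
        (⨅ i : Fin N, (X (grid N ((i : ℕ) + 1)) - y) ^ 2) * ρ y)
      - (1 / 12) * ∫ θ in (0 : ℝ)..1, ρ (X θ) * (deriv X θ) ^ 3|
      ≤ (5 * Kρ * KX ^ 3 + 2 * Kρ * KX ^ 4) / (N : ℝ) := by
  have : Nonempty (Fin N) := ⟨⟨0, hN⟩⟩
  have hN' : (0 : ℝ) < N := by exact_mod_cast hN
  set C := 5 * Kρ * KX ^ 3 + 2 * Kρ * KX ^ 4 with hC
  set h : ℝ := 1 / N with hh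
  have hh0 : 0 ≤ h := by positivity
  have hh1 : h ≤ 1 := by rw [hh, div_le_one hN']; exact_mod_cast hN
  have hNh : (N : ℝ) * h = 1 := by rw [hh]; field_simp
  set G : ℝ → ℝ := fun y => ⨅ i : Fin N, (X (grid N ((i : ℕ) + 1)) - y) ^ 2 with hG
  have hGc : Continuous G := continuous_iInf_sq_sub _
  have hρc : Continuous ρ := hρ.continuous
  have hXc : Continuous X := hX.continuous
  have hXd : Differentiable ℝ X := hX.differentiable (by norm_num)
  have hX'1 : ContDiff ℝ 1 (deriv X) := ((contDiff_succ_iff_deriv (n := 1)).1 hX).2.2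
  have hX'c : Continuous (deriv X) := hX'1.continuous
  have hcov : ∫ y in (0 : ℝ)..1, G y * ρ y
      = ∫ θ in (0 : ℝ)..1, G (X θ) * ρ (X θ) * deriv X θ := by
    have := intervalIntegral.integral_comp_mul_deriv (a := 0) (b := 1) (f := X) (f' := deriv X)
      (g := fun y => G y * ρ y) (fun x _ => (hXd x).hasDerivAt) hX'c.continuousOn (hGc.mul hρc)
    rw [hX0, hX1] at this
    exact this.symm
  set D : ℝ → ℝ := fun θ =>
    G (X θ) * ρ (X θ) * deriv X θ - h ^ 2 / 12 * (ρ (X θ) * deriv X θ ^ 3) with hD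
  have hDc : Continuous D := by fun_prop
  have hcell : ∀ k < N, |∫ θ in ((k : ℝ) / N)..(((k + 1 : ℕ) : ℝ) / N), D θ| ≤ C * h ^ 3 * h := by
    intro k hk
    have hend : ((k + 1 : ℕ) : ℝ) / N = (k : ℝ) / N + h := by rw [hh]; push_cast; ring
    rw [hend]
    have hgrid : grid N (k + 1) = (k : ℝ) / N + h / 2 := grid_succ N k
    set c := grid N (k + 1) with hc
    have hcI : c ∈ Set.Ioo (0 : ℝ) 1 := grid_succ_mem_Ioo hk
    have hcI' := Set.Ioo_subset_Icc_self hcI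
    set A := ρ (X c) * deriv X c ^ 3 with hA
    have hpos : 0 ≤ deriv X c := by
      have := hmono.derivWithin_nonneg (x := c)
      rwa [derivWithin_of_mem_nhds (Icc_mem_nhds hcI.1 hcI.2)] at this
    have hshift : ∫ θ in ((k : ℝ) / N)..((k : ℝ) / N + h), D θ
        = ∫ θ in ((k : ℝ) / N)..((k : ℝ) / N + h), (D θ - A * ((θ - c) ^ 2 - h ^ 2 / 12)) := by
      rw [intervalIntegral.integral_sub (hDc.intervalIntegrable _ _)
        (Continuous.intervalIntegrable (by fun_prop) _ _), intervalIntegral.integral_const_mul,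
        hgrid, integral_sq_sub_cell, mul_zero, sub_zero]
    rw [hshift]
    refine (intervalIntegral.norm_integral_le_of_norm_le_const (C := C * h ^ 3)
      (f := fun θ => D θ - A * ((θ - c) ^ 2 - h ^ 2 / 12)) ?_).trans_eq ?_
    · intro θ hθ
      rw [Set.uIoc_of_le (by linarith)] at hθ
      have hθ1 : (k : ℝ) / N ≤ θ := hθ.1.le
      have hθI : θ ∈ Set.Icc (0 : ℝ) 1 := by
        refine ⟨le_trans (by positivity) hθ1, hθ.2.trans ?_⟩
        rw [← hend, div_le_one hN']
        exact_mod_cast hk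
      have hdist : |θ - c| ≤ h / 2 := abs_sub_grid_le hθ1 hθ.2
      have hdist' : |θ - c| ≤ h := by linarith
      have hXX : |X θ - X c| ≤ KX * h :=
        (abs_sub_le_of_abs_deriv_le (convex_Icc 0 1) hXd hb1 hθI hcI').trans (by gcongr)
      have hρρ : |ρ (X θ) - ρ (X c)| ≤ Kρ * KX * h := by
        refine (abs_sub_le_of_abs_deriv_le (convex_Icc 0 1) (hρ.differentiable (by norm_num)) hρ1
          (hmaps _ hθI) (hmaps _ hcI')).trans ?_
        rw [mul_assoc]
        gcongr
      have hpp : |deriv X θ - deriv X c| ≤ KX * h :=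
        (abs_sub_le_of_abs_deriv_le (convex_Icc 0 1) (hX'1.differentiable (by norm_num)) hb2
          hθI hcI').trans (by gcongr)
      have hGθ : |G (X θ) - deriv X c ^ 2 * (θ - c) ^ 2| ≤ KX ^ 2 * h ^ 3 :=
        abs_iInf_sq_sub_le (c := fun i : Fin N => grid N ((i : ℕ) + 1)) (i := ⟨k, hk⟩)
          hX hKX.le hh1 hmono hb1 hb2
          (fun j => Set.Ioo_subset_Icc_self (grid_succ_mem_Ioo j.2)) hθI hpos hdist
          (fun j => abs_sub_grid_le_abs_sub_grid hN hθ1 hθ.2 j)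
      exact abs_integrand_sub_le hh0 hKρ.le hKX.le hdist hGθ (hρ0 _ (hmaps _ hθI))
        (hρ0 _ (hmaps _ hcI')) (hb1 _ hθI) (hb1 _ hcI') hρρ hpp
    · rw [add_sub_cancel_left, abs_of_nonneg hh0]
  have hsum : |∫ θ in (0 : ℝ)..1, D θ| ≤ N * (C * h ^ 3 * h) := by
    have hadj := intervalIntegral.sum_integral_adjacent_intervals (f := D) (μ := volume)
      (a := fun k : ℕ => (k : ℝ) / N) (n := N) (fun k _ => hDc.intervalIntegrable _ _)
    simp only [Nat.cast_zero, zero_div, div_self hN'.ne'] at hadj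
    rw [← hadj]
    refine (Finset.abs_sum_le_sum_abs _ _).trans ?_
    refine (Finset.sum_le_card_nsmul _ _ (C * h ^ 3 * h)
      fun k hk => hcell k (Finset.mem_range.1 hk)).trans_eq ?_
    simp
  have hsplit : (N : ℝ) ^ 2 * (∫ y in (0 : ℝ)..1, G y * ρ y)
      - (1 / 12) * ∫ θ in (0 : ℝ)..1, ρ (X θ) * (deriv X θ) ^ 3
      = (N : ℝ) ^ 2 * ∫ θ in (0 : ℝ)..1, D θ := by
    rw [hcov, hD, intervalIntegral.integral_sub (Continuous.intervalIntegrable (by fun_prop) _ _)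
      (Continuous.intervalIntegrable (by fun_prop) _ _), intervalIntegral.integral_const_mul,
      mul_sub, ← mul_assoc ((N : ℝ) ^ 2) (h ^ 2 / 12),
      show (N : ℝ) ^ 2 * (h ^ 2 / 12) = (N * h) ^ 2 / 12 by ring, hNh]
    norm_num
  rw [hsplit, abs_mul, abs_of_nonneg (by positivity : (0 : ℝ) ≤ (N : ℝ) ^ 2)]
  refine (mul_le_mul_of_nonneg_left hsum (by positivity)).trans_eq ?_
  rw [show (N : ℝ) ^ 2 * (N * (C * h ^ 3 * h)) = (N * h) ^ 3 * (C * h) by ring, hNh, hh]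
  ring

theorem discrete_to_continuous_functional (Kρ KX : ℝ) (hKρ : 0 < Kρ) (hKX : 0 < KX) :
    -- `C` depends only on `‖ρ‖_{C¹}` and `‖X‖_{C²}`
    ∃ C : ℝ, 0 < C ∧
      ∀ (lam : ℝ), 0 < lam → lam ≤ 1 →
      ∀ (ρ X : ℝ → ℝ),
        -- `ρ ∈ C¹([0,1])` with `λ ≤ ρ ≤ 1/λ` and `‖ρ‖_{C¹} ≤ Kρ`
        ContDiff ℝ 1 ρ →
        (∀ y ∈ Set.Icc (0 : ℝ) 1, lam ≤ ρ y ∧ ρ y ≤ 1 / lam) →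
        (∀ k : ℕ, k ≤ 1 → ∀ y ∈ Set.Icc (0 : ℝ) 1, |iteratedDeriv k ρ y| ≤ Kρ) →
        -- `X : [0,1] → [0,1]` is `C²`, nondecreasing, `X(0) = 0`, `X(1) = 1`, `‖X‖_{C²} ≤ KX`
        ContDiff ℝ 2 X →
        MonotoneOn X (Set.Icc (0 : ℝ) 1) →
        (∀ θ ∈ Set.Icc (0 : ℝ) 1, X θ ∈ Set.Icc (0 : ℝ) 1) →
        X 0 = 0 → X 1 = 1 →
        (∀ k : ℕ, k ≤ 2 → ∀ θ ∈ Set.Icc (0 : ℝ) 1, |iteratedDeriv k X θ| ≤ KX) →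
        -- conclusion: quantitative convergence of `N² F_{N,2}` to the continuum functional
        (∀ N : ℕ, 1 ≤ N →
          |(N : ℝ) ^ 2 *
              (∫ y in (0 : ℝ)..1,
                (⨅ i : Fin N, (X (grid N ((i : ℕ) + 1)) - y) ^ 2) * ρ y)
            - (1 / 12) * ∫ θ in (0 : ℝ)..1, ρ (X θ) * (deriv X θ) ^ 3| ≤ C / (N : ℝ))
        -- in particular, `N² F_{N,2} → (1/12)∫₀¹ ρ(X)(∂_θX)³`
        ∧ Filter.Tendsto
            (fun N : ℕ => (N : ℝ) ^ 2 *
              ∫ y in (0 : ℝ)..1,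
                (⨅ i : Fin N, (X (grid N ((i : ℕ) + 1)) - y) ^ 2) * ρ y)
            Filter.atTop
            (nhds ((1 / 12) * ∫ θ in (0 : ℝ)..1, ρ (X θ) * (deriv X θ) ^ 3)) := by
  refine ⟨5 * Kρ * KX ^ 3 + 2 * Kρ * KX ^ 4, by positivity, ?_⟩
  intro lam _ _ ρ X hρ _ hρb hX hmono hmaps hX0 hX1 hXb
  have hbound : ∀ N : ℕ, 1 ≤ N → _ := fun N hN =>
    abs_discrete_sub_continuous_le hKρ hKX hρ
      (fun y hy => by simpa using hρb 0 (by norm_num) y hy)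
      (fun y hy => by simpa using hρb 1 le_rfl y hy) hX hmono hmaps hX0 hX1
      (fun θ hθ => by simpa using hXb 1 (by norm_num) θ hθ)
      (fun θ hθ => by simpa [iteratedDeriv_succ] using hXb 2 le_rfl θ hθ) hN
  refine ⟨hbound, ?_⟩
  rw [tendsto_iff_dist_tendsto_zero]
  refine squeeze_zero' (Filter.Eventually.of_forall fun _ => dist_nonneg) ?_
    (tendsto_const_div_atTop_nhds_zero_nat
      (5 * Kρ * KX ^ 3 + 2 * Kρ * KX ^ 4))
  filter_upwards [Filter.eventually_ge_atTop 1] with N hN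
  exact hbound N hN
end

section
/- Let λ ∈ (0,1] and ρ ∈ C^2([0,1]) with λ ≤ ρ ≤ 1/λ. Let X:[0,1]→ℝ be Lipschitz with 0 < c ≤ ∂_θX ≤ C almost everywhere, and let Y:[0,1]→ℝ be Lipschitz with Y(0)=Y(1)=0 and |∂_θY| ≤ C. If C^2‖ρ'‖_∞ ≤ λc and C^3‖ρ''‖_∞ + 3C^2‖ρ'‖_∞ ≤ 6λc, then the second variation of F at X in the direction Y is nonnegative: 6∫_0^1 ρ(X)∂_θX (∂_θY)^2 dθ + 6∫_0^1 ρ'(X)(∂_θX)^2 (∂_θY) Y dθ + ∫_0^1 ρ''(X)(∂_θX)^3 Y^2 dθ ≥ 0. -/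
open MeasureTheory

/-- A function continuous on a compact measurable set is essentially bounded there. -/
lemma ContinuousOn.memLp_top_restrict {f : ℝ → ℝ} {s : Set ℝ} (hs : IsCompact s)
    (hf : ContinuousOn f s) : MemLp f ⊤ (volume.restrict s) := by
  obtain ⟨M, hM⟩ := hs.exists_bound_of_continuousOn hf
  exact memLp_top_of_bound (hf.aestronglyMeasurable hs.measurableSet) M
    ((ae_restrict_iff' hs.measurableSet).2 (Filter.Eventually.of_forall hM))

/-- The square of an essentially bounded function is essentially bounded. -/
lemma MeasureTheory.MemLp.sq_top {α : Type*} [MeasurableSpace α] {μ : Measure α} {f : α → ℝ}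
    (hf : MemLp f ⊤ μ) : MemLp (fun x => f x ^ 2) ⊤ μ := by
  simpa only [pow_two] using hf.mul' (r := ⊤) hf

/-- Pointwise form of the Poincaré inequality for a function vanishing at the left endpoint. -/
lemma sq_le_mul_integral_deriv_sq {Y : ℝ → ℝ} {L : NNReal} {x : ℝ}
    (hx : 0 ≤ x) (hY : LipschitzOnWith L Y (Set.Icc 0 x)) (hY0 : Y 0 = 0)
    (hint : IntervalIntegrable (fun θ => deriv Y θ ^ 2) volume 0 x) :
    Y x ^ 2 ≤ x * ∫ θ in (0 : ℝ)..x, deriv Y θ ^ 2 := by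
  rcases hx.eq_or_lt with rfl | hx
  · simp [hY0]
  have hac : AbsolutelyContinuousOnInterval Y 0 x :=
    LipschitzOnWith.absolutelyContinuousOnInterval (by rwa [Set.uIcc_of_le hx.le])
  have hftc : ∫ θ in (0 : ℝ)..x, deriv Y θ = Y x := by
    rw [hac.integral_deriv_eq_sub, hY0, sub_zero]
  have hd : IntervalIntegrable (deriv Y) volume 0 x := hac.intervalIntegrable_deriv
  have hnonneg : 0 ≤ ∫ θ in (0 : ℝ)..x, (deriv Y θ - Y x / x) ^ 2 :=
    intervalIntegral.integral_nonneg hx.le fun _ _ => sq_nonneg _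
  have hexp : ∫ θ in (0 : ℝ)..x, (deriv Y θ - Y x / x) ^ 2
      = (∫ θ in (0 : ℝ)..x, deriv Y θ ^ 2) - Y x ^ 2 / x := by
    have : ∀ θ, (deriv Y θ - Y x / x) ^ 2
        = deriv Y θ ^ 2 - (2 * (Y x / x)) * deriv Y θ + (Y x / x) ^ 2 := fun θ => by ring
    simp only [this]
    rw [intervalIntegral.integral_add (hint.sub (hd.const_mul _)) intervalIntegrable_const,
      intervalIntegral.integral_sub hint (hd.const_mul _), intervalIntegral.integral_const_mul,
      hftc, intervalIntegral.integral_const, smul_eq_mul]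
    field_simp
    ring
  rw [hexp, sub_nonneg, div_le_iff₀ hx] at hnonneg
  linarith

/-- The Poincaré inequality on `[0, 1]` with constant `2`, for a Lipschitz function vanishing at
the left endpoint. -/
lemma two_mul_integral_sq_le_integral_deriv_sq {Y : ℝ → ℝ} {L : NNReal}
    (hY : LipschitzOnWith L Y (Set.Icc 0 1)) (hY0 : Y 0 = 0)
    (hint : IntervalIntegrable (fun θ => deriv Y θ ^ 2) volume 0 1) :
    2 * ∫ θ in (0 : ℝ)..1, Y θ ^ 2 ≤ ∫ θ in (0 : ℝ)..1, deriv Y θ ^ 2 := by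
  set a := ∫ θ in (0 : ℝ)..1, deriv Y θ ^ 2 with ha
  have hpt : ∀ x ∈ Set.Icc (0 : ℝ) 1, Y x ^ 2 ≤ x * a := fun x hx => by
    have hsub : Set.uIcc 0 x ⊆ Set.uIcc (0 : ℝ) 1 := by
      rw [Set.uIcc_of_le hx.1, Set.uIcc_of_le zero_le_one]
      exact Set.Icc_subset_Icc_right hx.2
    refine (sq_le_mul_integral_deriv_sq hx.1 (hY.mono (Set.Icc_subset_Icc_right hx.2)) hY0
      (hint.mono_set hsub)).trans (mul_le_mul_of_nonneg_left ?_ hx.1)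
    exact intervalIntegral.integral_mono_interval le_rfl hx.1 hx.2
      (Filter.Eventually.of_forall fun _ => sq_nonneg _) hint
  have hYsq : IntervalIntegrable (fun θ => Y θ ^ 2) volume 0 1 :=
    ContinuousOn.intervalIntegrable_of_Icc zero_le_one (hY.continuousOn.pow 2)
  have hle : ∫ θ in (0 : ℝ)..1, Y θ ^ 2 ≤ ∫ θ in (0 : ℝ)..1, θ * a :=
    intervalIntegral.integral_mono_on zero_le_one hYsq
      (by apply Continuous.intervalIntegrable; fun_prop) hpt
  rw [intervalIntegral.integral_mul_const, integral_id] at hle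
  linarith

theorem hessian_nonneg_small_rho (lam c C : ℝ)
    (hlam0 : 0 < lam) (hlam1 : lam ≤ 1) (hc : 0 < c) (hcC : c ≤ C)
    (ρ : ℝ → ℝ) (hρC2 : ContDiff ℝ 2 ρ)
    (hρbd : ∀ y ∈ Set.Icc (0 : ℝ) 1, lam ≤ ρ y ∧ ρ y ≤ 1 / lam)
    (X Y : ℝ → ℝ)
    -- `X` is Lipschitz, maps `[0,1]` into `[0,1]`, with `c ≤ ∂_θX ≤ C` a.e.
    (hXlip : ∃ L : NNReal, LipschitzOnWith L X (Set.Icc 0 1))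
    (hXrange : ∀ θ ∈ Set.Icc (0 : ℝ) 1, X θ ∈ Set.Icc (0 : ℝ) 1)
    (hX' : ∀ᵐ θ ∂(volume.restrict (Set.Icc (0 : ℝ) 1)),
      c ≤ deriv X θ ∧ deriv X θ ≤ C)
    -- `Y` is Lipschitz, vanishes at the boundary, with `|∂_θY| ≤ C` a.e.
    (hYlip : ∃ L : NNReal, LipschitzOnWith L Y (Set.Icc 0 1))
    (hY0 : Y 0 = 0) (hY1 : Y 1 = 0)
    (hY' : ∀ᵐ θ ∂(volume.restrict (Set.Icc (0 : ℝ) 1)), |deriv Y θ| ≤ C)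
    -- smallness of `ρ'` and `ρ''`:  `C²‖ρ'‖_∞ ≤ λc` and `C³‖ρ''‖_∞ + 3C²‖ρ'‖_∞ ≤ 6λc`
    (K1 K2 : ℝ)
    (hb1 : ∀ y ∈ Set.Icc (0 : ℝ) 1, |deriv ρ y| ≤ K1)
    (hb2 : ∀ y ∈ Set.Icc (0 : ℝ) 1, |deriv (deriv ρ) y| ≤ K2)
    (hsmall1 : C ^ 2 * K1 ≤ lam * c)
    (hsmall2 : C ^ 3 * K2 + 3 * C ^ 2 * K1 ≤ 6 * lam * c) :
    0 ≤ 6 * (∫ θ in (0 : ℝ)..1, ρ (X θ) * deriv X θ * (deriv Y θ) ^ 2)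
        + 6 * (∫ θ in (0 : ℝ)..1, deriv ρ (X θ) * (deriv X θ) ^ 2 * deriv Y θ * Y θ)
        + ∫ θ in (0 : ℝ)..1, deriv (deriv ρ) (X θ) * (deriv X θ) ^ 3 * (Y θ) ^ 2 := by
  obtain ⟨LX, hX⟩ := hXlip
  obtain ⟨LY, hY⟩ := hYlip
  set μ := volume.restrict (Set.Icc (0 : ℝ) 1) with hμ
  have hC : 0 < C := hc.trans_le hcC
  have h0 : (0 : ℝ) ∈ Set.Icc (0 : ℝ) 1 := ⟨le_rfl, zero_le_one⟩
  have hK1 : 0 ≤ K1 := (abs_nonneg _).trans (hb1 0 h0)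
  have hK2 : 0 ≤ K2 := (abs_nonneg _).trans (hb2 0 h0)
  have hρ1 : ContDiff ℝ 1 (deriv ρ) := hρC2.deriv'
  have hρ2 : Continuous (deriv (deriv ρ)) := hρ1.continuous_deriv le_rfl
  have mXd : MemLp (deriv X) ⊤ μ := by
    refine memLp_top_of_bound (measurable_deriv X).aestronglyMeasurable C ?_
    filter_upwards [hX'] with θ h
    rw [Real.norm_eq_abs, abs_of_nonneg (hc.le.trans h.1)]
    exact h.2
  have mYd : MemLp (deriv Y) ⊤ μ :=
    memLp_top_of_bound (measurable_deriv Y).aestronglyMeasurable C hY'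
  have mY : MemLp Y ⊤ μ := hY.continuousOn.memLp_top_restrict isCompact_Icc
  have mcomp {g : ℝ → ℝ} (hg : Continuous g) : MemLp (fun θ => g (X θ)) ⊤ μ :=
    (hg.comp_continuousOn hX.continuousOn).memLp_top_restrict isCompact_Icc
  have i1 : Integrable (fun θ => ρ (X θ) * deriv X θ * deriv Y θ ^ 2) μ :=
    ((mYd.sq_top).mul' (r := ⊤) (mXd.mul' (r := ⊤) (mcomp hρC2.continuous))).integrable le_top
  have i2 : Integrable (fun θ => deriv ρ (X θ) * deriv X θ ^ 2 * deriv Y θ * Y θ) μ :=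
    (mY.mul' (r := ⊤) (mYd.mul' (r := ⊤)
      (mXd.sq_top.mul' (r := ⊤) (mcomp hρ1.continuous)))).integrable le_top
  have mX3 : MemLp (fun θ => deriv X θ ^ 3) ⊤ μ := by
    simpa only [pow_succ _ 2] using mXd.mul' (r := ⊤) mXd.sq_top
  have i3 : Integrable (fun θ => deriv (deriv ρ) (X θ) * deriv X θ ^ 3 * Y θ ^ 2) μ :=
    (mY.sq_top.mul' (r := ⊤) (mX3.mul' (r := ⊤) (mcomp hρ2))).integrable le_top
  have iY : Integrable (fun θ => Y θ ^ 2) μ := mY.sq_top.integrable le_top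
  have iYd : Integrable (fun θ => deriv Y θ ^ 2) μ := mYd.sq_top.integrable le_top
  have hpoinc := two_mul_integral_sq_le_integral_deriv_sq hY hY0
    ((intervalIntegrable_iff_integrableOn_Icc_of_le zero_le_one).2 iYd)
  simp only [intervalIntegral.integral_of_le zero_le_one, ← integral_Icc_eq_integral_Ioc,
    ← hμ] at hpoinc ⊢
  have hmem : ∀ᵐ θ ∂μ, θ ∈ Set.Icc (0 : ℝ) 1 := ae_restrict_mem measurableSet_Icc
  have e1 : lam * c * ∫ θ, deriv Y θ ^ 2 ∂μ
      ≤ ∫ θ, ρ (X θ) * deriv X θ * deriv Y θ ^ 2 ∂μ := by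
    rw [← integral_const_mul]
    refine integral_mono_ae (iYd.const_mul _) i1 ?_
    filter_upwards [hX', hmem] with θ h hθ
    have hρ := (hρbd _ (hXrange θ hθ)).1
    exact mul_le_mul_of_nonneg_right
      (mul_le_mul hρ h.1 hc.le (hlam0.le.trans hρ)) (sq_nonneg _)
  have e2 : -(C ^ 2 * K1 / 2) * (∫ θ, deriv Y θ ^ 2 ∂μ) + -(C ^ 2 * K1 / 2) * (∫ θ, Y θ ^ 2 ∂μ)
      ≤ ∫ θ, deriv ρ (X θ) * deriv X θ ^ 2 * deriv Y θ * Y θ ∂μ := by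
    rw [← integral_const_mul, ← integral_const_mul,
      ← integral_add (iYd.const_mul _) (iY.const_mul _)]
    refine integral_mono_ae ((iYd.const_mul _).add (iY.const_mul _)) i2 ?_
    filter_upwards [hX', hmem] with θ h hθ
    have hd : 0 ≤ deriv X θ := hc.le.trans h.1
    have hcoef : |deriv ρ (X θ) * deriv X θ ^ 2| ≤ C ^ 2 * K1 := by
      rw [abs_mul, abs_of_nonneg (sq_nonneg (deriv X θ)), mul_comm]
      exact mul_le_mul (pow_le_pow_left₀ hd h.2 2) (hb1 _ (hXrange θ hθ)) (abs_nonneg _)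
        (sq_nonneg _)
    obtain ⟨hl, hu⟩ := abs_le.1 hcoef
    nlinarith [mul_nonneg (sub_nonneg.2 hu) (sq_nonneg (deriv Y θ - Y θ)),
      mul_nonneg (neg_le_iff_add_nonneg.1 hl) (sq_nonneg (deriv Y θ + Y θ))]
  have e3 : -(C ^ 3 * K2) * (∫ θ, Y θ ^ 2 ∂μ)
      ≤ ∫ θ, deriv (deriv ρ) (X θ) * deriv X θ ^ 3 * Y θ ^ 2 ∂μ := by
    rw [← integral_const_mul]
    refine integral_mono_ae (iY.const_mul _) i3 ?_
    filter_upwards [hX', hmem] with θ h hθ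
    have hd : 0 ≤ deriv X θ := hc.le.trans h.1
    have hcoef : |deriv (deriv ρ) (X θ) * deriv X θ ^ 3| ≤ C ^ 3 * K2 := by
      rw [abs_mul, abs_of_nonneg (pow_nonneg hd 3), mul_comm]
      exact mul_le_mul (pow_le_pow_left₀ hd h.2 3) (hb2 _ (hXrange θ hθ)) (abs_nonneg _)
        (by positivity)
    exact mul_le_mul_of_nonneg_right (abs_le.1 hcoef).1 (sq_nonneg _)
  have hb : 0 ≤ ∫ θ, Y θ ^ 2 ∂μ := integral_nonneg fun _ => sq_nonneg _
  have ha : 0 ≤ ∫ θ, deriv Y θ ^ 2 ∂μ := integral_nonneg fun _ => sq_nonneg _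
  nlinarith [mul_nonneg (sub_nonneg.2 hsmall1) ha, mul_nonneg (sub_nonneg.2 hsmall2) hb,
    mul_nonneg (mul_pos hlam0 hc).le (sub_nonneg.2 hpoinc)]
end
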